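/- Let ε > 0 and let γ : (−ε, ε) × ℝ/ℤ → ℝ/ℤ be a C^∞ map such that each γ_t = γ(t, ·) belongs to Diff^∞(ℝ/ℤ), γ_0 = id, and ∂γ/∂t (t, x) < 0 for all t and x (computed in a lift). Let a_0 ∈ Diff^∞(ℝ/ℤ) have Diophantine rotation number ρ(a_0). Then for every k ∈ ℕ and ε' > 0 there exist k' ∈ ℕ and δ > 0 such that: for every a ∈ Diff^∞(ℝ/ℤ) with ‖a − a_0‖_{C^{k'}} < δ, there exist t ∈ ℝ with |t| < ε' and b ∈ Diff^∞(ℝ/ℤ) with ‖b − id‖_{C^k} < ε' such that a = γ_t ∘ b ∘ a_0 ∘ b⁻¹. -/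

import Mathlib

open Filter Topology Set

noncomputable section

/-- The circle ℝ/ℤ. -/
abbrev S1 := AddCircle (1 : ℝ)

/-- `F : ℝ → ℝ` is a lift of the circle map `f`: it is C^∞, commutes with the unit
translation, has everywhere positive derivative, and descends to `f` on ℝ/ℤ. -/
def IsLift (f : Equiv.Perm S1) (F : ℝ → ℝ) : Prop :=
  ContDiff ℝ (⊤ : ℕ∞) F ∧ (∀ x, F (x + 1) = F x + 1) ∧ (∀ x, 0 < deriv F x) ∧
    ∀ x : ℝ, f (x : S1) = ((F x : ℝ) : S1)

/-- `f` is an orientation preserving C^∞ diffeomorphism of ℝ/ℤ. -/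
def HasLift (f : Equiv.Perm S1) : Prop := ∃ F, IsLift f F

/-- max over 0 ≤ j ≤ k of sup over x of |F^(j)(x) - G^(j)(x)|. -/
noncomputable def liftDist (k : ℕ) (F G : ℝ → ℝ) : ℝ :=
  ⨆ j : Fin (k + 1), ⨆ x : ℝ, |iteratedDeriv (j : ℕ) F x - iteratedDeriv (j : ℕ) G x|

/-- The C^k distance between two smooth circle diffeomorphisms: infimum over lifts. -/
noncomputable def distC (k : ℕ) (f g : Equiv.Perm S1) : ℝ :=
  sInf {d | ∃ F G, IsLift f F ∧ IsLift g G ∧ d = liftDist k F G}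

/-- `f` is recurrent: for every k and ε > 0 there are arbitrarily large n ≥ 1 with
‖f^n − id‖_{C^k} < ε. -/
def Recurrent (f : Equiv.Perm S1) : Prop :=
  ∀ k : ℕ, ∀ ε : ℝ, 0 < ε → ∀ N : ℕ, ∃ n : ℕ, N ≤ n ∧ 1 ≤ n ∧ distC k (f ^ n) 1 < ε

/-- The word length of `g` with respect to the generating set `S`: the least `k` such that
`g` is a product of `k` elements of `S ∪ S⁻¹`. -/
noncomputable def wordLength (S : Set (Equiv.Perm S1)) (g : Equiv.Perm S1) : ℕ :=
  sInf {k | ∃ l : List (Equiv.Perm S1),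
    l.length = k ∧ (∀ x ∈ l, x ∈ S ∨ x⁻¹ ∈ S) ∧ l.prod = g}

/-- The rotation by `t` on ℝ/ℤ, `x ↦ x + t`. -/
def rot (t : S1) : Equiv.Perm S1 := Equiv.addRight t

/-- `f` is a distortion element of Diff^∞(ℝ/ℤ). -/
def IsDistortion (f : Equiv.Perm S1) : Prop :=
  ∃ S : Finset (Equiv.Perm S1), (∀ g ∈ S, HasLift g) ∧
    f ∈ Subgroup.closure (S : Set (Equiv.Perm S1)) ∧
    Tendsto (fun n : ℕ => (wordLength (S : Set (Equiv.Perm S1)) (f ^ n) : ℝ) / n)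
      atTop (nhds 0)

/-- The open arc in ℝ/ℤ which is the image of the interval `(a,b)`. -/
def arcOO (a b : ℝ) : Set S1 := (fun x : ℝ => (x : S1)) '' Set.Ioo a b

/-- The closed arc in ℝ/ℤ which is the image of the interval `[a,b]`. -/
def arcCC (a b : ℝ) : Set S1 := (fun x : ℝ => (x : S1)) '' Set.Icc a b

/-- `f` is supported on `U`: it is the identity outside `U`. -/
def SupportedOn (f : Equiv.Perm S1) (U : Set S1) : Prop := ∀ x : S1, x ∉ U → f x = x

/-- `f` has rotation number `t ∈ ℝ/ℤ`. -/
def HasRotNum (f : Equiv.Perm S1) (t : S1) : Prop :=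
  ∃ F : ℝ → ℝ, ∃ τ : ℝ, IsLift f F ∧ ((τ : ℝ) : S1) = t ∧
    Tendsto (fun n : ℕ => F^[n] 0 / n) atTop (nhds τ)

/-- A real number is Diophantine. -/
def DiophantineReal (t : ℝ) : Prop :=
  ∃ C : ℝ, 0 < C ∧ ∃ n : ℕ, 0 < n ∧ ∀ p q : ℤ, q ≠ 0 →
    C / |(q : ℝ)| ^ n < |(q : ℝ) * t - (p : ℝ)|

/-- An element of ℝ/ℤ is Diophantine if some (equivalently, every) lift is. -/
def Diophantine (t : S1) : Prop := ∃ τ : ℝ, (τ : S1) = t ∧ DiophantineReal τ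



local notation "𝒟" => iteratedDeriv
abbrev Sm (u : ℝ → ℝ) : Prop := ContDiff ℝ (⊤ : ℕ∞) u

theorem Sm.deriv' {u : ℝ → ℝ} (h : Sm u) : Sm (deriv u) := (contDiff_infty_iff_deriv.mp h).2
theorem Sm.iter {u : ℝ → ℝ} (h : Sm u) (j : ℕ) : Sm (𝒟 j u) := by
  rw [iteratedDeriv_eq_iterate]; exact h.iterate_deriv j
theorem Sm.diff {u : ℝ → ℝ} (h : Sm u) : Differentiable ℝ u := (contDiff_infty_iff_deriv.mp h).1
theorem Sm.cat {u : ℝ → ℝ} (h : Sm u) (n : ℕ) (x : ℝ) : ContDiffAt ℝ n u x :=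
  (h.of_le (by exact_mod_cast le_top)).contDiffAt
theorem Sm.hda {u : ℝ → ℝ} (h : Sm u) (j : ℕ) (x : ℝ) : HasDerivAt (𝒟 j u) (𝒟 (j+1) u x) x := by
  rw [iteratedDeriv_succ]; exact ((h.iter j).diff x).hasDerivAt

theorem prodG {u v : ℝ → ℝ} (hu : Sm u) (hv : Sm v) {k : ℕ} {B lam x : ℝ}
    (h : ∀ i j, i + j ≤ k → |𝒟 i u x| * |𝒟 j v x| ≤ B * lam ^ (i+j)) (a : ℕ) (ha : a ≤ k) :
    |𝒟 a (fun y => u y * v y) x| ≤ 2 ^ a * B * lam ^ a := by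
  have := iteratedDeriv_mul (hu.cat a x) (hv.cat a x)
  have e : (fun y => u y * v y) = u * v := rfl
  rw [e, this]
  refine (Finset.abs_sum_le_sum_abs _ _).trans ?_
  have h2 : ∀ i ∈ Finset.range (a+1), |(a.choose i : ℝ) * 𝒟 i u x * 𝒟 (a - i) v x|
      ≤ a.choose i * (B * lam ^ a) := by
    intro i hi
    have hi' : i ≤ a := by simpa [Nat.lt_succ_iff] using hi
    rw [abs_mul, abs_mul, Nat.abs_cast, mul_assoc]
    have := h i (a-i) (by omega)
    rw [show i + (a - i) = a by omega] at this
    gcongr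
  refine (Finset.sum_le_sum h2).trans ?_
  rw [← Finset.sum_mul]
  have : (∑ i ∈ Finset.range (a+1), (a.choose i : ℝ)) = 2 ^ a := by
    exact_mod_cast Nat.sum_range_choose a
  rw [this, mul_assoc]

theorem compG (k : ℕ) (K : ℝ) (hK : 0 ≤ K) : ∃ C : ℝ, 1 ≤ C ∧ ∀ w G : ℝ → ℝ, Sm w → Sm G →
    ∀ x A p lam : ℝ, 0 ≤ A → 0 ≤ p → 0 ≤ lam →
    (∀ a ≤ k, |𝒟 a w (G x)| ≤ A * p ^ a) →
    (∀ a < k, p * |𝒟 a (deriv G) x| ≤ K * lam ^ (a+1)) →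
    ∀ a ≤ k, |𝒟 a (fun y => w (G y)) x| ≤ C * A * lam ^ a := by
  induction k with
  | zero =>
    refine ⟨1, le_rfl, fun w G hw hG x A p lam hA hp hl h1 h2 a ha => ?_⟩
    obtain rfl : a = 0 := by omega
    simpa using h1 0 le_rfl
  | succ k ih =>
    obtain ⟨C, hC, ih⟩ := ih
    refine ⟨max 1 (2 ^ k * C * K), le_max_left _ _,
      fun w G hw hG x A p lam hA hp hl h1 h2 a ha => ?_⟩
    rcases a with _ | a
    · have := h1 0 (by omega)
      simp only [pow_zero, mul_one, iteratedDeriv_zero] at this ⊢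
      exact this.trans (le_mul_of_one_le_left hA (le_max_left _ _))
    · have e : deriv (fun y => w (G y)) = fun y => deriv w (G y) * deriv G y := by
        ext y
        exact ((hw.diff (G y)).hasDerivAt.comp y (hG.diff y).hasDerivAt).deriv
      rw [iteratedDeriv_succ', e]
      have hi := ih (deriv w) G hw.deriv' hG x (A * p) p lam (by positivity) hp hl
        (fun a ha => by
          rw [← iteratedDeriv_succ']
          refine (h1 (a+1) (by omega)).trans (le_of_eq (by ring)))
        (fun a ha => h2 a (by omega))
      have := prodG (u := fun y => deriv w (G y)) (v := deriv G) (hw.deriv'.comp hG) hG.deriv'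
        (k := k) (B := C * A * K * lam) (lam := lam) (x := x) (fun i j hij => by
          calc _ ≤ (C * (A * p) * lam ^ i) * |𝒟 j (deriv G) x| := by
                gcongr; exact hi i (by omega)
            _ = (C * A * lam ^ i) * (p * |𝒟 j (deriv G) x|) := by ring
            _ ≤ (C * A * lam ^ i) * (K * lam ^ (j+1)) := by
                exact mul_le_mul_of_nonneg_left (h2 j (by omega)) (by positivity)
            _ = _ := by ring) a (by omega)
      refine this.trans ?_
      calc _ = (2 ^ a * C * K) * A * lam ^ (a+1) := by ring
        _ ≤ (2 ^ k * C * K) * A * lam ^ (a+1) := by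
            gcongr
            · norm_num
            · omega
        _ ≤ _ := by gcongr; exact le_max_right _ _

theorem expG (k : ℕ) (K : ℝ) (hK : 0 ≤ K) : ∃ C : ℝ, 1 ≤ C ∧ ∀ L : ℝ → ℝ, Sm L →
    ∀ x lam : ℝ, 0 ≤ lam → (∀ a, 1 ≤ a → a ≤ k → |𝒟 a L x| ≤ K * lam ^ a) →
    ∀ a ≤ k, |𝒟 a (fun y => Real.exp (L y)) x| ≤ C * Real.exp (L x) * lam ^ a := by
  induction k with
  | zero =>
    refine ⟨1, le_rfl, fun L hL x lam hl h a ha => ?_⟩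
    obtain rfl : a = 0 := by omega
    simp
  | succ k ih =>
    obtain ⟨C, hC, ih⟩ := ih
    refine ⟨max C (2 ^ k * C * K), hC.trans (le_max_left _ _), fun L hL x lam hl h a ha => ?_⟩
    have hi := ih L hL x lam hl (fun a h1 h2 => h a h1 (by omega))
    rcases Nat.lt_or_ge a (k+1) with h3 | h3
    · refine (hi a (by omega)).trans ?_
      gcongr; exact le_max_left _ _
    · obtain rfl : a = k + 1 := by omega
      have e : deriv (fun y => Real.exp (L y)) = fun y => Real.exp (L y) * deriv L y := by
        ext y
        exact ((hL.diff y).hasDerivAt.exp).deriv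
      rw [iteratedDeriv_succ', e]
      have := prodG (u := fun y => Real.exp (L y)) (v := deriv L) hL.exp hL.deriv'
        (k := k) (B := C * Real.exp (L x) * K * lam) (lam := lam) (x := x) (fun i j hij => by
          rw [← iteratedDeriv_succ']
          calc _ ≤ (C * Real.exp (L x) * lam ^ i) * (K * lam ^ (j+1)) := by
                gcongr
                · exact hi i (by omega)
                · exact h (j+1) (by omega) (by omega)
            _ = _ := by ring) k le_rfl
      refine this.trans ?_
      calc _ = (2 ^ k * C * K) * Real.exp (L x) * lam ^ (k+1) := by ring
        _ ≤ _ := by gcongr; exact le_max_right _ _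

theorem explog1 (k : ℕ) (E : ℝ) (hE : 0 ≤ E) : ∃ C : ℝ, 1 ≤ C ∧ ∀ L : ℝ → ℝ, Sm L →
    ∀ x lam e : ℝ, 0 ≤ lam → 0 ≤ e → e ≤ E → (∀ a ≤ k, |𝒟 a L x| ≤ e * lam ^ a) →
    ∀ a ≤ k, |𝒟 a (fun y => Real.exp (L y) - 1) x| ≤ C * e * lam ^ a := by
  obtain ⟨C, hC, hh⟩ := expG k E hE
  refine ⟨2 ^ k * C * Real.exp E, ?_, fun L hL x lam e hl he heE h a ha => ?_⟩
  · have h1 : (1:ℝ) ≤ 2 ^ k := one_le_pow₀ (by norm_num)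
    have h2 : 1 ≤ Real.exp E := Real.one_le_exp hE
    nlinarith [one_le_mul_of_one_le_of_one_le h1 hC]
  have h0 : |L x| ≤ e := by simpa using h 0 (by omega)
  have hLE : Real.exp (L x) ≤ Real.exp E := Real.exp_le_exp.2 ((abs_le.1 h0).2.trans heE)
  have h1 := hh L hL x lam hl (fun a h1 h2 => (h a h2).trans (by gcongr))
  have hk : (1:ℝ) ≤ 2 ^ k := one_le_pow₀ (by norm_num)
  rcases a with _ | a
  · simp only [iteratedDeriv_zero, pow_zero, mul_one]
    have : |Real.exp (L x) - 1| ≤ Real.exp E * e := by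
      have h4 := Real.add_one_le_exp (L x)
      have h5 := Real.add_one_le_exp (-L x)
      have h6 : Real.exp (L x) * Real.exp (-L x) = 1 := by rw [← Real.exp_add]; simp
      have h7 := Real.exp_pos (L x)
      have h8 : 1 ≤ Real.exp E := Real.one_le_exp hE
      rw [abs_le] at h0 ⊢
      constructor
      · nlinarith
      · have : Real.exp (L x) - 1 ≤ Real.exp (L x) * L x := by nlinarith
        nlinarith
    refine this.trans ?_
    have : 1 * 1 * Real.exp E ≤ 2 ^ k * C * Real.exp E := by gcongr
    nlinarith
  · have e1 : deriv (fun y => Real.exp (L y) - 1) = fun y => Real.exp (L y) * deriv L y := by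
      ext y
      exact ((hL.diff y).hasDerivAt.exp.sub_const 1).deriv
    rw [iteratedDeriv_succ', e1]
    have := prodG (u := fun y => Real.exp (L y)) (v := deriv L) hL.exp hL.deriv'
      (k := a) (B := C * Real.exp E * e * lam) (lam := lam) (x := x) (fun i j hij => by
        rw [← iteratedDeriv_succ']
        calc _ ≤ (C * Real.exp (L x) * lam ^ i) * (e * lam ^ (j+1)) := by
              gcongr
              · exact h1 i (by omega)
              · exact h (j+1) (by omega)
          _ ≤ (C * Real.exp E * lam ^ i) * (e * lam ^ (j+1)) := by gcongr
          _ = _ := by ring) a le_rfl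
    refine this.trans ?_
    calc _ = (2 ^ a * C * Real.exp E) * e * lam ^ (a+1) := by ring
      _ ≤ _ := by
        gcongr
        · norm_num
        · omega

theorem explog2 (k : ℕ) (E : ℝ) (hE : 0 ≤ E) : ∃ C : ℝ, 1 ≤ C ∧ ∀ L : ℝ → ℝ, Sm L →
    ∀ x lam e : ℝ, 0 ≤ lam → 0 ≤ e → e ≤ E → -E ≤ L x →
    (∀ a ≤ k, |𝒟 a (fun y => Real.exp (L y) - 1) x| ≤ e * lam ^ a) →
    ∀ a, 1 ≤ a → a ≤ k → |𝒟 a L x| ≤ C * e * lam ^ a := by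
  induction k with
  | zero =>
    exact ⟨1, le_rfl, fun L hL x lam e hl he heE hx h a ha ha' => absurd ha (by omega)⟩
  | succ k ih =>
    obtain ⟨C, hC, ih⟩ := ih
    obtain ⟨C2, hC2, hh⟩ := expG k (C * E) (by positivity)
    refine ⟨max C (2 ^ k * C2 * Real.exp E), hC.trans (le_max_left _ _),
      fun L hL x lam e hl he heE hx h a ha ha' => ?_⟩
    have hi := ih L hL x lam e hl he heE hx (fun a h2 => h a (by omega))
    rcases Nat.lt_or_ge a (k+1) with h3 | h3
    · refine (hi a ha (by omega)).trans ?_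
      gcongr; exact le_max_left _ _
    · obtain rfl : a = k + 1 := by omega
      have h1 := hh (fun y => - L y) hL.neg x lam hl (fun a h1 h2 => by
        have : 𝒟 a (fun y => - L y) x = - 𝒟 a L x := iteratedDeriv_neg a L x
        rw [this, abs_neg]
        exact (hi a h1 h2).trans (by gcongr))
      have e1 : deriv L =
          fun y => Real.exp (- L y) * deriv (fun y => Real.exp (L y) - 1) y := by
        ext y
        rw [((hL.diff y).hasDerivAt.exp.sub_const 1).deriv, ← mul_assoc, ← Real.exp_add]; simp
      rw [iteratedDeriv_succ', e1]
      have hs : Sm (fun y => Real.exp (L y) - 1) := hL.exp.sub contDiff_const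
      have := prodG (u := fun y => Real.exp (- L y)) (v := deriv (fun y => Real.exp (L y) - 1))
        hL.neg.exp hs.deriv'
        (k := k) (B := C2 * Real.exp E * e * lam) (lam := lam) (x := x) (fun i j hij => by
          rw [← iteratedDeriv_succ']
          calc _ ≤ (C2 * Real.exp (-L x) * lam ^ i) * (e * lam ^ (j+1)) := by
                gcongr
                · exact h1 i (by omega)
                · exact h (j+1) (by omega)
            _ ≤ (C2 * Real.exp E * lam ^ i) * (e * lam ^ (j+1)) := by gcongr; linarith
            _ = _ := by ring) k le_rfl
      refine this.trans ?_
      calc _ = (2 ^ k * C2 * Real.exp E) * e * lam ^ (k+1) := by ring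
        _ ≤ _ := by gcongr; exact le_max_right _ _

theorem tayG (r : ℕ) : ∀ u : ℝ → ℝ, Sm u → ∀ x t K : ℝ,
    (∀ y ∈ Icc x (x+t), |𝒟 r u y| ≤ K) → ∀ s ∈ Icc 0 t,
    |u (x+s) - ∑ j ∈ Finset.range r, 𝒟 j u x / (j.factorial : ℝ) * s ^ j| ≤ K * s ^ r := by
  induction r with
  | zero =>
    intro u hu x t K h s hs
    simpa using h (x+s) ⟨by linarith [hs.1], by linarith [hs.2]⟩
  | succ r ih =>
    intro u hu x t K h s hs
    have hi := ih (deriv u) hu.deriv' x t K (by simpa only [← iteratedDeriv_succ'] using h)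
    rcases hs.1.eq_or_lt with h0 | h0
    · subst h0
      simp [Finset.sum_range_succ']
    set e : ℝ → ℝ := fun s => u (x+s) - ∑ j ∈ Finset.range (r+1), 𝒟 j u x / (j.factorial : ℝ) * s ^ j
    have hd : ∀ y, HasDerivAt e (deriv u (x+y) -
        ∑ j ∈ Finset.range r, 𝒟 j (deriv u) x / (j.factorial : ℝ) * y ^ j) y := by
      intro y
      have h1 : HasDerivAt (fun s => u (x+s)) (deriv u (x+y)) y := by
        simpa using ((hu.diff (x+y)).hasDerivAt.comp_const_add x y)
      have h2 : HasDerivAt (fun s => ∑ j ∈ Finset.range (r+1), 𝒟 j u x / (j.factorial : ℝ) * s ^ j)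
          (∑ j ∈ Finset.range (r+1), 𝒟 j u x / (j.factorial : ℝ) * (j * y ^ (j-1))) y :=
        HasDerivAt.fun_sum fun j _ => (hasDerivAt_pow j y).const_mul _
      refine (h1.sub h2).congr_deriv ?_
      rw [Finset.sum_range_succ']
      simp only [Nat.cast_zero, zero_mul, mul_zero, add_zero]
      congr 1
      refine Finset.sum_congr rfl fun j _ => ?_
      rw [← iteratedDeriv_succ', Nat.factorial_succ]
      have : (j.factorial : ℝ) ≠ 0 := by positivity
      push_cast
      field_simp
    obtain ⟨c, hc, hc'⟩ := exists_hasDerivAt_eq_slope e _ h0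
      (fun y _ => (hd y).continuousAt.continuousWithinAt) (fun y _ => hd y)
    have he0 : e 0 = 0 := by simp [e, Finset.sum_range_succ']
    have hK : 0 ≤ K := (abs_nonneg _).trans (h x ⟨le_rfl, by linarith [hs.2]⟩)
    have h5 := hi c ⟨hc.1.le, hc.2.le.trans hs.2⟩
    rw [hc', he0, sub_zero, sub_zero, abs_div, abs_of_pos h0, div_le_iff₀ h0] at h5
    refine h5.trans ?_
    rw [pow_succ, ← mul_assoc]
    have := hc.1.le
    have := hc.2.le
    gcongr

theorem INT (r : ℕ) : ∃ C : ℝ, 1 ≤ C ∧ ∀ u : ℝ → ℝ, Sm u → ∀ x t U K : ℝ, 0 < t →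
    (∀ y ∈ Icc x (x+t), |u y| ≤ U) → (∀ y ∈ Icc x (x+t), |𝒟 r u y| ≤ K) →
    ∀ j < r, |𝒟 j u x| * t ^ j ≤ C * (U + K * t ^ r) := by
  let v : Fin r → ℝ := fun i => (i:ℝ) / r
  let V := Matrix.vandermonde v
  have hdet : IsUnit V.det := by
    rw [isUnit_iff_ne_zero]
    refine Matrix.det_vandermonde_ne_zero_iff.2 fun i j hij => ?_
    have : (r:ℝ) ≠ 0 := by have := i.2; exact_mod_cast (by omega : r ≠ 0)
    simp only [v] at hij
    field_simp at hij
    exact Fin.ext (by exact_mod_cast hij)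
  refine ⟨1 + r.factorial * ∑ i, ∑ j, |V⁻¹ i j|,
    by simp only [le_add_iff_nonneg_right]; positivity, ?_⟩
  intro u hu x t U K ht hU hK j hj
  let c : Fin r → ℝ := fun j => 𝒟 j u x / ((j:ℕ).factorial : ℝ) * t ^ (j:ℕ)
  have hK0 : 0 ≤ K := (abs_nonneg _).trans (hK x ⟨le_rfl, by linarith⟩)
  have hU0 : 0 ≤ U := (abs_nonneg _).trans (hU x ⟨le_rfl, by linarith⟩)
  have hb : ∀ i, |V.mulVec c i| ≤ U + K * t ^ r := by
    intro i
    have hr : (0:ℝ) < r := by have := i.2; exact_mod_cast (by omega : 0 < r)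
    have hv0 : 0 ≤ v i := by positivity
    have hv1 : v i ≤ 1 := by
      simp only [v]; rw [div_le_one hr]; exact_mod_cast i.2.le
    have hs : v i * t ∈ Icc 0 t := ⟨by positivity, by nlinarith⟩
    have h1 := tayG r u hu x t K hK (v i * t) hs
    have h2 : V.mulVec c i = ∑ j ∈ Finset.range r, 𝒟 j u x / (j.factorial : ℝ) * (v i * t) ^ j := by
      rw [Finset.sum_range]
      simp only [Matrix.mulVec, dotProduct, V, Matrix.vandermonde_apply, c, mul_pow]
      exact Finset.sum_congr rfl fun j _ => by ring
    rw [← h2] at h1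
    have h3 := hU (x + v i * t) ⟨by linarith [hs.1], by linarith [hs.2]⟩
    have h4 : K * (v i * t) ^ r ≤ K * t ^ r := by
      gcongr; exact hs.2
    rw [abs_le] at *
    constructor <;> linarith
  have hc : c = V⁻¹.mulVec (V.mulVec c) := by
    rw [Matrix.mulVec_mulVec, Matrix.nonsing_inv_mul _ hdet, Matrix.one_mulVec]
  have h5 : |c ⟨j, hj⟩| ≤ (∑ i, ∑ j, |V⁻¹ i j|) * (U + K * t ^ r) := by
    rw [hc]
    rw [Matrix.mulVec, dotProduct]
    refine (Finset.abs_sum_le_sum_abs _ _).trans ?_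
    calc _ ≤ ∑ i, |V⁻¹ ⟨j, hj⟩ i| * (U + K * t ^ r) := by
          refine Finset.sum_le_sum fun i _ => ?_
          rw [abs_mul]; gcongr; exact hb i
      _ = (∑ i, |V⁻¹ ⟨j, hj⟩ i|) * (U + K * t ^ r) := by rw [Finset.sum_mul]
      _ ≤ _ := by
        refine mul_le_mul_of_nonneg_right ?_ (by positivity)
        exact Finset.single_le_sum (f := fun i => ∑ j, |V⁻¹ i j|) (fun i _ => by positivity)
          (Finset.mem_univ _)
  have h6 : |𝒟 j u x| * t ^ j = j.factorial * |c ⟨j, hj⟩| := by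
    simp only [c, abs_mul, abs_div, Nat.abs_cast, abs_of_pos (pow_pos ht j)]
    have : (j.factorial : ℝ) ≠ 0 := by positivity
    field_simp
  rw [h6]
  have h7 : (j.factorial : ℝ) ≤ r.factorial := by exact_mod_cast Nat.factorial_le hj.le
  calc _ ≤ (r.factorial : ℝ) * ((∑ i, ∑ j, |V⁻¹ i j|) * (U + K * t ^ r)) := by gcongr
    _ ≤ _ := by
      rw [← mul_assoc]; gcongr; linarith


structure CF (α : ℝ) (q : ℕ → ℕ) (p : ℕ → ℤ) (β : ℕ → ℝ) : Prop where
  q0 : q 0 = 1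
  q1 : 1 ≤ q 1
  bd : ∀ n, β n = (-1) ^ n * (q n * α - p n)
  bpos : ∀ n, 0 < β n
  blt : ∀ n, β (n+1) < β n
  st : ∀ n, ∃ a : ℕ, 1 ≤ a ∧ q (n+2) = a * q (n+1) + q n ∧ p (n+2) = a * p (n+1) + p n
  one : ∀ n, q n * β (n+1) + q (n+1) * β n = 1
  irr : Irrational α

structure CFs where
  q : ℕ
  p : ℤ
  b : ℝ
  q' : ℕ
  p' : ℤ
  b' : ℝ

def CFs.step (s : CFs) : CFs :=
  ⟨s.q', s.p', s.b', ⌊s.b / s.b'⌋₊ * s.q' + s.q, ⌊s.b / s.b'⌋₊ * s.p' + s.p,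
    s.b - ⌊s.b / s.b'⌋₊ * s.b'⟩

theorem exists_CF {α : ℝ} (hα : Irrational α) : ∃ q p β, CF α q p β := by
  let s : ℕ → CFs := fun n => CFs.step^[n] ⟨0, 1, 1, 1, ⌊α⌋, Int.fract α⟩
  have hs : ∀ n, s (n+1) = (s n).step := fun n => Function.iterate_succ_apply' _ _ _
  have inv : ∀ n, ((s n).b' = (-1) ^ n * ((s n).q' * α - (s n).p') ∧
      (s n).b = (-1) ^ (n+1) * ((s n).q * α - (s n).p)) ∧ (0 < (s n).b' ∧ (s n).b' < (s n).b) ∧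
      1 ≤ (s n).q' ∧ (s n).q * (s n).b' + (s n).q' * (s n).b = 1 := by
    intro n
    induction n with
    | zero =>
      refine ⟨⟨?_, ?_⟩, ⟨?_, ?_⟩, ?_, ?_⟩
      · simp [s]
      · simp [s]
      · show 0 < Int.fract α
        refine lt_of_le_of_ne (Int.fract_nonneg _) fun h => ?_
        have := Int.floor_add_fract α
        rw [← h, add_zero] at this
        exact (irrational_iff_ne_rational α).1 hα ⌊α⌋ 1 one_ne_zero (by simp [this])
      · exact Int.fract_lt_one α
      · simp [s]
      · simp [s]
    | succ n ih =>
      obtain ⟨⟨h1, h2⟩, ⟨h3, h4⟩, h5, h6⟩ := ih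
      rw [hs]
      have ha : 1 ≤ ⌊(s n).b / (s n).b'⌋₊ := by
        rw [Nat.one_le_floor_iff, one_le_div h3]; exact h4.le
      have h7 := Nat.floor_le (div_nonneg (h3.trans h4).le h3.le)
      have h8 := Nat.lt_floor_add_one ((s n).b / (s n).b')
      rw [le_div_iff₀ h3] at h7
      rw [div_lt_iff₀ h3] at h8
      simp only [CFs.step]
      generalize ⌊(s n).b / (s n).b'⌋₊ = a at *
      have hb : (s n).b - a * (s n).b' = (-1) ^ (n+1) *
          (((a * (s n).q' + (s n).q : ℕ) : ℝ) * α - ((a * (s n).p' + (s n).p : ℤ) : ℝ)) := by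
        rw [h1, h2]; push_cast; ring
      have hq : 1 ≤ a * (s n).q' + (s n).q := by nlinarith
      refine ⟨⟨hb, ?_⟩, ⟨?_, ?_⟩, hq, ?_⟩
      · rw [h1]; ring
      · refine lt_of_le_of_ne (by linarith) fun h => ?_
        rw [hb] at h
        have h9 : (((a * (s n).q' + (s n).q : ℕ) : ℝ) * α -
          ((a * (s n).p' + (s n).p : ℤ) : ℝ)) = 0 := by
          rcases neg_one_pow_eq_or ℝ (n+1) with h' | h' <;> rw [h'] at h <;> linarith
        have h10 : ((a * (s n).q' + (s n).q : ℕ) : ℝ) ≠ 0 := by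
          exact_mod_cast (by omega : a * (s n).q' + (s n).q ≠ 0)
        refine (irrational_iff_ne_rational α).1 hα (a * (s n).p' + (s n).p)
          (a * (s n).q' + (s n).q : ℕ) (by exact_mod_cast h10) ?_
        rw [eq_div_iff (by exact_mod_cast h10)]
        push_cast at h9 ⊢
        linarith
      · linarith
      · push_cast; linear_combination h6
  refine ⟨fun n => (s n).q', fun n => (s n).p', fun n => (s n).b', ?_, (inv 1).2.2.1,
    fun n => (inv n).1.1, fun n => (inv n).2.1.1, fun n => ?_, fun n => ?_, fun n => ?_, hα⟩
  · simp [s]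
  · have := (inv (n+1)).2.1.2
    rwa [hs n] at this ⊢
  · refine ⟨⌊(s (n+1)).b / (s (n+1)).b'⌋₊, ?_, ?_, ?_⟩
    · rw [Nat.one_le_floor_iff, one_le_div (inv (n+1)).2.1.1]; exact (inv (n+1)).2.1.2.le
    · simp only [hs (n+1), hs n, CFs.step]
    · simp only [hs (n+1), hs n, CFs.step]
  · have := (inv (n+1)).2.2.2
    rwa [hs n] at this ⊢

namespace CF
variable {α : ℝ} {q : ℕ → ℕ} {p : ℕ → ℤ} {β : ℕ → ℝ} (h : CF α q p β)
include h

theorem qpos (n : ℕ) : 1 ≤ q n := by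
  induction n using Nat.strong_induction_on with
  | _ n ih =>
    rcases n with _ | _ | n
    · rw [h.q0]
    · exact h.q1
    · obtain ⟨a, h1, h2, -⟩ := h.st n
      have := ih n (by omega)
      show 1 ≤ q (n+2)
      rw [h2]; exact this.trans (Nat.le_add_left _ _)

theorem qadd (n : ℕ) : q n + q (n+1) ≤ q (n+2) := by
  obtain ⟨a, h1, h2, -⟩ := h.st n
  nlinarith [h.qpos (n+1)]

theorem qmono (n : ℕ) : q n ≤ q (n+1) := by
  rcases n with _ | n
  · rw [h.q0]; exact h.q1
  · have := h.qadd n; show q (n+1) ≤ q (n+2); omega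

theorem qmono' {m n : ℕ} (hmn : m ≤ n) : q m ≤ q n := monotone_nat_of_le_succ h.qmono hmn

theorem qR (n : ℕ) : (1:ℝ) ≤ q n := by exact_mod_cast h.qpos n

theorem qb (n : ℕ) : q (n+1) * β n ≤ 1 := by
  have := h.one n
  nlinarith [h.bpos (n+1), h.qR n]

theorem qb2 (n : ℕ) : 1 ≤ 2 * (q (n+1) * β n) := by
  have := h.one n
  have h1 : (q n : ℝ) ≤ q (n+1) := by exact_mod_cast h.qmono n
  have : (q n : ℝ) * β (n+1) ≤ q (n+1) * β n :=
    mul_le_mul h1 (h.blt n).le (h.bpos _).le (by positivity)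
  linarith

theorem bhalf (n : ℕ) : 2 * β (n+2) ≤ β n := by
  obtain ⟨a, h1, h2, h3⟩ := h.st n
  have h4 : β n = a * β (n+1) + β (n+2) := by
    rw [h.bd, h.bd, h.bd, h2, h3]; push_cast; ring
  have h5 : (1:ℝ) ≤ a := by exact_mod_cast h1
  nlinarith [h.bpos (n+1), h.blt (n+1)]

theorem bmono {m n : ℕ} (hmn : m ≤ n) : β n ≤ β m :=
  antitone_nat_of_succ_le (fun n => (h.blt n).le) hmn

theorem b1 (n : ℕ) : β n ≤ 1 := by
  nlinarith [h.qb n, h.qR (n+1), h.bpos n]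

theorem det (n : ℕ) : (-1 : ℤ) ^ n * (q n * p (n+1) - q (n+1) * p n) = 1 := by
  have h1 := h.one n
  rw [h.bd, h.bd] at h1
  have : ((-1 : ℝ)) ^ n * ((q n : ℝ) * p (n+1) - q (n+1) * p n) = 1 := by
    linear_combination h1
  exact_mod_cast this

theorem dio (hd : DiophantineReal α) : ∃ c : ℝ, 0 < c ∧ ∃ N : ℕ, 1 ≤ N ∧
    (∀ n, c ≤ β n * q n ^ N) ∧ ∀ n, c * β n ^ N ≤ β (n+1) := by
  obtain ⟨c, hc, N, hN, hh⟩ := hd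
  have h1 : ∀ n, c ≤ β n * q n ^ N := by
    intro n
    have h2 := hh (p n) (q n) (by have := h.qpos n; omega)
    have h3 : |((q n : ℤ) : ℝ) * α - p n| = β n := by
      rw [← abs_of_pos (h.bpos n), h.bd n, abs_mul, abs_pow]; simp
    have h4 : |((q n : ℤ) : ℝ)| = q n := by simp
    rw [h3, h4, div_lt_iff₀ (by have := h.qR n; positivity)] at h2
    exact h2.le
  refine ⟨c, hc, N, hN, h1, fun n => ?_⟩
  have h2 := h1 (n+1)
  have h3 : (q (n+1) * β n) ^ N ≤ 1 := pow_le_one₀ (by have := h.bpos n; positivity) (h.qb n)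
  rw [mul_pow] at h3
  have h4 : 0 < β n ^ N := pow_pos (h.bpos n) N
  calc c * β n ^ N ≤ (β (n+1) * q (n+1) ^ N) * β n ^ N := by gcongr
    _ = β (n+1) * (q (n+1) ^ N * β n ^ N) := by ring
    _ ≤ β (n+1) * 1 := by have := h.bpos (n+1); gcongr
    _ = _ := mul_one _

theorem q2 (n : ℕ) : n + 1 ≤ 2 * q n := by
  induction n using Nat.strong_induction_on with
  | _ n ih =>
    rcases n with _ | _ | n
    · rw [h.q0]; norm_num
    · have := h.q1; show 1 + 1 ≤ 2 * q 1; omega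
    · have h1 := h.qadd n
      have := ih n (by omega)
      have := h.qpos (n+1)
      show n + 2 + 1 ≤ 2 * q (n+2)
      omega

theorem blim : Tendsto β atTop (𝓝 0) := by
  have h1 : ∀ n, β n ≤ 2 / (n + 1 : ℝ) := by
    intro n
    rw [le_div_iff₀ (by positivity)]
    have h2 : ((n:ℝ) + 1) ≤ 2 * q (n+1) := by
      have := h.q2 (n+1); exact_mod_cast (by omega : n + 1 ≤ 2 * q (n+1))
    nlinarith [h.qb n, h.bpos n]
  refine squeeze_zero (fun n => (h.bpos n).le) h1 ?_
  have := (tendsto_one_div_add_atTop_nhds_zero_nat (𝕜 := ℝ)).const_mul 2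
  simpa [div_eq_mul_inv] using this
end CF

structure Ev (α : ℝ) (q : ℕ → ℕ) (p : ℕ → ℤ) (β : ℕ → ℝ) (B : ℕ → ℝ) (F : ℝ → ℝ) : Prop where
  cf : CF α q p β
  sm : Sm F
  per : ∀ x, F (x+1) = F x + 1
  B1 : ∀ j, 1 ≤ B j
  lo : ∀ x, (B 0)⁻¹ ≤ deriv F x
  hi : ∀ j x, 1 ≤ j → |𝒟 j F x| ≤ B j
  ord1 : ∀ (i : ℕ) (k : ℤ) x, (k:ℝ) < i * α → x + k < F^[i] x
  ord2 : ∀ (i : ℕ) (k : ℤ) x, i * α < k → F^[i] x < x + k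

def mm (q : ℕ → ℕ) (p : ℕ → ℤ) (F : ℝ → ℝ) (n : ℕ) (x : ℝ) : ℝ :=
  (-1) ^ n * (F^[q n] x - p n - x)

def inI (q : ℕ → ℕ) (p : ℕ → ℤ) (F : ℝ → ℝ) (n : ℕ) (x z : ℝ) : Prop :=
  0 ≤ (-1) ^ n * (z - x) ∧ (-1) ^ n * (z - x) ≤ mm q p F n x

def Lg (F : ℝ → ℝ) (i : ℕ) (x : ℝ) : ℝ := ∑ k ∈ Finset.range i, Real.log (deriv F (F^[k] x))

theorem Lg_zero (F : ℝ → ℝ) : Lg F 0 = fun _ => 0 := by ext; simp [Lg]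
theorem Lg_succ (F : ℝ → ℝ) (i : ℕ) (x : ℝ) :
    Lg F (i+1) x = Lg F i x + Real.log (deriv F (F^[i] x)) := Finset.sum_range_succ _ _
theorem Lg_add (F : ℝ → ℝ) (i j : ℕ) (x : ℝ) : Lg F (i+j) x = Lg F i (F^[j] x) + Lg F j x := by
  rw [add_comm i j, Lg, Finset.sum_range_add, add_comm]
  congr 1
  refine Finset.sum_congr rfl fun k _ => ?_
  rw [add_comm j k, Function.iterate_add_apply]

theorem mvt {f f' : ℝ → ℝ} (h : ∀ x, HasDerivAt f (f' x) x) (x y : ℝ) :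
    ∃ c ∈ uIcc x y, f y - f x = f' c * (y - x) := by
  rcases lt_trichotomy x y with h1 | h1 | h1
  · obtain ⟨c, hc, hc'⟩ := exists_hasDerivAt_eq_slope f f' h1
      (fun y _ => (h y).continuousAt.continuousWithinAt) (fun y _ => h y)
    refine ⟨c, by rw [uIcc_of_le h1.le]; exact ⟨hc.1.le, hc.2.le⟩, ?_⟩
    rw [hc']; field_simp [sub_ne_zero.2 h1.ne']
  · subst h1; exact ⟨x, by simp, by simp⟩
  · obtain ⟨c, hc, hc'⟩ := exists_hasDerivAt_eq_slope f f' h1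
      (fun y _ => (h y).continuousAt.continuousWithinAt) (fun y _ => h y)
    refine ⟨c, by rw [uIcc_of_ge h1.le]; exact ⟨hc.1.le, hc.2.le⟩, ?_⟩
    have : x - y ≠ 0 := by linarith
    rw [hc']; field_simp; ring

theorem sgn_cases (n : ℕ) : ((-1:ℝ)) ^ n = 1 ∧ ((-1:ℝ)) ^ (n+1) = -1 ∨
    ((-1:ℝ)) ^ n = -1 ∧ ((-1:ℝ)) ^ (n+1) = 1 := by
  rw [pow_succ]
  rcases neg_one_pow_eq_or ℝ n with h | h <;> simp [h]

namespace Ev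
variable {α : ℝ} {q : ℕ → ℕ} {p : ℕ → ℤ} {β : ℕ → ℝ} {B : ℕ → ℝ} {F : ℝ → ℝ}
  (h : Ev α q p β B F)
include h

theorem B0 : 0 < (B 0)⁻¹ := by have := h.B1 0; positivity
theorem dpos (x : ℝ) : 0 < deriv F x := h.B0.trans_le (h.lo x)
theorem smono : StrictMono F := strictMono_of_deriv_pos h.dpos
theorem imono (i : ℕ) : StrictMono F^[i] := h.smono.iterate i
theorem ism (i : ℕ) : Sm F^[i] := by
  induction i with
  | zero => exact contDiff_id
  | succ i ih => rw [Function.iterate_succ]; exact ih.comp h.sm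
theorem perZ (k : ℤ) (x : ℝ) : F (x + k) = F x + k := by
  induction k using Int.induction_on generalizing x with
  | zero => simp
  | succ k ih => push_cast at ih ⊢; rw [← add_assoc, h.per, ih]; ring
  | pred k ih =>
    push_cast at ih ⊢
    have := h.per (x + (-k - 1))
    rw [show x + (-(k:ℝ) - 1) + 1 = x + -k by ring, ih] at this
    linarith
theorem iper (i : ℕ) (k : ℤ) (x : ℝ) : F^[i] (x + k) = F^[i] x + k := by
  induction i with
  | zero => simp
  | succ i ih => rw [Function.iterate_succ_apply', ih, h.perZ, Function.iterate_succ_apply']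
theorem iper' (i : ℕ) (k : ℤ) (x : ℝ) : F^[i] (x - k) = F^[i] x - k := by
  have := h.iper i (-k) x
  push_cast at this
  simpa [sub_eq_add_neg] using this
theorem dper (k : ℤ) (x : ℝ) : deriv F (x + k) = deriv F x := by
  have h1 : HasDerivAt F (deriv F (x+k)) x := by
    have := (h.sm.diff (x+k)).hasDerivAt.comp_add_const x (k:ℝ)
    have := this.sub_const (k:ℝ)
    refine this.congr_of_eventuallyEq (Eventually.of_forall fun y => ?_)
    simp [h.perZ]
  exact h1.deriv.symm
theorem Lper (i : ℕ) (k : ℤ) (x : ℝ) : Lg F i (x + k) = Lg F i x := by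
  simp only [Lg, h.iper, h.dper]
theorem ifd (i : ℕ) (x : ℝ) : HasDerivAt F^[i] (Real.exp (Lg F i x)) x := by
  induction i with
  | zero => simpa [Lg] using hasDerivAt_id x
  | succ i ih =>
    rw [Function.iterate_succ']
    have := (h.sm.diff (F^[i] x)).hasDerivAt.comp x ih
    rwa [Lg_succ, Real.exp_add, Real.exp_log (h.dpos _), mul_comm]
theorem smφ : Sm (fun x => Real.log (deriv F x)) := h.sm.deriv'.log fun x => (h.dpos x).ne'
theorem smL (i : ℕ) : Sm (Lg F i) := by
  have : Sm (fun x => ∑ k ∈ Finset.range i, Real.log (deriv F (F^[k] x))) :=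
    ContDiff.sum fun k _ => h.smφ.comp (h.ism k)
  exact this

theorem olt {i j : ℕ} {k : ℤ} (hij : i * α + k < j * α) (x : ℝ) : F^[i] x + k < F^[j] x := by
  rcases le_total i j with hl | hl
  · obtain ⟨d, rfl⟩ := Nat.exists_eq_add_of_le hl
    rw [add_comm i d, Function.iterate_add_apply]
    apply h.ord1
    push_cast at hij; linarith
  · obtain ⟨d, rfl⟩ := Nat.exists_eq_add_of_le hl
    rw [add_comm j d, Function.iterate_add_apply]
    have := h.ord2 d (-k) (F^[j] x) (by push_cast at hij ⊢; linarith)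
    push_cast at this; linarith
theorem ole {i j : ℕ} {k : ℤ} (hij : i * α + k ≤ j * α) (x : ℝ) : F^[i] x + k ≤ F^[j] x := by
  rcases hij.lt_or_eq with h1 | h1
  · exact (h.olt h1 x).le
  · have hij' : i = j := by
      by_contra hne
      have h2 : ((i:ℤ) - j) ≠ 0 := by omega
      refine (irrational_iff_ne_rational α).1 h.cf.irr (-k) (i - j) h2 ?_
      rw [eq_div_iff (by exact_mod_cast h2)]
      push_cast; linarith
    subst hij'
    have : (k:ℝ) = 0 := by linarith
    simp [this]

theorem mpos (n : ℕ) (x : ℝ) : 0 < mm q p F n x := by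
  have h1 := h.cf.bpos n
  rw [h.cf.bd] at h1
  unfold mm
  rcases sgn_cases n with ⟨hs, -⟩ | ⟨hs, -⟩ <;> rw [hs] at h1 ⊢
  · have := h.ord1 (q n) (p n) x (by linarith); linarith
  · have := h.ord2 (q n) (p n) x (by linarith); linarith
theorem mper (n : ℕ) (k : ℤ) (x : ℝ) : mm q p F n (x + k) = mm q p F n x := by
  unfold mm; rw [h.iper]; ring
theorem mhd (n : ℕ) (x : ℝ) :
    HasDerivAt (mm q p F n) ((-1) ^ n * (Real.exp (Lg F (q n) x) - 1)) x :=
  (((h.ifd (q n) x).sub_const _).sub (hasDerivAt_id x)).const_mul _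
theorem smm (n : ℕ) : Sm (mm q p F n) :=
  contDiff_const.mul (((h.ism _).sub contDiff_const).sub contDiff_id)

theorem inIit {n : ℕ} {x z : ℝ} (hz : inI q p F n x z) (i : ℕ) :
    inI q p F n (F^[i] x) (F^[i] z) := by
  have h1 : F^[q n] (F^[i] x) - p n = F^[i] (F^[q n] x - p n) := by
    rw [h.iper', ← Function.iterate_add_apply, ← Function.iterate_add_apply, add_comm]
  unfold inI mm at *
  rw [h1]
  rcases sgn_cases n with ⟨hs, -⟩ | ⟨hs, -⟩ <;> rw [hs] at hz ⊢
  · have h2 := (h.imono i).monotone (show x ≤ z by linarith [hz.1])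
    have h3 := (h.imono i).monotone (show z ≤ F^[q n] x - p n by linarith [hz.2])
    constructor <;> linarith
  · have h2 := (h.imono i).monotone (show z ≤ x by linarith [hz.1])
    have h3 := (h.imono i).monotone (show F^[q n] x - p n ≤ z by linarith [hz.2])
    constructor <;> linarith

omit h in
theorem inIabs {n : ℕ} {x z : ℝ} (hz : inI q p F n x z) : |z - x| ≤ mm q p F n x := by
  obtain ⟨h1, h2⟩ := hz
  have : |z - x| = |(-1) ^ n * (z - x)| := by rw [abs_mul, abs_pow]; simp
  rw [this, abs_of_nonneg h1]; exact h2

omit h in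
theorem inIuIcc {n : ℕ} {x z w : ℝ} (hz : inI q p F n x z) (hw : w ∈ uIcc x z) :
    inI q p F n x w := by
  unfold inI at *
  rcases sgn_cases n with ⟨hs, -⟩ | ⟨hs, -⟩ <;> rw [hs] at hz ⊢
  · rw [uIcc_of_le (by linarith)] at hw
    constructor <;> linarith [hw.1, hw.2]
  · rw [uIcc_of_ge (by linarith)] at hw
    constructor <;> linarith [hw.1, hw.2]

theorem inIT (n : ℕ) (x : ℝ) : inI q p F n x (F^[q n] x - p n) :=
  ⟨(h.mpos n x).le, le_rfl⟩

theorem sum1 (n : ℕ) (x : ℝ) : ∑ i ∈ Finset.range (q (n+1)), mm q p F n (F^[i] x) +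
    ∑ i ∈ Finset.range (q n), mm q p F (n+1) (F^[i] x) = 1 := by
  have h1 := Finset.sum_range_add (fun i => F^[i] x) (q n) (q (n+1))
  have h2 := Finset.sum_range_add (fun i => F^[i] x) (q (n+1)) (q n)
  rw [add_comm, h1] at h2
  have h3 : (((-1:ℤ) ^ n * (q n * p (n+1) - q (n+1) * p n) : ℤ) : ℝ) = 1 := by
    rw [h.cf.det]; simp
  push_cast at h3
  simp only [mm, ← Function.iterate_add_apply, ← Finset.mul_sum, Finset.sum_sub_distrib,
    Finset.sum_const, Finset.card_range, nsmul_eq_mul, pow_succ]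
  linear_combination (-1)^n * h2 + h3

theorem cov (n : ℕ) (x y : ℝ) : ∃ a < q n + q (n+1), ∃ z, inI q p F n x z ∧
    ∃ k : ℤ, F^[a] z = y + k := by
  set s : ℝ := (-1) ^ n with hs
  have hss : s * s = 1 := by rw [hs, ← pow_add, ← two_mul]; simp
  let d : ℕ → ℝ := fun a => Int.fract (s * (y - F^[a] x))
  have hq := h.cf.qpos n
  obtain ⟨a, ha, hmin⟩ := Finset.exists_min_image (Finset.range (q n + q (n+1))) d
    ⟨0, by simp; omega⟩
  rw [Finset.mem_range] at ha
  have hk : ∃ k : ℤ, s * (y + k - F^[a] x) = d a := by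
    have : d a = s * (y - F^[a] x) - ⌊s * (y - F^[a] x)⌋ := (Int.self_sub_floor _).symm
    generalize ⌊s * (y - F^[a] x)⌋ = w at this
    refine ⟨-(-1) ^ n * w, ?_⟩
    push_cast; rw [this, ← hs]; linear_combination (-w:ℝ) * hss
  obtain ⟨k, hk⟩ := hk
  have hd0 : 0 ≤ d a := Int.fract_nonneg _
  have hd1 : d a < 1 := Int.fract_lt_one _
  have key : ∀ b < q n + q (n+1), ∀ k' : ℤ, 0 ≤ s * (y + k' - F^[b] x) →
      d a ≤ s * (y + k' - F^[b] x) := by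
    intro b hb k' h0
    by_contra hlt
    push Not at hlt
    have h2 := hmin b (Finset.mem_range.2 hb)
    have : d b = s * (y + k' - F^[b] x) := by
      have e : s * (y - F^[b] x) = s * (y + k' - F^[b] x) + ((- (-1) ^ n * k' : ℤ) : ℝ) := by
        push_cast; rw [← hs]; ring
      show Int.fract (s * (y - F^[b] x)) = _
      rw [e, Int.fract_add_intCast, Int.fract_eq_self.2 ⟨h0, by linarith⟩]
    linarith
  have hle : s * (y + k - F^[a] x) ≤ mm q p F n (F^[a] x) := by
    by_contra hlt
    push Not at hlt
    have hm := h.mpos n (F^[a] x)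
    unfold mm at hlt hm
    rw [← Function.iterate_add_apply, ← hs] at hlt hm
    rcases Nat.lt_or_ge a (q (n+1)) with h1 | h1
    · have := key (q n + a) (by omega) (k + p n) (by push_cast; linarith)
      push_cast at this
      linarith
    · obtain ⟨b, rfl⟩ := Nat.exists_eq_add_of_le h1
      have hm' := h.mpos (n+1) (F^[b] x)
      unfold mm at hm'
      rw [← Function.iterate_add_apply, pow_succ, ← hs] at hm'
      have h3 : 0 < s * (F^[q n + (q (n+1) + b)] x - p n - p (n+1) - F^[b] x) := by
        have hb := h.cf.blt n
        rw [h.cf.bd, h.cf.bd, pow_succ, ← hs] at hb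
        rcases sgn_cases n with ⟨h4, -⟩ | ⟨h4, -⟩ <;> rw [← hs] at h4 <;> rw [h4] at hb ⊢
        · have := h.olt (i := b) (j := q n + (q (n+1) + b)) (k := p n + p (n+1))
            (by push_cast; linarith) x
          push_cast at this; linarith
        · have := h.olt (j := b) (i := q n + (q (n+1) + b)) (k := - p n - p (n+1))
            (by push_cast; linarith) x
          push_cast at this; linarith
      have := key b (by omega) (k - p (n+1)) (by push_cast; linarith)
      push_cast at this
      linarith
  have h5 : F^[a] (F^[q n] x - p n) = F^[q n] (F^[a] x) - p n := by
    rw [h.iper', ← Function.iterate_add_apply, ← Function.iterate_add_apply, add_comm]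
  have h6 : y + k ∈ uIcc (F^[a] x) (F^[a] (F^[q n] x - p n)) := by
    rw [h5]
    unfold mm at hle
    rw [← hs] at hle
    rw [mem_uIcc]
    rcases sgn_cases n with ⟨h4, -⟩ | ⟨h4, -⟩ <;> rw [← hs] at h4 <;> rw [h4] at hle hk
    · left; constructor <;> linarith
    · right; constructor <;> linarith
  obtain ⟨z, hz, hz'⟩ := intermediate_value_uIcc ((h.ism a).continuous.continuousOn) h6
  exact ⟨a, ha, z, inIuIcc (h.inIT n x) hz, k, hz'⟩
end Ev

namespace Ev
variable {α : ℝ} {q : ℕ → ℕ} {p : ℕ → ℤ} {β : ℕ → ℝ} {F : ℝ → ℝ}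

theorem phiB (α : ℝ) (q : ℕ → ℕ) (p : ℕ → ℤ) (β B : ℕ → ℝ) (k : ℕ) : ∃ C : ℝ, 1 ≤ C ∧
    ∀ F, Ev α q p β B F → ∀ x, ∀ a ≤ k, |𝒟 a (fun x => Real.log (deriv F x)) x| ≤ C := by
  let E : ℝ := 1 + |B 0| + |B 1| + ∑ a ∈ Finset.range (k+1), |B (a+1)|
  have hsum : 0 ≤ ∑ a ∈ Finset.range (k+1), |B (a+1)| := Finset.sum_nonneg fun _ _ => abs_nonneg _
  have hE : 0 ≤ E := by positivity
  obtain ⟨C, hC, hh⟩ := explog2 k E hE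
  refine ⟨1 + C * E, by nlinarith, fun F h x a ha => ?_⟩
  have hL : |Real.log (deriv F x)| ≤ E := by
    have h1 := h.lo x
    have h2 := h.dpos x
    have h3 : deriv F x ≤ B 1 := by
      have := h.hi 1 x le_rfl; rw [iteratedDeriv_one] at this; exact (abs_le.1 this).2
    have hB := h.B1 0
    rw [abs_le]; constructor
    · have h4 := Real.log_le_log h.B0 h1
      rw [Real.log_inv] at h4
      have h5 := Real.log_le_sub_one_of_pos (show 0 < B 0 by linarith)
      have := le_abs_self (B 0)
      have := abs_nonneg (B 1)
      simp only [E]; linarith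
    · have h5 := Real.log_le_sub_one_of_pos h2
      have := le_abs_self (B 1)
      have := abs_nonneg (B 0)
      simp only [E]; linarith
  rcases Nat.eq_zero_or_pos a with h0 | h0
  · subst h0
    simp only [iteratedDeriv_zero]; nlinarith
  have h6 := hh _ h.smφ x 1 E zero_le_one hE le_rfl (by linarith [(abs_le.1 hL).1]) (fun a ha => by
    have e : (fun y => Real.exp (Real.log (deriv F y)) - 1) = fun y => deriv F y - 1 := by
      ext y; rw [Real.exp_log (h.dpos y)]
    rw [e, one_pow, mul_one]
    have h7 : |B (a+1)| ≤ ∑ a ∈ Finset.range (k+1), |B (a+1)| :=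
      Finset.single_le_sum (f := fun a => |B (a+1)|) (fun _ _ => abs_nonneg _) (by simp; omega)
    have h8 := h.hi (a+1) x (by omega)
    have := le_abs_self (B (a+1))
    have := abs_nonneg (B 1)
    have := abs_nonneg (B 0)
    rcases Nat.eq_zero_or_pos a with h0 | h0
    · subst h0
      simp only [iteratedDeriv_zero, zero_add, iteratedDeriv_one] at h8 ⊢
      rw [abs_le] at h8 ⊢
      simp only [E]
      constructor <;> linarith [le_abs_self (B 1)]
    · obtain ⟨b, rfl⟩ : ∃ b, a = b + 1 := ⟨a - 1, by omega⟩
      have e2 : deriv (fun y => deriv F y - 1) = deriv (deriv F) := by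
        ext y; exact deriv_sub_const _
      rw [iteratedDeriv_succ', e2, ← iteratedDeriv_succ', ← iteratedDeriv_succ']
      simp only [E]; linarith) a h0 ha
  rw [one_pow, mul_one] at h6
  linarith

theorem mstep {B : ℕ → ℝ} (h : Ev α q p β B F) (i n : ℕ) (x : ℝ) :
    ∃ c, inI q p F n x c ∧ mm q p F n (F^[i] x) = Real.exp (Lg F i c) * mm q p F n x := by
  obtain ⟨c, hc, hc'⟩ := mvt (h.ifd i) x (F^[q n] x - p n)
  refine ⟨c, inIuIcc (h.inIT n x) hc, ?_⟩
  have h1 : F^[i] (F^[q n] x - p n) = F^[q n] (F^[i] x) - p n := by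
    rw [h.iper', ← Function.iterate_add_apply, ← Function.iterate_add_apply, add_comm]
  rw [h1] at hc'
  unfold mm
  linear_combination (-1) ^ n * hc'

theorem sumle {B : ℕ → ℝ} (h : Ev α q p β B F) (n : ℕ) (x : ℝ) {i : ℕ} (hi : i ≤ q (n+1)) :
    ∑ k ∈ Finset.range i, mm q p F n (F^[k] x) ≤ 1 := by
  rw [← h.sum1 n x]
  have h1 : ∑ k ∈ Finset.range i, mm q p F n (F^[k] x) ≤
      ∑ k ∈ Finset.range (q (n+1)), mm q p F n (F^[k] x) :=
    Finset.sum_le_sum_of_subset_of_nonneg (Finset.range_mono hi) fun _ _ _ => (h.mpos _ _).le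
  have h2 : 0 ≤ ∑ i ∈ Finset.range (q n), mm q p F (n+1) (F^[i] x) :=
    Finset.sum_nonneg fun _ _ => (h.mpos _ _).le
  linarith

theorem mle1 {B : ℕ → ℝ} (h : Ev α q p β B F) (n : ℕ) (x : ℝ) : mm q p F n x ≤ 1 := by
  simpa using h.sumle n x (i := 1) (h.cf.qpos _)

theorem D1 (α : ℝ) (q : ℕ → ℕ) (p : ℕ → ℤ) (β B : ℕ → ℝ) : ∃ V : ℝ, 1 ≤ V ∧
    ∀ F, Ev α q p β B F → ∀ n i y z, i ≤ q (n+1) → inI q p F n y z →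
    |Lg F i z - Lg F i y| ≤ V := by
  obtain ⟨V, hV, hh⟩ := phiB α q p β B 1
  refine ⟨V, hV, fun F h n i y z hi hz => ?_⟩
  simp only [Lg, ← Finset.sum_sub_distrib]
  refine (Finset.abs_sum_le_sum_abs _ _).trans ?_
  calc _ ≤ ∑ k ∈ Finset.range i, V * mm q p F n (F^[k] y) := by
        refine Finset.sum_le_sum fun k hk => ?_
        obtain ⟨c, -, hc⟩ := mvt (fun x => (h.smφ.diff x).hasDerivAt) (F^[k] y) (F^[k] z)
        rw [hc, abs_mul]
        have h1 := hh F h c 1 le_rfl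
        rw [iteratedDeriv_one] at h1
        exact mul_le_mul h1 (inIabs (h.inIit hz k)) (abs_nonneg _) (by linarith)
    _ = V * ∑ k ∈ Finset.range i, mm q p F n (F^[k] y) := by rw [Finset.mul_sum]
    _ ≤ V * 1 := by gcongr; exact h.sumle n y hi
    _ = V := mul_one V

theorem Lzero {B : ℕ → ℝ} (h : Ev α q p β B F) (i : ℕ) : ∃ x, Lg F i x = 0 := by
  obtain ⟨c, -, hc⟩ := mvt (h.ifd i) 0 1
  have h1 := h.iper i 1 0
  simp only [zero_add, Int.cast_one] at h1
  rw [h1] at hc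
  have : Real.exp (Lg F i c) = 1 := by linarith
  exact ⟨c, by simpa using this⟩

theorem D2 (α : ℝ) (q : ℕ → ℕ) (p : ℕ → ℤ) (β B : ℕ → ℝ) : ∃ V : ℝ, 1 ≤ V ∧
    ∀ F, Ev α q p β B F → ∀ n x, |Lg F (q n) x| ≤ V := by
  obtain ⟨V, hV, hh⟩ := D1 α q p β B
  obtain ⟨V', hV', hh'⟩ := phiB α q p β B 1
  refine ⟨2 * V + V', by linarith, fun F h n y => ?_⟩
  rcases n with _ | n
  · have := hh' F h y 0 (by omega)
    rw [h.cf.q0]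
    simp only [Lg, Finset.range_one, Finset.sum_singleton, Function.iterate_zero, id]
    simp only [iteratedDeriv_zero] at this
    linarith
  · obtain ⟨x, hx⟩ := h.Lzero (q (n+1))
    obtain ⟨a, ha, z, hz, k, hk⟩ := h.cov n x y
    have h1 : Lg F (q (n+1)) y + Lg F a z = Lg F a (F^[q (n+1)] z - p (n+1)) + Lg F (q (n+1)) z := by
      have e := h.Lper a (-p (n+1)) (F^[q (n+1)] z)
      push_cast at e
      rw [← sub_eq_add_neg] at e
      rw [e, ← Lg_add, ← h.Lper (q (n+1)) k y, ← hk, ← Lg_add, add_comm]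
    have h2 := hh F h n (q (n+1)) x z le_rfl hz
    have h3 := hh F h (n+1) a z _ (ha.le.trans (h.cf.qadd n)) (h.inIT (n+1) z)
    rw [abs_le] at *
    constructor <;> linarith

/-- D3-D5 -/
theorem D34 (α : ℝ) (q : ℕ → ℕ) (p : ℕ → ℤ) (β B : ℕ → ℝ) : ∃ K : ℝ, 1 ≤ K ∧
    ∀ F, Ev α q p β B F → ∀ n,
    (∀ x z, inI q p F n x z → mm q p F n z ≤ K * mm q p F n x ∧ mm q p F n x ≤ K * mm q p F n z) ∧
    (∀ x, mm q p F (n+1) x ≤ K * mm q p F n x) ∧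
    (∀ l x, mm q p F n (F^[q l] x) ≤ K * mm q p F n x ∧
      mm q p F n x ≤ K * mm q p F n (F^[q l] x)) := by
  obtain ⟨V, hV, hh⟩ := D2 α q p β B
  refine ⟨Real.exp V, Real.one_le_exp (by linarith), fun F h n => ?_⟩
  have hb : ∀ l c, Real.exp (Lg F (q l) c) ≤ Real.exp V ∧ 1 ≤ Real.exp V * Real.exp (Lg F (q l) c) :=
    fun l c => by
      have := abs_le.1 (hh F h l c)
      refine ⟨Real.exp_le_exp.2 this.2, ?_⟩
      rw [← Real.exp_add]; exact Real.one_le_exp (by linarith)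
  have hV1 : 1 ≤ Real.exp V := Real.one_le_exp (by linarith)
  have h3 : ∀ l x, mm q p F n (F^[q l] x) ≤ Real.exp V * mm q p F n x ∧
      mm q p F n x ≤ Real.exp V * mm q p F n (F^[q l] x) := by
    intro l x
    obtain ⟨c, -, hc⟩ := h.mstep (q l) n x
    have := hb l c
    have := h.mpos n x
    rw [hc]; constructor <;> nlinarith
  refine ⟨fun x z hz => ?_, fun x => ?_, h3⟩
  · obtain ⟨c, -, hc⟩ := mvt (h.ifd (q n)) x z
    have hb' := hb n c
    have e : mm q p F n z = Real.exp (Lg F (q n) c) * ((-1) ^ n * (z - x)) +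
        (mm q p F n x - (-1) ^ n * (z - x)) := by
      unfold mm; linear_combination (-1) ^ n * hc
    obtain ⟨h1, h2⟩ := hz
    rw [e]
    generalize (-1) ^ n * (z - x) = w at *
    constructor <;> nlinarith
  · obtain ⟨c, -, hc⟩ := h.mstep (q n) (n+1) x
    have hb' := hb n c
    have h5 : mm q p F (n+1) (F^[q n] x) ≤ mm q p F n x := by
      have hbl := h.cf.blt n
      rw [h.cf.bd, h.cf.bd, pow_succ] at hbl
      unfold mm
      rw [← Function.iterate_add_apply, pow_succ]
      rcases sgn_cases n with ⟨h4, -⟩ | ⟨h4, -⟩ <;> rw [h4] at hbl ⊢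
      · have := h.olt (i := 0) (j := q (n+1) + q n) (k := p n + p (n+1))
          (by push_cast; linarith) x
        push_cast at this; simp only [Function.iterate_zero, id] at this; linarith
      · have := h.olt (j := 0) (i := q (n+1) + q n) (k := - p n - p (n+1))
          (by push_cast; linarith) x
        push_cast at this; simp only [Function.iterate_zero, id] at this; linarith
    rw [hc] at h5
    have := h.mpos (n+1) x
    nlinarith

theorem D5 (α : ℝ) (q : ℕ → ℕ) (p : ℕ → ℤ) (β B : ℕ → ℝ) {e : ℝ} (he : 0 < e) : ∃ n0 : ℕ,
    ∀ F, Ev α q p β B F → ∀ n x, n0 ≤ n → mm q p F n x ≤ e := by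
  obtain ⟨K, hK, hh⟩ := D34 α q p β B
  have hstep : ∀ F, Ev α q p β B F → ∀ n x, mm q p F (n+2) x ≤ (1 + (K^3)⁻¹)⁻¹ * mm q p F n x := by
    intro F h n x
    obtain ⟨a, ha, hq, hp⟩ := h.cf.st n
    have hqa := h.cf.qadd n
    obtain ⟨d, hd⟩ := Nat.exists_eq_add_of_le (show q (n+1) ≤ q (n+2) by omega)
    let y := F^[d] x - (p (n+2) - p (n+1) : ℤ)
    have hTy : F^[q (n+1)] y - p (n+1) = F^[q (n+2)] x - p (n+2) := by
      simp only [y]; rw [h.iper', ← Function.iterate_add_apply, ← hd]; push_cast; ring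
    have hy : mm q p F n x ≥ mm q p F (n+2) x + mm q p F (n+1) y := by
      have hle : 0 ≤ (-1) ^ n * ((F^[q n] x - p n) - y) := by
        have hb := h.cf.bpos (n+1)
        rw [h.cf.bd, pow_succ] at hb
        have ha' : (0:ℝ) ≤ (a:ℝ) - 1 := by
          have : (1:ℝ) ≤ a := by exact_mod_cast ha
          linarith
        have hdR : (d:ℝ) = a * q (n+1) + q n - q (n+1) := by
          have : ((q (n+1) + d : ℕ) : ℝ) = ((a * q (n+1) + q n : ℕ) : ℝ) := by rw [← hd, ← hq]
          push_cast at this; linarith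
        have hpR : (p (n+2) : ℝ) = a * p (n+1) + p n := by rw [hp]; push_cast; ring
        have h0 := mul_nonneg ha' hb.le
        simp only [y]
        rcases sgn_cases n with ⟨h4, -⟩ | ⟨h4, -⟩ <;> rw [h4] at h0 ⊢
        · have := h.ole (i := d) (j := q n) (k := p n - (p (n+2) - p (n+1)))
            (by push_cast; rw [hdR, hpR]; nlinarith) x
          push_cast at this ⊢; linarith
        · have := h.ole (i := q n) (j := d) (k := -p n + (p (n+2) - p (n+1)))
            (by push_cast; rw [hdR, hpR]; nlinarith) x
          push_cast at this ⊢; linarith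
      have e1 : mm q p F (n+1) y = -(-1) ^ n * (F^[q (n+2)] x - p (n+2) - y) := by
        unfold mm; rw [hTy]; ring
      have e2 : mm q p F (n+2) x = (-1) ^ n * (F^[q (n+2)] x - p (n+2) - x) := by
        unfold mm; ring
      have e3 : mm q p F n x = (-1) ^ n * ((F^[q n] x - p n) - x) := rfl
      rw [e1, e2, e3]; linarith
    have h1 := ((hh F h (n+1)).1 y _ (h.inIT (n+1) y)).1
    rw [hTy] at h1
    have h2 := (hh F h (n+1)).2.1 (F^[q (n+2)] x - p (n+2))
    have h3 := ((hh F h (n+2)).2.2 (n+2) x).2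
    have e := h.mper (n+2) (- p (n+2)) (F^[q (n+2)] x)
    push_cast at e
    rw [← sub_eq_add_neg] at e
    rw [e] at h2
    have h4 : mm q p F (n+2) x ≤ K^3 * mm q p F (n+1) y := by
      calc _ ≤ _ := h3
        _ ≤ K * (K * (K * mm q p F (n+1) y)) := by gcongr; exact h2.trans (by gcongr)
        _ = _ := by ring
    have hK3 : 0 < K^3 := by positivity
    rw [inv_mul_eq_div, le_div_iff₀ (by positivity)]
    have : mm q p F (n+2) x * (K^3)⁻¹ ≤ mm q p F (n+1) y := by
      rw [← div_eq_mul_inv, div_le_iff₀ hK3]; linarith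
    linarith
  set lam := (1 + (K^3)⁻¹)⁻¹ with hlam
  have hl0 : 0 ≤ lam := by positivity
  have hl1 : lam < 1 := inv_lt_one_of_one_lt₀ (by simp; positivity)
  have hdec : ∀ F, Ev α q p β B F → ∀ j l x, mm q p F (2 * j + l) x ≤ lam ^ j := by
    intro F h j l x
    induction j with
    | zero => simpa using h.mle1 l x
    | succ j ih =>
      calc _ ≤ lam * mm q p F (2 * j + l) x := by
            have := hstep F h (2 * j + l) x
            rwa [show 2 * j + l + 2 = 2 * (j+1) + l by ring] at this
        _ ≤ lam * lam ^ j := by gcongr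
        _ = _ := by ring
  obtain ⟨j, hj⟩ := exists_pow_lt_of_lt_one he hl1
  refine ⟨2 * j, fun F h n x hn => ?_⟩
  obtain ⟨l, rfl⟩ := Nat.exists_eq_add_of_le hn
  exact (hdec F h j l x).trans hj.le
end Ev

def ph (F : ℝ → ℝ) : ℝ → ℝ := fun x => Real.log (deriv F x)
def sg (F : ℝ → ℝ) : ℝ → ℝ := fun x => 𝒟 2 (ph F) x - 𝒟 1 (ph F) x * 𝒟 1 (ph F) x / 2
def NN (F : ℝ → ℝ) (i : ℕ) (x : ℝ) : ℝ :=
  ∑ k ∈ Finset.range i, 𝒟 1 (ph F) (F^[k] x) * Real.exp (Lg F k x)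
def SS (F : ℝ → ℝ) (i : ℕ) (x : ℝ) : ℝ :=
  ∑ k ∈ Finset.range i, sg F (F^[k] x) * Real.exp (2 * Lg F k x)
def om (q : ℕ → ℕ) (F : ℝ → ℝ) (n : ℕ) (x : ℝ) : ℝ :=
  ∑ i ∈ Finset.range (q (n+1)), Real.exp (- Lg F i x / 2)
def Om (q : ℕ → ℕ) (p : ℕ → ℤ) (F : ℝ → ℝ) (n : ℕ) (x : ℝ) : ℝ :=
  ∑ i ∈ Finset.range (q (n+1)), 1 / √(mm q p F n (F^[i] x))

theorem cmpsq {a b K : ℝ} (ha : 0 < a) (hK : 1 ≤ K) (h : a ≤ K * b) :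
    1 / √b ≤ K * (1 / √a) := by
  have hb : 0 < b := by by_contra hb; nlinarith
  rw [mul_one_div, div_le_div_iff₀ (Real.sqrt_pos.2 hb) (Real.sqrt_pos.2 ha), one_mul]
  rw [show K * √b = √(K^2 * b) by
    rw [Real.sqrt_mul (by positivity), Real.sqrt_sq (by positivity)]]
  apply Real.sqrt_le_sqrt
  nlinarith

/-- maximum of a continuous 1-periodic function -/
theorem exmax {f : ℝ → ℝ} (hf : Continuous f) (hp : ∀ x, f (x+1) = f x) : ∃ x0, ∀ x, f x ≤ f x0 := by
  obtain ⟨x0, -, h0⟩ := isCompact_Icc.exists_isMaxOn (nonempty_Icc.2 (zero_le_one' ℝ))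
    hf.continuousOn
  refine ⟨x0, fun x => ?_⟩
  have hp' : Function.Periodic f 1 := hp
  have h1 := hp'.sub_zsmul_eq (x := x) ⌊x⌋
  rw [← h1]
  refine h0 ⟨?_, ?_⟩
  · simp
  · have := (Int.lt_floor_add_one x).le; simp; exact (Int.fract_lt_one x).le

namespace Ev
variable {α : ℝ} {q : ℕ → ℕ} {p : ℕ → ℤ} {β : ℕ → ℝ} {B : ℕ → ℝ} {F : ℝ → ℝ}

theorem smp (h : Ev α q p β B F) : Sm (ph F) := h.smφ
theorem smsg (h : Ev α q p β B F) : Sm (sg F) :=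
  (h.smp.iter 2).sub (((h.smp.iter 1).mul (h.smp.iter 1)).div_const 2)
theorem smN (h : Ev α q p β B F) (i : ℕ) : Sm (NN F i) := by
  have : Sm (fun x => ∑ k ∈ Finset.range i, 𝒟 1 (ph F) (F^[k] x) * Real.exp (Lg F k x)) :=
    ContDiff.sum fun k _ => ((h.smp.iter 1).comp (h.ism k)).mul (h.smL k).exp
  exact this
theorem hdL (h : Ev α q p β B F) (i : ℕ) (x : ℝ) : HasDerivAt (Lg F i) (NN F i x) x := by
  refine HasDerivAt.fun_sum fun k _ => ?_
  exact (h.smp.hda 0 (F^[k] x)).comp x (h.ifd k x)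
theorem dL (h : Ev α q p β B F) (i : ℕ) : deriv (Lg F i) = NN F i :=
  funext fun x => (h.hdL i x).deriv
theorem hdN (h : Ev α q p β B F) (i : ℕ) (x : ℝ) :
    HasDerivAt (NN F i) (SS F i x + NN F i x * NN F i x / 2) x := by
  induction i with
  | zero =>
    have : NN F 0 = fun _ => 0 := by ext; simp [NN]
    rw [this]; simpa [SS] using hasDerivAt_const x (0:ℝ)
  | succ i ih =>
    have e : NN F (i+1) = fun x => NN F i x + 𝒟 1 (ph F) (F^[i] x) * Real.exp (Lg F i x) := by
      ext y; exact Finset.sum_range_succ _ _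
    have e2 : SS F (i+1) x = SS F i x + sg F (F^[i] x) * Real.exp (2 * Lg F i x) :=
      Finset.sum_range_succ _ _
    have h1 := ((h.smp.hda 1 (F^[i] x)).comp x (h.ifd i x)).mul (h.hdL i x).exp
    have h2 := ih.add h1
    rw [e, e2]
    refine h2.congr_deriv ?_
    simp only [Function.comp, sg, two_mul, Real.exp_add]
    ring
theorem dN (h : Ev α q p β B F) (i : ℕ) :
    deriv (NN F i) = fun x => SS F i x + NN F i x * NN F i x / 2 :=
  funext fun x => (h.hdN i x).deriv

/-- `DF^i` versus `m_n`. -/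
theorem DF (α : ℝ) (q : ℕ → ℕ) (p : ℕ → ℤ) (β B : ℕ → ℝ) : ∃ K : ℝ, 1 ≤ K ∧
    ∀ F, Ev α q p β B F → ∀ n i x, i ≤ q (n+1) →
    Real.exp (Lg F i x) * mm q p F n x ≤ K * mm q p F n (F^[i] x) ∧
    mm q p F n (F^[i] x) ≤ K * (Real.exp (Lg F i x) * mm q p F n x) := by
  obtain ⟨V, hV, hh⟩ := D1 α q p β B
  refine ⟨Real.exp V, Real.one_le_exp (by linarith), fun F h n i x hi => ?_⟩
  obtain ⟨c, hc, hc'⟩ := h.mstep i n x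
  have h1 := abs_le.1 (hh F h n i x c hi hc)
  have hm := h.mpos n x
  rw [hc', ← mul_assoc, ← mul_assoc, ← Real.exp_add, ← Real.exp_add]
  constructor <;> · gcongr; linarith

theorem Omcmp (α : ℝ) (q : ℕ → ℕ) (p : ℕ → ℤ) (β B : ℕ → ℝ) : ∃ K : ℝ, 1 ≤ K ∧
    ∀ F, Ev α q p β B F → ∀ n x y, Om q p F n x ≤ K * Om q p F n y := by
  obtain ⟨K, hK, hh⟩ := D34 α q p β B
  refine ⟨K * (K * K), one_le_mul_of_one_le_of_one_le hK (one_le_mul_of_one_le_of_one_le hK hK),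
    fun F h n x y => ?_⟩
  set c : ℝ → ℝ := fun x => 1 / √(mm q p F n x) with hc
  have hc0 : ∀ x, 0 ≤ c x := fun x => by positivity
  have hstep : ∀ a ≤ q (n+1), ∀ z, Om q p F n z ≤ K * Om q p F n (F^[a] z) := by
    intro a ha z
    obtain ⟨d, hd⟩ := Nat.exists_eq_add_of_le ha
    have e1 : Om q p F n z = ∑ i ∈ Finset.range a, c (F^[i] z) +
        ∑ i ∈ Finset.range d, c (F^[a+i] z) := by
      unfold Om; rw [hd, Finset.sum_range_add]
    have e2 : Om q p F n (F^[a] z) = ∑ i ∈ Finset.range d, c (F^[a+i] z) +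
        ∑ i ∈ Finset.range a, c (F^[q (n+1)] (F^[i] z)) := by
      unfold Om
      simp only [← Function.iterate_add_apply]
      rw [hd, add_comm a d, Finset.sum_range_add]
      congr 1
      · exact Finset.sum_congr rfl fun i _ => by rw [add_comm]
      · exact Finset.sum_congr rfl fun i _ => by rw [show d + i + a = d + a + i by ring]
    rw [e1, e2, mul_add, Finset.mul_sum, Finset.mul_sum, add_comm]
    gcongr with i _ i _
    · exact le_mul_of_one_le_left (hc0 _) hK
    · exact cmpsq (h.mpos _ _) hK ((hh F h n).2.2 (n+1) (F^[i] z)).1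
  have hper : ∀ (k : ℤ) z, Om q p F n (z + k) = Om q p F n z := by
    intro k z; simp only [Om, h.iper, h.mper]
  obtain ⟨a, ha, z, hz, k, hk⟩ := h.cov n x y
  have h1 : Om q p F n x ≤ K * Om q p F n z := by
    unfold Om
    rw [Finset.mul_sum]
    exact Finset.sum_le_sum fun i _ => cmpsq (h.mpos _ _) hK ((hh F h n).1 _ _ (h.inIit hz i)).1
  have hOm0 : ∀ z, 0 ≤ Om q p F n z := fun z => Finset.sum_nonneg fun i _ => hc0 _
  have h2 : Om q p F n z ≤ K * K * Om q p F n (F^[a] z) := by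
    rcases le_total a (q (n+1)) with h3 | h3
    · refine (hstep a h3 z).trans ?_
      have := hOm0 (F^[a] z)
      nlinarith [mul_nonneg (mul_nonneg (sub_nonneg.2 hK) (zero_le_one.trans hK)) this]
    · obtain ⟨d, rfl⟩ := Nat.exists_eq_add_of_le h3
      have hdq : d ≤ q (n+1) := by have := h.cf.qmono n; omega
      have h4 := hstep d hdq z
      have h5 := hstep (q (n+1)) le_rfl (F^[d] z)
      rw [← Function.iterate_add_apply] at h5
      calc _ ≤ _ := h4
        _ ≤ K * (K * Om q p F n (F^[q (n+1) + d] z)) := by gcongr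
        _ = _ := by ring
  rw [hk, hper] at h2
  calc _ ≤ _ := h1
    _ ≤ K * (K * K * Om q p F n y) := by gcongr
    _ = _ := by ring

theorem omcmp (α : ℝ) (q : ℕ → ℕ) (p : ℕ → ℤ) (β B : ℕ → ℝ) : ∃ K : ℝ, 1 ≤ K ∧
    ∀ F, Ev α q p β B F → ∀ n x y,
    om q F n x ^ 2 * mm q p F n y ≤ K * (om q F n y ^ 2 * mm q p F n x) := by
  obtain ⟨K, hK, hh⟩ := DF α q p β B
  obtain ⟨K', hK', hO⟩ := Omcmp α q p β B
  refine ⟨(K * K * K')^2, by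
    have := one_le_mul_of_one_le_of_one_le (one_le_mul_of_one_le_of_one_le hK hK) hK'
    nlinarith, fun F h n x y => ?_⟩
  have key : ∀ x, om q F n x ≤ K * (√(mm q p F n x) * Om q p F n x) ∧
      √(mm q p F n x) * Om q p F n x ≤ K * om q F n x := by
    intro x
    have hm := h.mpos n x
    have hs := Real.sqrt_pos.2 hm
    have e : ∀ i, Real.exp (- Lg F i x / 2) = √(mm q p F n x) *
        (1 / √(Real.exp (Lg F i x) * mm q p F n x)) := by
      intro i
      rw [Real.sqrt_mul (Real.exp_pos _).le, show -Lg F i x / 2 = -(Lg F i x / 2) by ring,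
        Real.exp_neg, Real.exp_half]
      have := Real.sqrt_pos.2 (Real.exp_pos (Lg F i x))
      field_simp
    simp only [om, Om, e, ← Finset.mul_sum]
    have hle := h.cf.qpos
    constructor
    · rw [mul_left_comm]
      refine mul_le_mul_of_nonneg_left ?_ hs.le
      rw [Finset.mul_sum]
      refine Finset.sum_le_sum fun i hi => ?_
      exact cmpsq (h.mpos _ _) hK (hh F h n i x (Finset.mem_range.1 hi).le).2
    · rw [mul_left_comm]
      refine mul_le_mul_of_nonneg_left ?_ hs.le
      rw [Finset.mul_sum]
      refine Finset.sum_le_sum fun i hi => ?_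
      exact cmpsq (mul_pos (Real.exp_pos _) hm) hK (hh F h n i x (Finset.mem_range.1 hi).le).1
  have h1 := (key x).1
  have h2 := (key y).2
  have h3 := hO F h n x y
  have hO0 : ∀ x, 0 ≤ Om q p F n x := fun z => Finset.sum_nonneg fun i _ => by positivity
  have ho0 : ∀ x, 0 ≤ om q F n x := fun z => Finset.sum_nonneg fun i _ => by positivity
  have hy := Real.sqrt_nonneg (mm q p F n y)
  have hx := Real.sqrt_nonneg (mm q p F n x)
  have h4 : om q F n x * √(mm q p F n y) ≤ K * K * K' * (om q F n y * √(mm q p F n x)) := by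
    calc _ ≤ K * (√(mm q p F n x) * (K' * Om q p F n y)) * √(mm q p F n y) := by
          gcongr; exact h1.trans (by gcongr)
      _ = K * K' * √(mm q p F n x) * (√(mm q p F n y) * Om q p F n y) := by ring
      _ ≤ K * K' * √(mm q p F n x) * (K * om q F n y) := by gcongr
      _ = _ := by ring
  have h5 := pow_le_pow_left₀ (mul_nonneg (ho0 x) hy) h4 2
  rw [mul_pow, mul_pow (K*K*K'), mul_pow (om q F n y), Real.sq_sqrt (h.mpos _ _).le,
    Real.sq_sqrt (h.mpos _ _).le] at h5
  exact h5

theorem sumsq (α : ℝ) (q : ℕ → ℕ) (p : ℕ → ℤ) (β B : ℕ → ℝ) : ∃ K : ℝ, 1 ≤ K ∧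
    ∀ F, Ev α q p β B F → ∀ n M, (∀ x, mm q p F n x ≤ M) → ∀ l x, l ≤ q (n+1) →
    ∑ k ∈ Finset.range l, Real.exp (2 * Lg F k x) ≤ K * (M / mm q p F n x ^ 2) ∧
    Real.exp (Lg F l x) ≤ K * (M / mm q p F n x) := by
  obtain ⟨K, hK, hh⟩ := DF α q p β B
  refine ⟨K * K, one_le_mul_of_one_le_of_one_le hK hK, fun F h n M hM l x hl => ?_⟩
  have hm := h.mpos n x
  have hM0 : 0 < M := hm.trans_le (hM x)
  have hk : ∀ k ≤ l, Real.exp (Lg F k x) ≤ K * mm q p F n (F^[k] x) / mm q p F n x := by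
    intro k hk
    rw [le_div_iff₀ hm]; exact (hh F h n k x (hk.trans hl)).1
  constructor
  · calc _ ≤ ∑ k ∈ Finset.range l, K * K * (M / mm q p F n x ^ 2) * mm q p F n (F^[k] x) := by
          refine Finset.sum_le_sum fun k hk' => ?_
          have h1 := hk k (Finset.mem_range.1 hk').le
          have hmk := h.mpos n (F^[k] x)
          rw [two_mul, Real.exp_add]
          calc _ ≤ (K * mm q p F n (F^[k] x) / mm q p F n x) *
                (K * mm q p F n (F^[k] x) / mm q p F n x) := by gcongr
            _ = K * K * (mm q p F n (F^[k] x) / mm q p F n x ^ 2) * mm q p F n (F^[k] x) := by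
                field_simp
            _ ≤ _ := by gcongr; exact hM _
      _ = K * K * (M / mm q p F n x ^ 2) * ∑ k ∈ Finset.range l, mm q p F n (F^[k] x) := by
          rw [Finset.mul_sum]
      _ ≤ K * K * (M / mm q p F n x ^ 2) * 1 := by gcongr; exact h.sumle n x hl
      _ = _ := mul_one _
  · refine (hk l le_rfl).trans ?_
    rw [mul_div_assoc]
    have := hM (F^[l] x)
    calc _ ≤ K * (M / mm q p F n x) := by gcongr
      _ ≤ _ := by
        rw [mul_assoc]; exact le_mul_of_one_le_left (by positivity) hK

theorem sgB (α : ℝ) (q : ℕ → ℕ) (p : ℕ → ℤ) (β B : ℕ → ℝ) (k : ℕ) : ∃ C : ℝ, 1 ≤ C ∧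
    ∀ F, Ev α q p β B F → ∀ x, ∀ a ≤ k, |𝒟 a (sg F) x| ≤ C := by
  obtain ⟨C, hC, hh⟩ := phiB α q p β B (k+2)
  refine ⟨C + 2 ^ k * (C * C), by nlinarith [one_le_pow₀ (n := k) (by norm_num : (1:ℝ) ≤ 2)],
    fun F h x a ha => ?_⟩
  have h1 : 𝒟 a (sg F) x = 𝒟 (a+2) (ph F) x - 𝒟 a (fun x => 𝒟 1 (ph F) x * 𝒟 1 (ph F) x) x / 2 := by
    have e : sg F = (𝒟 2 (ph F)) - fun x => 𝒟 1 (ph F) x * 𝒟 1 (ph F) x / 2 := rfl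
    rw [e, iteratedDeriv_sub ((h.smp.iter 2).cat a x)
      (Sm.cat (((h.smp.iter 1).mul (h.smp.iter 1)).div_const 2) a x)]
    congr 1
    · simp only [iteratedDeriv_eq_iterate, ← Function.iterate_add_apply]
    · exact iteratedDeriv_div_const _ _
  have h2 := prodG (h.smp.iter 1) (h.smp.iter 1) (k := k) (B := C * C) (lam := 1) (x := x)
    (fun i j hij => by
      have e : ∀ i, 𝒟 i (𝒟 1 (ph F)) x = 𝒟 (i+1) (ph F) x := fun i => by
        simp only [iteratedDeriv_eq_iterate, ← Function.iterate_add_apply]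
      rw [e, e, one_pow, mul_one]
      exact mul_le_mul (hh F h x _ (by omega)) (hh F h x _ (by omega)) (abs_nonneg _) (by linarith))
    a ha
  rw [one_pow, mul_one] at h2
  have h3 := hh F h x (a+2) (by omega)
  have h4 : (2:ℝ) ^ a * (C * C) ≤ 2 ^ k * (C * C) := by
    gcongr
    norm_num
  have h3' : |𝒟 (a+2) (ph F) x| ≤ C := h3
  rw [h1, abs_le]
  rw [abs_le] at h2 h3'
  have : 0 ≤ (2:ℝ) ^ a * (C * C) := by positivity
  constructor <;> linarith

theorem SSB (α : ℝ) (q : ℕ → ℕ) (p : ℕ → ℤ) (β B : ℕ → ℝ) : ∃ K : ℝ, 1 ≤ K ∧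
    ∀ F, Ev α q p β B F → ∀ n M, (∀ x, mm q p F n x ≤ M) → ∀ l x, l ≤ q (n+1) →
    |SS F l x| ≤ K * (M / mm q p F n x ^ 2) := by
  obtain ⟨K, hK, hh⟩ := sumsq α q p β B
  obtain ⟨C, hC, hs⟩ := sgB α q p β B 0
  refine ⟨C * K, one_le_mul_of_one_le_of_one_le hC hK, fun F h n M hM l x hl => ?_⟩
  unfold SS
  refine (Finset.abs_sum_le_sum_abs _ _).trans ?_
  calc _ ≤ ∑ k ∈ Finset.range l, C * Real.exp (2 * Lg F k x) := by
        refine Finset.sum_le_sum fun k _ => ?_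
        rw [abs_mul, Real.abs_exp]
        gcongr
        simpa using hs F h (F^[k] x) 0 le_rfl
    _ ≤ C * (K * (M / mm q p F n x ^ 2)) := by
        rw [← Finset.mul_sum]; gcongr; exact (hh F h n M hM l x hl).1
    _ = _ := by ring

theorem NB (α : ℝ) (q : ℕ → ℕ) (p : ℕ → ℤ) (β B : ℕ → ℝ) : ∃ K : ℝ, 1 ≤ K ∧
    ∀ F, Ev α q p β B F → ∀ n M, (∀ x, mm q p F n x ≤ M) → ∀ l x, l ≤ q (n+1) →
    |NN F l x| ≤ K * (√M / mm q p F n x) := by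
  obtain ⟨K, hK, hS⟩ := SSB α q p β B
  obtain ⟨K', hK', hO⟩ := omcmp α q p β B
  refine ⟨2 * (K' * (2 * K)), by nlinarith [one_le_mul_of_one_le_of_one_le hK' hK],
    fun F h n M hM l x hl => ?_⟩
  have hM0 : 0 < M := (h.mpos n 0).trans_le (hM 0)
  let W : ℝ → ℝ := fun x => ∑ i ∈ Finset.range (q (n+1)), NN F i x * Real.exp (- Lg F i x / 2)
  let Z : ℝ → ℝ := fun x => ∑ i ∈ Finset.range (q (n+1)), SS F i x * Real.exp (- Lg F i x / 2)
  have hexp : ∀ i x, HasDerivAt (fun x => Real.exp (- Lg F i x / 2))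
      (Real.exp (- Lg F i x / 2) * (- NN F i x / 2)) x := fun i x =>
    ((h.hdL i x).neg.div_const 2).exp
  have hom : ∀ x, HasDerivAt (om q F n) (- W x / 2) x := by
    intro x
    have : HasDerivAt (om q F n) (∑ i ∈ Finset.range (q (n+1)),
      Real.exp (- Lg F i x / 2) * (- NN F i x / 2)) x := HasDerivAt.fun_sum fun i _ => hexp i x
    refine this.congr_deriv ?_
    simp only [W]
    rw [neg_div, Finset.sum_div, ← Finset.sum_neg_distrib]
    exact Finset.sum_congr rfl fun i _ => by ring
  have hW : ∀ x, HasDerivAt W (Z x) x := by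
    intro x
    refine HasDerivAt.fun_sum fun i _ => ?_
    refine ((h.hdN i x).mul (hexp i x)).congr_deriv (by ring)
  have hompos : ∀ x, 0 < om q F n x := fun x =>
    Finset.sum_pos (fun i _ => Real.exp_pos _) ⟨0, Finset.mem_range.2 (h.cf.qpos (n+1))⟩
  have hZ : ∀ x, |Z x| ≤ K * (M / mm q p F n x ^ 2) * om q F n x := by
    intro x
    refine (Finset.abs_sum_le_sum_abs _ _).trans ?_
    simp only [om]
    rw [Finset.mul_sum]
    refine Finset.sum_le_sum fun i hi => ?_
    rw [abs_mul, Real.abs_exp]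
    gcongr
    exact hS F h n M hM i x (Finset.mem_range.1 hi).le
  have hLp : ∀ i x, Lg F i (x+1) = Lg F i x := fun i x => by simpa using h.Lper i 1 x
  have hNp : ∀ i x, NN F i (x+1) = NN F i x := by
    intro i x
    have h1 := ((h.hdL i (x+1)).comp_add_const x 1)
    have e : (fun x => Lg F i (x+1)) = Lg F i := funext fun x => hLp i x
    rw [e] at h1
    exact h1.unique (h.hdL i x)
  have main : ∀ l ≤ q (n+1), ∀ x, |NN F l x * om q F n x - W x| ≤
      K' * (2 * K) * (√M / mm q p F n x) * om q F n x := by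
    intro l hl x
    let Y : ℝ → ℝ := fun x => om q F n x * (NN F l x * om q F n x - W x)
    have hY : ∀ x, HasDerivAt Y ((NN F l x * om q F n x - W x) ^ 2 / 2 + SS F l x * om q F n x ^ 2
        - Z x * om q F n x) x := by
      intro x
      refine ((hom x).mul (((h.hdN l x).mul (hom x)).sub (hW x))).congr_deriv ?_
      simp only [Pi.sub_apply, Pi.mul_apply]
      ring
    have hYp : ∀ x, Y (x+1) = Y x := by
      intro x; simp only [Y, W, om, hLp, hNp]
    have hYc : Continuous Y := continuous_iff_continuousAt.2 fun x => (hY x).continuousAt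
    obtain ⟨x0, hx0⟩ := exmax (f := fun x => |Y x|) hYc.abs (fun x => by rw [hYp])
    have hcrit : (NN F l x0 * om q F n x0 - W x0) ^ 2 / 2 + SS F l x0 * om q F n x0 ^ 2
        - Z x0 * om q F n x0 = 0 := by
      rcases le_total 0 (Y x0) with h0 | h0
      · have : IsLocalMax Y x0 := Eventually.of_forall fun y => by
          have := hx0 y; simp only [abs_of_nonneg h0] at this; exact (le_abs_self _).trans this
        exact this.hasDerivAt_eq_zero (hY x0)
      · have : IsLocalMin Y x0 := Eventually.of_forall fun y => by
          have := hx0 y; simp only [abs_of_nonpos h0] at this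
          linarith [neg_abs_le (Y y)]
        exact this.hasDerivAt_eq_zero (hY x0)
    have hm0 := h.mpos n x0
    have hm := h.mpos n x
    have ho0 := hompos x0
    have ho := hompos x
    have h1 : |NN F l x0 * om q F n x0 - W x0| ≤ 2 * K * (√M / mm q p F n x0) * om q F n x0 := by
      apply abs_le_of_sq_le_sq _ (by positivity)
      have h2 := abs_le.1 (hS F h n M hM l x0 hl)
      have h3 := abs_le.1 (hZ x0)
      have e : (2 * K * (√M / mm q p F n x0) * om q F n x0)^2 =
          4 * K * (K * (M / mm q p F n x0 ^ 2) * om q F n x0 ^ 2) := by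
        rw [mul_pow, mul_pow, div_pow, Real.sq_sqrt hM0.le]; ring
      rw [e]
      set s := K * (M / mm q p F n x0 ^ 2)
      have hs : 0 ≤ s * om q F n x0 ^ 2 := by positivity
      have h4 : -(s * om q F n x0 ^ 2) ≤ SS F l x0 * om q F n x0 ^ 2 := by
        have := mul_le_mul_of_nonneg_right h2.1 (sq_nonneg (om q F n x0)); linarith
      have h5 : Z x0 * om q F n x0 ≤ s * om q F n x0 ^ 2 := by
        have := mul_le_mul_of_nonneg_right h3.2 ho0.le; linarith
      nlinarith
    have h2 : |Y x0| ≤ 2 * K * √M * (om q F n x0 ^ 2 / mm q p F n x0) := by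
      simp only [Y]; rw [abs_mul, abs_of_pos ho0]
      calc _ ≤ om q F n x0 * (2 * K * (√M / mm q p F n x0) * om q F n x0) := by gcongr
        _ = _ := by ring
    have h3 : om q F n x0 ^ 2 / mm q p F n x0 ≤ K' * (om q F n x ^ 2 / mm q p F n x) := by
      rw [← mul_div_assoc, div_le_div_iff₀ hm0 hm, mul_assoc]
      exact hO F h n x0 x
    have h4 : om q F n x * |NN F l x * om q F n x - W x| ≤
        2 * K * √M * (K' * (om q F n x ^ 2 / mm q p F n x)) := by
      have : |Y x| ≤ |Y x0| := hx0 x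
      rw [← abs_of_pos ho, ← abs_mul, abs_of_pos ho]
      refine (this.trans h2).trans (by gcongr)
    have h5 : 2 * K * √M * (K' * (om q F n x ^ 2 / mm q p F n x)) = om q F n x *
        (K' * (2 * K) * (√M / mm q p F n x) * om q F n x) := by ring
    rw [h5] at h4
    exact le_of_mul_le_mul_left h4 ho
  have h1 := main l hl x
  have h0 := main 0 (Nat.zero_le _) x
  have hN0 : NN F 0 x = 0 := by simp [NN]
  rw [hN0, zero_mul] at h0
  have ho := hompos x
  have h2 : |NN F l x| * om q F n x ≤
      2 * (K' * (2 * K)) * (√M / mm q p F n x) * om q F n x := by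
    rw [← abs_of_pos ho, ← abs_mul, abs_of_pos ho]
    rw [abs_le] at *
    constructor <;> linarith
  calc |NN F l x| ≤ 2 * (K' * (2 * K)) * (√M / mm q p F n x) := le_of_mul_le_mul_right h2 ho
    _ = _ := by ring
end Ev

def MM (q : ℕ → ℕ) (p : ℕ → ℤ) (F : ℝ → ℝ) (n : ℕ) : ℝ := ⨆ x, mm q p F n x

theorem dsucc (a : ℕ) (f : ℝ → ℝ) : 𝒟 (a+1) f = 𝒟 a (deriv f) := iteratedDeriv_succ'

namespace Ev
variable {α : ℝ} {q : ℕ → ℕ} {p : ℕ → ℤ} {β : ℕ → ℝ} {B : ℕ → ℝ} {F : ℝ → ℝ}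

theorem mM (h : Ev α q p β B F) (n : ℕ) (x : ℝ) : mm q p F n x ≤ MM q p F n :=
  le_ciSup (f := fun x => mm q p F n x) ⟨1, by rintro _ ⟨y, rfl⟩; exact h.mle1 n y⟩ x
theorem M0 (h : Ev α q p β B F) (n : ℕ) : 0 < MM q p F n := (h.mpos n 0).trans_le (h.mM n 0)
theorem Mle (_h : Ev α q p β B F) (n : ℕ) {e : ℝ} (he : ∀ x, mm q p F n x ≤ e) :
    MM q p F n ≤ e := ciSup_le he
theorem M1 (h : Ev α q p β B F) (n : ℕ) : MM q p F n ≤ 1 := h.Mle n (h.mle1 n)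

theorem dF (h : Ev α q p β B F) (i : ℕ) : deriv F^[i] = fun x => Real.exp (Lg F i x) :=
  funext fun x => (h.ifd i x).deriv

theorem Nc (α : ℝ) (q : ℕ → ℕ) (p : ℕ → ℤ) (β B : ℕ → ℝ) (k : ℕ) : ∃ C : ℝ, 1 ≤ C ∧
    ∀ F, Ev α q p β B F → ∀ n l x, l ≤ q (n+1) → ∀ a ≤ k,
    |𝒟 a (NN F l) x| ≤ C * (√(MM q p F n) / mm q p F n x) ^ (a+1) := by
  induction k with
  | zero =>
    obtain ⟨K, hK, hh⟩ := NB α q p β B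
    refine ⟨K, hK, fun F h n l x hl a ha => ?_⟩
    obtain rfl : a = 0 := by omega
    simpa using hh F h n _ (h.mM n) l x hl
  | succ k ih =>
    obtain ⟨C, hC, hN⟩ := ih
    obtain ⟨C1, hC1, he1⟩ := expG k (2*C) (by linarith)
    obtain ⟨C2, hC2, he2⟩ := expG k C (by linarith)
    obtain ⟨K, hK, hsum⟩ := sumsq α q p β B
    obtain ⟨C3, hC3, hcomp⟩ := compG k (C2 * K) (by positivity)
    obtain ⟨S, hS, hsg⟩ := sgB α q p β B k
    refine ⟨C + 2 ^ k * (C*C) + 2 ^ k * (C3 * S * C1) * K, by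
      have : 0 ≤ 2 ^ k * (C*C) + 2 ^ k * (C3 * S * C1) * K := by positivity
      linarith, fun F h n l x hl a ha => ?_⟩
    set Λ := √(MM q p F n) / mm q p F n x with hΛ
    have hm := h.mpos n x
    have hM := h.M0 n
    have hΛ0 : 0 < Λ := by positivity
    rcases a with _ | a
    · refine (hN F h n l x hl 0 (by omega)).trans ?_
      gcongr
      have : 0 ≤ 2 ^ k * (C*C) + 2 ^ k * (C3 * S * C1) * K := by positivity
      linarith
    have hak : a ≤ k := by omega
    have hΛ2 : MM q p F n / mm q p F n x ^ 2 = Λ ^ 2 := by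
      rw [hΛ, div_pow, Real.sq_sqrt hM.le]
    have hΛ1 : MM q p F n / mm q p F n x ≤ Λ := by
      rw [hΛ]; gcongr
      apply Real.le_sqrt_of_sq_le; nlinarith [h.M1 n]
    have hLg : ∀ i ≤ l, ∀ b, 1 ≤ b → b ≤ k → |𝒟 b (Lg F i) x| ≤ C * Λ ^ b := by
      intro i hi b hb hbk
      obtain ⟨b, rfl⟩ : ∃ c, b = c + 1 := ⟨b-1, by omega⟩
      rw [dsucc, h.dL]
      exact hN F h n i x (hi.trans hl) b (by omega)
    have hNN : |𝒟 a (fun x => NN F l x * NN F l x) x| ≤ 2 ^ a * (C*C*Λ^2) * Λ ^ a := by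
      refine prodG (h.smN l) (h.smN l) (k := k) (fun i j hij => ?_) a hak
      calc _ ≤ (C * Λ ^ (i+1)) * (C * Λ ^ (j+1)) :=
            mul_le_mul (hN F h n l x hl i (by omega)) (hN F h n l x hl j (by omega))
              (abs_nonneg _) (by positivity)
        _ = _ := by ring
    have hterm : ∀ i ∈ Finset.range l, |𝒟 a (fun x => sg F (F^[i] x) * Real.exp (2 * Lg F i x)) x|
        ≤ 2 ^ a * (C3 * S * C1 * Real.exp (2 * Lg F i x)) * Λ ^ a := by
      intro i hi
      have hil := (Finset.mem_range.1 hi).le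
      have s1 : Sm (fun x => sg F (F^[i] x)) := h.smsg.comp (h.ism i)
      have s2 : Sm (fun x => 2 * Lg F i x) := contDiff_const.mul (h.smL i)
      refine prodG s1 s2.exp (k := k) (fun b c hbc => ?_) a hak
      have h1 := he1 _ s2 x Λ hΛ0.le (fun b hb hbk => by
        rw [iteratedDeriv_const_mul_field, abs_mul, abs_two, mul_assoc]
        gcongr
        exact hLg i hil b hb hbk) c (by omega)
      have h2 := hcomp _ _ h.smsg (h.ism i) x S 1 Λ (by linarith) zero_le_one hΛ0.le
        (fun b hb => by rw [one_pow, mul_one]; exact hsg F h _ b hb)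
        (fun b hb => by
          rw [one_mul, h.dF]
          refine (he2 _ (h.smL i) x Λ hΛ0.le (hLg i hil) b hb.le).trans ?_
          have h3 := (hsum F h n _ (h.mM n) i x (hil.trans hl)).2
          calc _ ≤ C2 * (K * Λ) * Λ ^ b := by gcongr; exact h3.trans (by gcongr)
            _ = _ := by ring) b (by omega)
      calc _ ≤ (C3 * S * Λ ^ b) * (C1 * Real.exp (2 * Lg F i x) * Λ ^ c) :=
            mul_le_mul h2 h1 (abs_nonneg _) (by positivity)
        _ = _ := by ring
    have hSS : |𝒟 a (SS F l) x| ≤ 2 ^ a * (C3 * S * C1 * (K * Λ ^ 2)) * Λ ^ a := by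
      have e : SS F l = fun x => ∑ k ∈ Finset.range l, sg F (F^[k] x) * Real.exp (2 * Lg F k x) := rfl
      have s4 : ∀ i, Sm (fun x => sg F (F^[i] x) * Real.exp (2 * Lg F i x)) := fun i =>
        (h.smsg.comp (h.ism i)).mul (contDiff_const.mul (h.smL i)).exp
      rw [e, iteratedDeriv_fun_sum (fun i _ => (s4 i).cat a x)]
      refine (Finset.abs_sum_le_sum_abs _ _).trans ((Finset.sum_le_sum hterm).trans ?_)
      rw [← Finset.sum_mul, ← Finset.mul_sum, ← Finset.mul_sum]
      have h3 := (hsum F h n _ (h.mM n) l x hl).1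
      rw [hΛ2] at h3
      gcongr
    have s3 : Sm (SS F l) := by
      have : Sm (fun x => ∑ k ∈ Finset.range l, sg F (F^[k] x) * Real.exp (2 * Lg F k x)) :=
        ContDiff.sum fun i _ => (h.smsg.comp (h.ism i)).mul (contDiff_const.mul (h.smL i)).exp
      exact this
    have e : 𝒟 (a+1) (NN F l) x = 𝒟 a (SS F l) x + 𝒟 a (fun x => NN F l x * NN F l x) x / 2 := by
      rw [dsucc, h.dN]
      have e2 : (fun x => SS F l x + NN F l x * NN F l x / 2) =
        SS F l + fun x => NN F l x * NN F l x / 2 := rfl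
      rw [e2, iteratedDeriv_add (s3.cat a x)
        (Sm.cat (((h.smN l).mul (h.smN l)).div_const 2) a x)]
      congr 1
      exact iteratedDeriv_div_const _ _
    have hpow : (2:ℝ) ^ a ≤ 2 ^ k := pow_le_pow_right₀ one_le_two hak
    have hNN' : |𝒟 a (fun x => NN F l x * NN F l x) x / 2| ≤ 2 ^ k * (C*C) * Λ ^ (a+2) := by
      rw [abs_div, abs_two, div_le_iff₀ two_pos]
      refine hNN.trans ?_
      calc _ = 2 ^ a * (C*C) * Λ ^ (a+2) * 1 := by ring
        _ ≤ 2 ^ k * (C*C) * Λ ^ (a+2) * 2 := by gcongr; norm_num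
    have hSS' : |𝒟 a (SS F l) x| ≤ 2 ^ k * (C3 * S * C1) * K * Λ ^ (a+2) := by
      refine hSS.trans ?_
      calc _ = 2 ^ a * (C3 * S * C1) * K * Λ ^ (a+2) := by ring
        _ ≤ _ := by gcongr
    rw [e]
    refine (abs_add_le _ _).trans ?_
    have : 0 ≤ C * Λ ^ (a+2) := by positivity
    calc _ ≤ _ := add_le_add hSS' hNN'
      _ ≤ (C + 2 ^ k * (C*C) + 2 ^ k * (C3 * S * C1) * K) * Λ ^ (a+2) := by linarith

theorem Losc (α : ℝ) (q : ℕ → ℕ) (p : ℕ → ℤ) (β B : ℕ → ℝ) : ∃ C : ℝ, 1 ≤ C ∧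
    ∀ F, Ev α q p β B F → ∀ n a w z, a ≤ 2 * q (n+1) → inI q p F n w z →
    |Lg F a z - Lg F a w| ≤ C * √(MM q p F n) := by
  obtain ⟨K, hK, hN⟩ := NB α q p β B
  obtain ⟨K', hK', hD⟩ := D34 α q p β B
  have key : ∀ F, Ev α q p β B F → ∀ n a w z, a ≤ q (n+1) → inI q p F n w z →
    |Lg F a z - Lg F a w| ≤ K * K' * √(MM q p F n) := by
    intro F h n a w z ha hz
    obtain ⟨c, hc, hc'⟩ := mvt (h.hdL a) w z
    have h1 := ((hD F h n).1 _ _ (inIuIcc hz hc)).2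
    have h2 := hN F h n _ (h.mM n) a c ha
    have h3 := inIabs hz
    have hm := h.mpos n c
    rw [hc', abs_mul]
    calc _ ≤ (K * (√(MM q p F n) / mm q p F n c)) * (K' * mm q p F n c) :=
          mul_le_mul h2 (h3.trans h1) (abs_nonneg _) (by positivity)
      _ = _ := by field_simp
  refine ⟨2 * (K * K'), by nlinarith, fun F h n a w z ha hz => ?_⟩
  have hs : 0 ≤ K * K' * √(MM q p F n) := by positivity
  rcases le_total a (q (n+1)) with h1 | h1
  · have := key F h n a w z h1 hz
    linarith
  · obtain ⟨d, rfl⟩ := Nat.exists_eq_add_of_le h1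
    rw [Lg_add, Lg_add]
    have h2 := abs_le.1 (key F h n d w z (by omega) hz)
    have h3 := abs_le.1 (key F h n (q (n+1)) _ _ le_rfl (h.inIit hz d))
    rw [abs_le]; constructor <;> linarith

theorem inIb (h : Ev α q p β B F) (n : ℕ) (z : ℝ) :
    inI q p F n (F^[q (n+1)] z - p (n+1)) z := by
  have h1 := h.mpos (n+1) z
  have b1 := h.cf.bd n
  have b2 := h.cf.bd (n+1)
  have b3 := h.cf.blt n
  have h2 : F^[q n] (F^[q (n+1)] z - p (n+1)) = F^[q n + q (n+1)] z - p (n+1) := by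
    rw [h.iper', Function.iterate_add_apply]
  have h3 := h.ord1 (q n + q (n+1)) (p n + p (n+1)) z
  have h4 := h.ord2 (q n + q (n+1)) (p n + p (n+1)) z
  push_cast at h3 h4
  unfold inI mm at *
  rw [h2]
  rcases sgn_cases n with ⟨e1, e2⟩ | ⟨e1, e2⟩ <;> rw [e1] at b1 ⊢ <;> rw [e2] at b2 h1
  · have := h3 (by linarith)
    constructor <;> linarith
  · have := h4 (by linarith)
    constructor <;> linarith

theorem Yb (α : ℝ) (q : ℕ → ℕ) (p : ℕ → ℤ) (β B : ℕ → ℝ) : ∃ C : ℝ, 1 ≤ C ∧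
    ∀ F, Ev α q p β B F → ∀ n x, |Lg F (q (n+1)) x| ≤ C * √(MM q p F n) := by
  obtain ⟨K, hK, hL⟩ := Losc α q p β B
  refine ⟨2 * K, by linarith, fun F h n x => ?_⟩
  obtain ⟨y, hy⟩ := h.Lzero (q (n+1))
  obtain ⟨a, ha, z, hz, k, hk⟩ := h.cov n x y
  have haq : a ≤ 2 * q (n+1) := by have := h.cf.qmono n; omega
  have h1 := hL F h n (q (n+1)) x z (by omega) hz
  have h2 := hL F h n a _ z haq (h.inIb n z)
  have h3 : Lg F a (F^[q (n+1)] z - p (n+1)) = Lg F a (F^[q (n+1)] z) := by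
    have := h.Lper a (-p (n+1)) (F^[q (n+1)] z)
    push_cast at this; rwa [← sub_eq_add_neg] at this
  have h4 := Lg_add F a (q (n+1)) z
  rw [add_comm, Lg_add, hk, h.Lper, hy] at h4
  rw [h3] at h2
  rw [abs_le] at *
  constructor <;> linarith

def _root_.rr (q : ℕ → ℕ) (p : ℕ → ℤ) (F : ℝ → ℝ) (n : ℕ) (x : ℝ) : ℝ :=
  mm q p F (n+1) x / mm q p F n x

set_option maxHeartbeats 1000000 in
theorem rrd (α : ℝ) (q : ℕ → ℕ) (p : ℕ → ℤ) (β B : ℕ → ℝ) (r : ℕ) : ∃ C : ℝ, 1 ≤ C ∧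
    ∀ F, Ev α q p β B F → ∀ n δ R, 0 < δ → C * δ ≤ 1 → MM q p F n ≤ δ ^ 4 →
    (∀ x, rr q p F (n+1) x ≤ R) → ∀ x y, rr q p F (n+1) x ≤ rr q p F (n+1) y + C * δ * R + C * δ ^ r := by
  obtain ⟨K, hK, hD⟩ := D34 α q p β B
  obtain ⟨C1, hC1, hY⟩ := Yb α q p β B
  obtain ⟨C2, hC2, hN⟩ := Nc α q p β B (r+1)
  obtain ⟨C3, hC3, he⟩ := expG (r+1) C2 (by linarith)
  obtain ⟨V, hV, hD2⟩ := D2 α q p β B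
  obtain ⟨C4, hC4, hI⟩ := INT (r+2)
  obtain ⟨C5, hC5, hL⟩ := Losc α q p β B
  set E := C4 * (2 + C3 * Real.exp V * (2 * K) ^ (r+1)) with hE
  have hE0 : 1 ≤ E := by
    have : 0 ≤ C3 * Real.exp V * (2 * K) ^ (r+1) := by positivity
    nlinarith
  refine ⟨4 * C1 + 4 * C5 * K + E, by nlinarith, fun F h n δ R hδ hCδ hM hR x y => ?_⟩
  have hCK : 0 ≤ C5 * K := by positivity
  have hd1 : 4 * C1 * δ ≤ 1 := by
    refine le_trans ?_ hCδ
    gcongr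
    linarith
  have hd2 : 4 * C5 * K * δ ≤ 1 := by
    refine le_trans ?_ hCδ
    gcongr
    linarith
  have hδ1 : δ ≤ 1 := by nlinarith
  have hR0 : 0 ≤ R := (div_pos (h.mpos (n+2) 0) (h.mpos (n+1) 0)).le.trans (hR 0)
  have hMn : ∀ j, MM q p F (j+1) ≤ K * MM q p F j := fun j =>
    h.Mle _ fun x => ((hD F h j).2.1 x).trans (by gcongr; exact h.mM _ _)
  have s0 : √(MM q p F n) ≤ δ ^ 2 := by
    apply Real.sqrt_le_iff.2 ⟨by positivity, hM.trans (le_of_eq (by ring))⟩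
  have s1 : √(MM q p F (n+1)) ≤ K * δ ^ 2 := by
    apply Real.sqrt_le_iff.2 ⟨by positivity, ?_⟩
    have := hMn n
    calc _ ≤ K * δ ^ 4 := this.trans (by gcongr)
      _ ≤ K * K * δ ^ 4 := by gcongr; nlinarith
      _ = _ := by ring
  have s2 : √(MM q p F (n+2)) ≤ K * δ ^ 2 := by
    apply Real.sqrt_le_iff.2 ⟨by positivity, ?_⟩
    calc _ ≤ K * (K * δ ^ 4) := (hMn (n+1)).trans (by gcongr; exact (hMn n).trans (by gcongr))
      _ = _ := by ring
  have abs_sgn : ∀ n : ℕ, |((-1:ℝ)) ^ n| = 1 := fun n => by simp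
  have hδ2 : δ ^ 2 ≤ δ := by nlinarith
  -- derivative of m_{n+1}
  have dm : ∀ w, |(-1:ℝ) ^ (n+1) * (Real.exp (Lg F (q (n+1)) w) - 1)| ≤ 2 * C1 * δ ^ 2 := by
    intro w
    have h1 := hY F h n w
    have h2 : |Lg F (q (n+1)) w| ≤ C1 * δ ^ 2 := h1.trans (by gcongr)
    have h3 : |Lg F (q (n+1)) w| ≤ 1 := h2.trans (by nlinarith [mul_le_mul_of_nonneg_left hδ2 (zero_le_one.trans hC1)])
    rw [abs_mul, abs_sgn, one_mul]
    exact (Real.abs_exp_sub_one_le h3).trans (by linarith)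
  have cmp : ∀ z w, |w - z| ≤ mm q p F (n+1) z / δ →
      |mm q p F (n+1) w - mm q p F (n+1) z| ≤ 2 * C1 * δ * mm q p F (n+1) z := by
    intro z w hw
    obtain ⟨c, -, hc⟩ := mvt (h.mhd (n+1)) z w
    rw [hc, abs_mul]
    have := h.mpos (n+1) z
    calc _ ≤ 2 * C1 * δ ^ 2 * (mm q p F (n+1) z / δ) :=
          mul_le_mul (dm c) hw (abs_nonneg _) (by positivity)
      _ = _ := by field_simp
  have half : 2 * C1 * δ ≤ 1 / 2 := by linarith
  have du : ∀ z, |(-1:ℝ) ^ (n+2) * (Real.exp (Lg F (q (n+2)) z) - 1)| ≤ E * δ * (R + δ ^ r) := by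
    intro z
    have hm := h.mpos (n+1) z
    have h1 : ∀ w ∈ Icc z (z + mm q p F (n+1) z / δ),
        mm q p F (n+1) z / 2 ≤ mm q p F (n+1) w ∧ mm q p F (n+1) w ≤ 2 * mm q p F (n+1) z := by
      intro w hw
      have := abs_le.1 (cmp z w (by rw [abs_of_nonneg (by linarith [hw.1])]; linarith [hw.2]))
      have h2 : 2 * C1 * δ * mm q p F (n+1) z ≤ 1 / 2 * mm q p F (n+1) z := by gcongr
      constructor <;> linarith
    have h2 := hI _ (h.smm (n+2)) z (mm q p F (n+1) z / δ) (R * (2 * mm q p F (n+1) z))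
      (C3 * Real.exp V * (2 * K * δ ^ 2 / mm q p F (n+1) z) ^ (r+1)) (by positivity)
      (fun w hw => by
        rw [abs_of_pos (h.mpos _ _)]
        have h3 := (div_le_iff₀ (h.mpos (n+1) w)).1 (hR w)
        exact h3.trans (by gcongr; exact (h1 w hw).2))
      (fun w hw => by
        have hmw := h.mpos (n+1) w
        have e1 : deriv (mm q p F (n+2)) = fun w => (-1:ℝ) ^ (n+2) * (Real.exp (Lg F (q (n+2)) w) - 1) :=
          funext fun w => (h.mhd (n+2) w).deriv
        rw [dsucc, e1, iteratedDeriv_const_mul_field, abs_mul, abs_sgn, one_mul,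
          iteratedDeriv_fun_sub (Sm.cat (h.smL _).exp _ _) (Sm.cat contDiff_const _ _),
          iteratedDeriv_const]
        simp only [Nat.succ_ne_zero, if_false, sub_zero]
        have h4 := he _ (h.smL (q (n+2))) w (√(MM q p F (n+1)) / mm q p F (n+1) w) (by positivity)
          (fun a ha hak => by
            obtain ⟨b, rfl⟩ : ∃ c, a = c + 1 := ⟨a-1, by omega⟩
            rw [dsucc, h.dL]
            exact hN F h (n+1) _ w le_rfl b (by omega)) (r+1) le_rfl
        refine h4.trans ?_
        have h5 := (abs_le.1 (hD2 F h (n+2) w)).2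
        have h6 : √(MM q p F (n+1)) / mm q p F (n+1) w ≤ 2 * K * δ ^ 2 / mm q p F (n+1) z := by
          rw [div_le_div_iff₀ hmw hm]
          calc _ ≤ (K * δ ^ 2) * (2 * mm q p F (n+1) w) := by
                gcongr; linarith [(h1 w hw).1]
            _ = _ := by ring
        gcongr) 1 (by omega)
    rw [iteratedDeriv_one, (h.mhd (n+2) z).deriv, pow_one] at h2
    have h3 : C4 * (R * (2 * mm q p F (n+1) z) + C3 * Real.exp V *
        (2 * K * δ ^ 2 / mm q p F (n+1) z) ^ (r+1) * (mm q p F (n+1) z / δ) ^ (r+2))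
        = C4 * (2 * R + C3 * Real.exp V * (2 * K) ^ (r+1) * δ ^ r) * δ * (mm q p F (n+1) z / δ) := by
      have : (2 * K * δ ^ 2 / mm q p F (n+1) z) ^ (r+1) * (mm q p F (n+1) z / δ) ^ (r+2)
          = (2 * K) ^ (r+1) * δ ^ r * mm q p F (n+1) z := by
        rw [div_pow, div_pow, mul_pow, ← pow_mul]
        field_simp
        ring
      rw [mul_assoc (C3 * _), this]
      field_simp
    rw [h3] at h2
    refine (le_of_mul_le_mul_right h2 (by positivity)).trans ?_
    rw [mul_right_comm E, hE, mul_assoc C4 (2 + _)]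
    gcongr
    have : 0 ≤ C3 * Real.exp V * (2 * K) ^ (r+1) := by positivity
    have h7 : 0 ≤ δ ^ r := by positivity
    nlinarith [mul_nonneg this hR0]
  obtain ⟨a, ha, z, hz, k, hk⟩ := h.cov (n+1) x y
  have ha2 : a ≤ 2 * q (n+2) := by
    have h1 : q (n+1) ≤ q (n+2) := h.cf.qmono (n+1)
    have h2 : a < q (n+1) + q (n+2) := ha
    omega
  have ha3 : a ≤ q (n+3) := ha.le.trans (h.cf.qadd (n+1))
  have hmx := h.mpos (n+1) x
  have hmz := h.mpos (n+1) z
  have hmy := h.mpos (n+1) y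
  have hzx : |z - x| ≤ mm q p F (n+1) x := inIabs hz
  -- x to z
  have hz1 : |mm q p F (n+2) z - mm q p F (n+2) x| ≤ E * δ * (R + δ ^ r) * mm q p F (n+1) x := by
    obtain ⟨c, -, hc⟩ := mvt (h.mhd (n+2)) x z
    rw [hc, abs_mul]
    exact mul_le_mul (du c) hzx (abs_nonneg _) (by positivity)
  have hz2 : mm q p F (n+1) z ≤ (1 + 2 * C1 * δ) * mm q p F (n+1) x := by
    have := abs_le.1 (cmp x z (hzx.trans (by rw [le_div_iff₀ hδ]; nlinarith)))
    linarith
  have hA : rr q p F (n+1) x ≤ rr q p F (n+1) z + 2 * C1 * δ * R + E * δ * (R + δ ^ r) := by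
    have hu : mm q p F (n+2) x ≤ mm q p F (n+2) z + E * δ * (R + δ ^ r) * mm q p F (n+1) x := by
      linarith [(abs_le.1 hz1).1]
    have hu2 : mm q p F (n+2) z = rr q p F (n+1) z * mm q p F (n+1) z := by
      unfold rr; rw [div_mul_cancel₀ _ hmz.ne']
    have hr0 : 0 ≤ rr q p F (n+1) z := div_nonneg (h.mpos _ _).le hmz.le
    rw [rr, div_le_iff₀ hmx]
    have h1 : rr q p F (n+1) z * mm q p F (n+1) z ≤
        rr q p F (n+1) z * ((1 + 2 * C1 * δ) * mm q p F (n+1) x) := by gcongr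
    have h2 : rr q p F (n+1) z * (2 * C1 * δ * mm q p F (n+1) x) ≤
        R * (2 * C1 * δ * mm q p F (n+1) x) := by gcongr; exact hR z
    rw [hu2] at hu
    linarith
  -- z to y
  obtain ⟨c, hc, hc'⟩ := h.mstep a (n+2) z
  obtain ⟨d, hd, hd'⟩ := h.mstep a (n+1) z
  rw [hk, h.mper] at hc' hd'
  have hB : rr q p F (n+1) z ≤ rr q p F (n+1) y + 4 * C5 * K * δ ^ 2 * R := by
    have e1 : rr q p F (n+1) z = Real.exp (Lg F a d - Lg F a c) * rr q p F (n+1) y := by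
      rw [rr, rr, show n + 1 + 1 = n + 2 from rfl, hc', hd', Real.exp_sub]
      have := Real.exp_pos (Lg F a c)
      have := Real.exp_pos (Lg F a d)
      field_simp
    have hb1 := hL F h (n+1) a z d ha2 hd
    have hb2 := hL F h (n+2) a z c (ha3.trans (Nat.le_mul_of_pos_left _ two_pos)) hc
    have hb3 : |Lg F a d - Lg F a c| ≤ 2 * C5 * K * δ ^ 2 := by
      have hb1' := abs_le.1 (hb1.trans (by gcongr : _ ≤ C5 * (K * δ ^ 2)))
      have hb2' := abs_le.1 (hb2.trans (by gcongr : _ ≤ C5 * (K * δ ^ 2)))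
      rw [abs_le]; constructor <;> linarith
    have hb4 : |Lg F a d - Lg F a c| ≤ 1 := hb3.trans (by
      have : C5 * K * δ ^ 2 ≤ C5 * K * δ := by gcongr
      linarith)
    have hb5 := (abs_le.1 (Real.abs_exp_sub_one_le hb4)).2
    have hry := hR y
    have hr0 : 0 ≤ rr q p F (n+1) y := div_nonneg (h.mpos _ _).le hmy.le
    rw [e1]
    have h6 : (Real.exp (Lg F a d - Lg F a c) - 1) * rr q p F (n+1) y ≤ (4 * C5 * K * δ ^ 2) * R :=
      mul_le_mul (by linarith) hry hr0 (by positivity)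
    linarith
  have h7 : 4 * C5 * K * δ ^ 2 * R ≤ 4 * C5 * K * δ * R := by gcongr
  have h8 : 0 ≤ δ ^ r := by positivity
  have h9 : E * δ * δ ^ r ≤ E * δ ^ r := by
    have : δ * δ ^ r ≤ 1 * δ ^ r := by gcongr
    rw [one_mul] at this
    rw [mul_assoc]; gcongr
  have h10 : 0 ≤ (4 * C1 + 4 * C5 * K) * δ ^ r := by positivity
  have h11 : 0 ≤ 2 * C1 * δ * R := by positivity
  linarith
end Ev

namespace Ev
variable {α : ℝ} {q : ℕ → ℕ} {p : ℕ → ℤ} {β : ℕ → ℝ} {B : ℕ → ℝ} {F : ℝ → ℝ}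

theorem orb (h : Ev α q p β B F) (P : ℕ) (x : ℝ) : |F^[P] x - x - P * α| ≤ 1 := by
  rcases Nat.eq_zero_or_pos P with rfl | hP
  · simp
  have h1 : ((⌊P * α⌋ : ℤ) : ℝ) < P * α := by
    refine lt_of_le_of_ne (Int.floor_le _) fun e => ?_
    exact (h.cf.irr.natCast_mul hP.ne').ne_int _ e.symm
  have h2 := h.ord1 P _ x h1
  have h3 := h.ord2 P (⌊P * α⌋ + 1) x (by push_cast; exact Int.lt_floor_add_one _)
  have h4 := Int.lt_floor_add_one (P * α)
  push_cast at h3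
  rw [abs_le]; constructor <;> linarith

theorem msum (h : Ev α q p β B F) (n P : ℕ) (x : ℝ) :
    |∑ i ∈ Finset.range P, mm q p F n (F^[i] x) - P * β n| ≤ q n := by
  have e1 : ∑ i ∈ Finset.range P, (F^[q n] (F^[i] x) - F^[i] x) =
      ∑ i ∈ Finset.range (q n), (F^[P] (F^[i] x) - F^[i] x) := by
    simp only [← Function.iterate_add_apply, Finset.sum_sub_distrib]
    have h1 := Finset.sum_range_add (fun i => F^[i] x) (q n) P
    have h2 := Finset.sum_range_add (fun i => F^[i] x) P (q n)
    rw [add_comm, h2] at h1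
    linarith
  have e2 : ∑ i ∈ Finset.range P, mm q p F n (F^[i] x) - P * β n =
      (-1) ^ n * ∑ i ∈ Finset.range (q n), (F^[P] (F^[i] x) - F^[i] x - P * α) := by
    rw [Finset.sum_sub_distrib, ← e1, h.cf.bd n]
    simp only [mm, ← Finset.mul_sum, Finset.sum_sub_distrib, Finset.sum_const, Finset.card_range,
      nsmul_eq_mul]
    ring
  rw [e2, abs_mul, show |((-1:ℝ)) ^ n| = 1 by simp, one_mul]
  refine (Finset.abs_sum_le_sum_abs _ _).trans ((Finset.sum_le_sum fun i _ => h.orb P _).trans ?_)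
  simp

theorem avg (h : Ev α q p β B F) {n n' : ℕ} {a c d : ℝ}
    (H : ∀ x, a + c * mm q p F n x + d * mm q p F n' x ≤ 0) : a + c * β n + d * β n' ≤ 0 := by
  by_contra! hc
  obtain ⟨P, hP⟩ := exists_nat_gt ((|c| * q n + |d| * q n') / (a + c * β n + d * β n'))
  rw [div_lt_iff₀ hc] at hP
  have h1 : ∑ i ∈ Finset.range P, (a + c * mm q p F n (F^[i] 0) + d * mm q p F n' (F^[i] 0)) ≤ 0 :=
    Finset.sum_nonpos fun i _ => H _
  simp only [Finset.sum_add_distrib, ← Finset.mul_sum, Finset.sum_const, Finset.card_range,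
      nsmul_eq_mul] at h1
  have h2 := h.msum n P 0
  have h3 := h.msum n' P 0
  set s := ∑ i ∈ Finset.range P, mm q p F n (F^[i] 0)
  set s' := ∑ i ∈ Finset.range P, mm q p F n' (F^[i] 0)
  have h4 : |c * (s - P * β n)| ≤ |c| * q n := by rw [abs_mul]; gcongr
  have h5 : |d * (s' - P * β n')| ≤ |d| * q n' := by rw [abs_mul]; gcongr
  have := (abs_le.1 h4).1
  have := (abs_le.1 h5).1
  linarith

theorem exR (h : Ev α q p β B F) (n : ℕ) : ∃ x0, ∀ x, rr q p F n x ≤ rr q p F n x0 := by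
  refine exmax (f := rr q p F n) ?_ ?_
  · exact (h.smm (n+1)).continuous.div (h.smm n).continuous fun x => (h.mpos n x).ne'
  · intro x
    have h1 := h.mper n 1 x
    have h2 := h.mper (n+1) 1 x
    push_cast at h1 h2
    rw [rr, rr, h1, h2]

theorem ratio (α : ℝ) (q : ℕ → ℕ) (p : ℕ → ℤ) (β B : ℕ → ℝ) (r : ℕ) : ∃ C : ℝ, 1 ≤ C ∧
    ∀ F, Ev α q p β B F → ∀ n δ, 0 < δ → C * δ ≤ 1 → MM q p F n ≤ δ ^ 4 →
    ∃ R, 0 < R ∧ (∀ x, rr q p F (n+1) x ≤ R) ∧ R * (1 - C * δ) ≤ β (n+2) / β (n+1) + C * δ ^ r ∧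
    β (n+2) / β (n+1) ≤ R ∧ ∀ y, R * (1 - C * δ) - C * δ ^ r ≤ rr q p F (n+1) y := by
  obtain ⟨C, hC, hh⟩ := rrd α q p β B r
  refine ⟨C, hC, fun F h n δ hδ hCδ hM => ?_⟩
  obtain ⟨x0, hx0⟩ := h.exR (n+1)
  have h1 := hh F h n δ _ hδ hCδ hM hx0 x0
  have hb := h.cf.bpos (n+1)
  set R := rr q p F (n+1) x0
  have h2 : ∀ y, R * (1 - C * δ) - C * δ ^ r ≤ rr q p F (n+1) y := fun y => by linarith [h1 y]
  refine ⟨R, div_pos (h.mpos _ _) (h.mpos _ _), hx0, ?_, ?_, h2⟩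
  · have h3 := h.avg (n := n+1) (n' := n+2) (a := 0) (c := R * (1 - C * δ) - C * δ ^ r) (d := -1)
      fun x => by
        have := h2 x
        rw [rr, le_div_iff₀ (h.mpos _ _)] at this
        linarith
    have h4 : R * (1 - C * δ) - C * δ ^ r ≤ β (n+2) / β (n+1) := by
      rw [le_div_iff₀ hb]; linarith
    linarith
  · have h3 := h.avg (n := n+1) (n' := n+2) (a := 0) (c := - R) (d := 1)
      fun x => by
        have := hx0 x
        rw [rr, div_le_iff₀ (h.mpos _ _)] at this
        linarith
    rw [div_le_iff₀ hb]; linarith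

theorem Mstep (h : Ev α q p β B F) {n : ℕ} {R : ℝ} (hR : ∀ x, rr q p F n x ≤ R) :
    MM q p F (n+1) ≤ R * MM q p F n := by
  have hR0 : 0 ≤ R := (div_pos (h.mpos (n+1) 0) (h.mpos n 0)).le.trans (hR 0)
  refine h.Mle _ fun x => ?_
  have := hR x
  rw [rr, div_le_iff₀ (h.mpos _ _)] at this
  exact this.trans (by gcongr; exact h.mM n x)

set_option maxHeartbeats 1000000 in
theorem phA (cf : CF α q p β) (B : ℕ → ℝ) (hd : DiophantineReal α) : ∃ c : ℝ, 0 < c ∧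
    ∃ n0 : ℕ, ∀ F, Ev α q p β B F → ∀ n, n0 ≤ n → MM q p F n ≤ β n ^ c := by
  obtain ⟨c0', hc0', N, hN, -, hdio'⟩ := cf.dio hd
  set c0 := min c0' 1 with hc0d
  have hc0 : 0 < c0 := lt_min hc0' one_pos
  have hc01 : c0 ≤ 1 := min_le_right _ _
  have hdio : ∀ n, c0 * β n ^ N ≤ β (n+1) := fun n =>
    le_trans (by have := cf.bpos n; gcongr; exact min_le_left _ _) (hdio' n)
  obtain ⟨C, hC, hr⟩ := ratio α q p β B (4 * (N^3 + 1))
  set c1 := c0 * (c0 * c0 ^ N) ^ N with hc1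
  set c2 := c0 * c0 ^ N with hc2
  have hc2' : 0 < c2 := by positivity
  have hc1' : 0 < c1 := by positivity
  have hc21 : c2 ≤ 1 := mul_le_one₀ hc01 (by positivity) (pow_le_one₀ hc0.le hc01)
  have hc11 : c1 ≤ 1 := mul_le_one₀ hc01 (by positivity) (pow_le_one₀ hc2'.le hc21)
  have d2 : ∀ n, c2 * β n ^ (N^2) ≤ β (n+2) := by
    intro n
    have := cf.bpos n
    calc c2 * β n ^ (N^2) = c0 * (c0 * β n ^ N) ^ N := by rw [hc2, mul_pow, ← pow_mul]; ring
      _ ≤ c0 * β (n+1) ^ N := by gcongr; exact hdio n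
      _ ≤ _ := hdio _
  have d3 : ∀ n, c1 * β n ^ (N^3) ≤ β (n+3) := by
    intro n
    have := cf.bpos n
    calc c1 * β n ^ (N^3) = c0 * (c2 * β n ^ (N^2)) ^ N := by
          rw [hc1, mul_pow c2 _ N, ← pow_mul, ← pow_succ, hc2]; ring
      _ ≤ c0 * β (n+2) ^ N := by gcongr; exact d2 n
      _ ≤ _ := hdio _
  set e1 := c1 / (20 * C) ^ 4 with he1
  have he1' : 0 < e1 := by positivity
  have he11 : e1 ≤ c1 / (20 * C) := by
    rw [he1]; gcongr; exact le_self_pow₀ (by linarith) (by norm_num)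
  have he12 : e1 ≤ 1 / (20 * C) ^ 4 := by rw [he1]; gcongr
  have he1lt : e1 < 1 := he11.trans_lt (by rw [div_lt_one (by positivity)]; linarith)
  set e0 := c2 * e1 ^ (N^2) with he0
  have he0' : 0 < e0 := by positivity
  have he0lt : e0 < 1 := by
    have : e1 ^ (N^2) < 1 := pow_lt_one₀ he1'.le he1lt (by positivity)
    nlinarith
  obtain ⟨n1, hn1⟩ := D5 α q p β B he0'
  obtain ⟨n2, hn2⟩ := eventually_atTop.1 (cf.blim.eventually (gt_mem_nhds (by positivity : 0 < e0 ^ 2)))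
  set n0 := max n1 n2 with hn0
  have hb0 : β (n0+2) < e0 ^ 2 := hn2 _ (by omega)
  have hbp := cf.bpos
  have hlb : Real.log (β (n0+2)) < 0 := Real.log_neg (hbp _) (hb0.trans (by nlinarith))
  have hle : Real.log e0 < 0 := Real.log_neg he0' he0lt
  set c := Real.log e0 / Real.log (β (n0+2)) with hc
  have hcpos : 0 < c := div_pos_of_neg_of_neg hle hlb
  have hchalf : c ≤ 1 / 2 := by
    rw [hc, div_le_iff_of_neg hlb]
    have := Real.log_le_log (hbp _) hb0.le
    rw [Real.log_pow] at this
    push_cast at this; linarith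
  have hce : β (n0+2) ^ c = e0 := by
    rw [Real.rpow_def_of_pos (hbp _), hc, mul_div_cancel₀ _ hlb.ne, Real.exp_log he0']
  have bmono : ∀ {m n : ℕ}, m ≤ n → β n ^ c ≤ β m ^ c := fun hmn =>
    Real.rpow_le_rpow (hbp _).le (cf.bmono hmn) hcpos.le
  -- powers
  have pw : ∀ (a : ℝ) (k m n : ℕ), 0 < a → a ≤ 1 → a * β n ^ k ≤ β m → a * (β n ^ c) ^ k ≤ β m ^ c := by
    intro a k m n ha ha1 hh
    have h1 := Real.rpow_le_rpow (by have := hbp n; positivity) hh hcpos.le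
    rw [Real.mul_rpow ha.le (by have := hbp n; positivity), ← Real.rpow_natCast, ← Real.rpow_mul (hbp n).le,
      mul_comm (k:ℝ), Real.rpow_mul (hbp n).le, Real.rpow_natCast] at h1
    refine le_trans ?_ h1
    have : a ≤ a ^ c := by
      conv_lhs => rw [← Real.rpow_one a]
      exact Real.rpow_le_rpow_of_exponent_ge ha ha1 (by linarith)
    have := Real.rpow_pos_of_pos (hbp n) c
    gcongr
  have hbe : β n0 ^ c ≤ e1 := by
    have h1 := pw c2 (N^2) (n0+2) n0 hc2' hc21 (d2 n0)
    rw [hce, he0] at h1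
    have h2 := le_of_mul_le_mul_left h1 hc2'
    exact le_of_pow_le_pow_left₀ (by positivity) he1'.le h2
  refine ⟨c, hcpos, n0, fun F h => ?_⟩
  have hstart : ∀ n, n0 ≤ n → MM q p F n ≤ e0 := fun n hn =>
    h.Mle n fun x => hn1 F h n x (by omega)
  have key : ∀ n, n0 ≤ n → MM q p F n ≤ β n ^ c ∧ MM q p F (n+1) ≤ β (n+1) ^ c ∧
      MM q p F (n+2) ≤ β (n+2) ^ c := by
    intro n hn
    induction n, hn using Nat.le_induction with
    | base =>
      refine ⟨(hstart _ le_rfl).trans ?_, (hstart _ (by omega)).trans ?_, (hstart _ (by omega)).trans ?_⟩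
      all_goals exact le_of_eq_of_le hce.symm (bmono (by omega))
    | succ n hn ih =>
      obtain ⟨i0, i1, i2⟩ := ih
      refine ⟨i1, i2, ?_⟩
      set b := β n ^ c with hb
      have hb0 : 0 < b := Real.rpow_pos_of_pos (hbp n) c
      have hbe1 : b ≤ e1 := (bmono hn).trans hbe
      set δ := b ^ (1/4 : ℝ) with hδ
      have hδ0 : 0 < δ := Real.rpow_pos_of_pos hb0 _
      have hδ4 : δ ^ 4 = b := by
        rw [hδ, ← Real.rpow_natCast, ← Real.rpow_mul hb0.le]; norm_num
      have hCδ : C * δ ≤ 1 / 20 := by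
        have : δ ≤ 1 / (20 * C) := by
          refine le_of_pow_le_pow_left₀ (n := 4) (by norm_num) (by positivity) ?_
          rw [hδ4, div_pow, one_pow]
          exact hbe1.trans he12
        rw [le_div_iff₀ (by positivity)] at this
        linarith
      obtain ⟨R1, hR1, hR1a, hR1b, -, -⟩ := hr F h n δ hδ0 (by linarith) (by rw [hδ4]; exact i0)
      obtain ⟨R2, hR2, hR2a, hR2b, -, -⟩ := hr F h (n+1) δ hδ0 (by linarith)
        (by rw [hδ4]; exact i1.trans (bmono (by omega)))
      set κ := C * δ ^ (4 * (N^3+1)) with hκ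
      have hκ0 : 0 < κ := by positivity
      have hP0 : 0 < β (n+3) / β (n+1) := div_pos (hbp _) (hbp _)
      set P := β (n+3) / β (n+1) with hP
      have hP2 : P ≤ 1 / 2 := by
        rw [hP, div_le_iff₀ (hbp _)]; linarith [cf.bhalf (n+1)]
      have hPc : c1 * b ^ (N^3) ≤ P ^ c := by
        refine (pw c1 (N^3) (n+3) n hc1' hc11 (d3 n)).trans ?_
        refine Real.rpow_le_rpow (hbp _).le ?_ hcpos.le
        rw [hP, le_div_iff₀ (hbp _)]
        have := cf.b1 (n+1); have := hbp (n+3); nlinarith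
      have hκP : κ ≤ P ^ c / 20 := by
        have h1 : κ = C * b * b ^ (N^3) := by
          rw [hκ, pow_mul, hδ4, pow_succ]; ring
        have h2 : C * b ≤ c1 / 20 := by
          have := hbe1.trans he11
          rw [le_div_iff₀ (by positivity)] at this
          linarith
        rw [h1]
        calc _ ≤ c1 / 20 * b ^ (N^3) := by gcongr
          _ ≤ _ := by linarith
      have hPc1 : P ^ c ≤ 1 := Real.rpow_le_one hP0.le (by linarith) hcpos.le
      have hsq : √P ≤ P ^ c := by
        rw [Real.sqrt_eq_rpow]
        exact Real.rpow_le_rpow_of_exponent_ge hP0 (by linarith) hchalf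
      have hPs : P ≤ 0.71 * P ^ c := by
        have h1 : √P ≤ 0.71 := by
          rw [Real.sqrt_le_left (by norm_num)]; norm_num; linarith
        have h2 := Real.mul_self_sqrt hP0.le
        nlinarith [Real.sqrt_nonneg P]
      have r1 : β (n+2) / β (n+1) ≤ 1 := by
        rw [div_le_one (hbp _)]; exact (cf.blt _).le
      have r2 : β (n+3) / β (n+2) ≤ 1 := by
        rw [div_le_one (hbp _)]; exact (cf.blt _).le
      have r10 : 0 < β (n+2) / β (n+1) := div_pos (hbp _) (hbp _)
      have r20 : 0 < β (n+3) / β (n+2) := div_pos (hbp _) (hbp _)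
      have rP : β (n+3) / β (n+2) * (β (n+2) / β (n+1)) = P := by
        rw [hP, div_mul_div_cancel₀ (hbp _).ne']
      have hR2b' : R2 * (1 - C * δ) ≤ β (n+3) / β (n+2) + κ := hR2b
      set ρ1 := β (n+2) / β (n+1)
      set ρ2 := β (n+3) / β (n+2)
      have q1 : R1 * (19/20) ≤ ρ1 + κ := le_trans (by gcongr; linarith) hR1b
      have q2 : R2 * (19/20) ≤ ρ2 + κ := le_trans (by gcongr; linarith) hR2b'
      have q3 : R2 * R1 ≤ P ^ c := by
        have : R2 * (19/20) * (R1 * (19/20)) ≤ (ρ2 + κ) * (ρ1 + κ) := by gcongr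
        have e : (ρ2 + κ) * (ρ1 + κ) = P + κ * (ρ1 + ρ2 + κ) := by rw [← rP]; ring
        have e2 : κ * (ρ1 + ρ2 + κ) ≤ κ * (41/20) := by gcongr; linarith
        rw [e] at this
        linarith
      have f1 := h.Mstep hR1a
      have f2 := h.Mstep hR2a
      calc MM q p F (n+3) ≤ R2 * MM q p F (n+2) := f2
        _ ≤ R2 * (R1 * MM q p F (n+1)) := by gcongr
        _ = R2 * R1 * MM q p F (n+1) := by ring
        _ ≤ P ^ c * β (n+1) ^ c := mul_le_mul q3 i1 (h.M0 _).le (by positivity)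
        _ = β (n+3) ^ c := by
          rw [← Real.mul_rpow hP0.le (hbp _).le, hP, div_mul_cancel₀ _ (hbp _).ne']
  exact fun n hn => (key n hn).1
end Ev

theorem CF.bsum {α : ℝ} {q : ℕ → ℕ} {p : ℕ → ℤ} {β : ℕ → ℝ} (cf : CF α q p β) {t : ℝ} (ht : 0 < t) :
    Summable fun n => β n ^ t := by
  set r : ℝ := √(1/2) with hr
  have hr2 : r ^ 2 = 1 / 2 := Real.sq_sqrt (by norm_num)
  have hr0 : 0 < r := Real.sqrt_pos.2 (by norm_num)
  have hr1 : r < 1 := by nlinarith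
  have hb : ∀ n, β n ≤ 2 * r ^ n ∧ β (n+1) ≤ 2 * r ^ (n+1) := by
    intro n
    induction n with
    | zero =>
      have := cf.b1 0; have := cf.b1 1
      constructor
      · simp; linarith
      · simp; nlinarith
    | succ n ih =>
      refine ⟨ih.2, ?_⟩
      have := cf.bhalf n
      have e : r ^ (n+2) = r ^ n * (1/2) := by rw [pow_add, hr2]
      show β (n+2) ≤ 2 * r ^ (n+2)
      rw [e]; linarith [ih.1]
  refine Summable.of_nonneg_of_le (fun n => Real.rpow_nonneg (cf.bpos n).le _)
    (fun n => (Real.rpow_le_rpow (cf.bpos n).le (hb n).1 ht.le)) ?_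
  have : (fun n : ℕ => (2 * r ^ n) ^ t) = fun n => 2 ^ t * (r ^ t) ^ n := by
    ext n
    rw [Real.mul_rpow (by norm_num) (by positivity), ← Real.rpow_natCast, ← Real.rpow_mul hr0.le,
      mul_comm (n:ℝ), Real.rpow_mul hr0.le, Real.rpow_natCast]
  rw [this]
  exact (summable_geometric_of_lt_one (by positivity) (Real.rpow_lt_one hr0.le hr1 ht)).mul_left _

namespace Ev
variable {α : ℝ} {q : ℕ → ℕ} {p : ℕ → ℤ} {β : ℕ → ℝ} {B : ℕ → ℝ} {F : ℝ → ℝ}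

theorem fin (α : ℝ) (q : ℕ → ℕ) (p : ℕ → ℤ) (β B : ℕ → ℝ) (n : ℕ) : ∃ X : ℝ, 0 ≤ X ∧
    ∀ F, Ev α q p β B F → ∀ x, 1 ≤ X * mm q p F n x := by
  obtain ⟨K, hK, hD⟩ := DF α q p β B
  obtain ⟨K', hK', hD'⟩ := D34 α q p β B
  obtain ⟨V, hV, hp⟩ := phiB α q p β B 0
  set E := K * Real.exp (q (n+1) * V) with hE
  have hE0 : 0 ≤ E := by positivity
  refine ⟨q (n+1) * E + q n * (K' * E), by positivity, fun F h x => ?_⟩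
  have hm := h.mpos n x
  have hL : ∀ i ≤ q (n+1), Lg F i x ≤ q (n+1) * V := by
    intro i hi
    have : ∀ k ∈ Finset.range i, Real.log (deriv F (F^[k] x)) ≤ V := fun k _ =>
      le_of_abs_le (by simpa using hp F h (F^[k] x) 0 le_rfl)
    refine (Finset.sum_le_card_nsmul _ _ _ this).trans ?_
    rw [Finset.card_range, nsmul_eq_mul]
    gcongr
  have h1 : ∀ i ≤ q (n+1), mm q p F n (F^[i] x) ≤ E * mm q p F n x := by
    intro i hi
    refine (hD F h n i x hi).2.trans ?_
    rw [hE, ← mul_assoc]; gcongr; exact hL i hi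
  have h2 : ∀ i ≤ q n, mm q p F (n+1) (F^[i] x) ≤ K' * E * mm q p F n x := by
    intro i hi
    refine ((hD' F h n).2.1 _).trans ?_
    rw [mul_assoc]; gcongr; exact h1 i (hi.trans (h.cf.qmono n))
  rw [← h.sum1 n x, add_mul]
  refine add_le_add ?_ ?_
  · refine (Finset.sum_le_card_nsmul _ _ _ fun i hi => h1 i (Finset.mem_range.1 hi).le).trans ?_
    rw [Finset.card_range, nsmul_eq_mul]; exact (mul_assoc _ _ _).ge
  · refine (Finset.sum_le_card_nsmul _ _ _ fun i hi => h2 i (Finset.mem_range.1 hi).le).trans ?_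
    rw [Finset.card_range, nsmul_eq_mul, ← mul_assoc]

set_option maxHeartbeats 1000000 in
theorem phB (cf : CF α q p β) (B : ℕ → ℝ) (hd : DiophantineReal α) : ∃ D : ℝ, 1 ≤ D ∧
    ∀ F, Ev α q p β B F → ∀ n x, MM q p F n ≤ D * mm q p F n x := by
  obtain ⟨c0, hc0, N, hN, -, hdio⟩ := cf.dio hd
  obtain ⟨c, hc, n0, hA⟩ := phA cf B hd
  have hbp := cf.bpos
  set c2 := c0 * c0 ^ N with hc2
  have hc2' : 0 < c2 := by positivity
  have d2 : ∀ n, c2 * β n ^ (N^2) ≤ β (n+2) := by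
    intro n
    have := cf.bpos n
    calc c2 * β n ^ (N^2) = c0 * (c0 * β n ^ N) ^ N := by rw [hc2, mul_pow, ← pow_mul]; ring
      _ ≤ c0 * β (n+1) ^ N := by gcongr; exact hdio n
      _ ≤ _ := hdio _
  obtain ⟨r, hr⟩ := exists_nat_ge ((N^2 + 1) / (c / 4))
  rw [div_le_iff₀ (by positivity)] at hr
  obtain ⟨C, hC, hra⟩ := ratio α q p β B (r+1)
  have hsum := cf.bsum (t := c/4) (by positivity)
  obtain ⟨n1, hn1⟩ := eventually_atTop.1 (hsum.tendsto_atTop_zero.eventually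
    (gt_mem_nhds (by positivity : 0 < 1 / (4 * C))))
  obtain ⟨n2, hn2⟩ := eventually_atTop.1 (cf.blim.eventually (gt_mem_nhds hc2'))
  set m := max n0 (max n1 n2) with hm
  choose X hX0 hX using fun n => fin α q p β B n
  set D0 := 1 + ∑ n ∈ Finset.range (m+2), X n with hD0
  have hD01 : 1 ≤ D0 := by
    have : 0 ≤ ∑ n ∈ Finset.range (m+2), X n := Finset.sum_nonneg fun n _ => hX0 n
    linarith
  set δ : ℕ → ℝ := fun n => β n ^ (c/4) with hδ
  have hδ0 : ∀ n, 0 < δ n := fun n => Real.rpow_pos_of_pos (hbp n) _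
  set T := ∑' n, δ n with hT
  refine ⟨D0 * Real.exp (4 * C * T), by
    have : 1 ≤ Real.exp (4 * C * T) :=
      Real.one_le_exp (by have : 0 ≤ T := tsum_nonneg fun n => (hδ0 n).le
                          positivity)
    nlinarith, fun F h => ?_⟩
  have hsmall : ∀ n < m+2, ∀ x, MM q p F n ≤ D0 * mm q p F n x := by
    intro n hn x
    refine (h.M1 n).trans ((hX n F h x).trans ?_)
    have := h.mpos n x
    gcongr
    have := Finset.single_le_sum (fun i _ => hX0 i) (Finset.mem_range.2 hn)
    linarith
  have step : ∀ n, m ≤ n → ∀ D, (∀ x, MM q p F (n+1) ≤ D * mm q p F (n+1) x) →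
      ∀ x, MM q p F (n+2) ≤ D * Real.exp (4 * C * δ n) * mm q p F (n+2) x := by
    intro n hn D hDn x
    have hd1 : 4 * C * δ n ≤ 1 := by
      have := (hn1 n (by omega)).le
      rw [le_div_iff₀ (by positivity)] at this
      linarith
    have hδ4 : δ n ^ 4 = β n ^ c := by
      rw [hδ]; simp only; rw [← Real.rpow_natCast, ← Real.rpow_mul (hbp n).le]; norm_num
    obtain ⟨R, hR, hRa, -, hRb, hRc⟩ := hra F h n (δ n) (hδ0 n) (by have := hδ0 n; nlinarith)
      (by rw [hδ4]; exact hA F h n (by omega))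
    have hδr : δ n ^ r ≤ R := by
      have e : δ n ^ r ≤ β n ^ (N^2+1) := by
        have e1 : δ n ^ r = β n ^ (c/4 * r) := by
          rw [hδ]; simp only; rw [← Real.rpow_natCast, ← Real.rpow_mul (hbp n).le]
        rw [e1, ← Real.rpow_natCast]
        refine Real.rpow_le_rpow_of_exponent_ge (hbp n) (cf.b1 n) ?_
        push_cast; linarith
      refine e.trans (le_trans ?_ hRb)
      have e2 : β n ^ (N^2+1) ≤ β (n+2) := by
        refine le_trans ?_ (d2 n)
        rw [pow_succ, mul_comm]
        have := hbp n
        gcongr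
        exact (hn2 n (by omega)).le
      refine e2.trans ?_
      rw [le_div_iff₀ (hbp _)]
      have := hbp (n+2); have := cf.b1 (n+1); nlinarith
    have hrr : R * (1 - 2 * (C * δ n)) ≤ rr q p F (n+1) x := by
      refine le_trans ?_ (hRc x)
      rw [pow_succ]
      have : C * (δ n ^ r * δ n) ≤ C * δ n * R := by
        have := hδ0 n
        calc _ = C * δ n * δ n ^ r := by ring
          _ ≤ _ := by gcongr
      linarith
    rw [rr, le_div_iff₀ (h.mpos _ _)] at hrr
    have f1 := h.Mstep hRa
    have hm1 := h.mpos (n+1) x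
    have hm2 := h.mpos (n+2) x
    have hD : 0 ≤ D := by
      by_contra hneg
      have := hDn x; have := h.M0 (n+1); nlinarith
    have g1 : 1 ≤ Real.exp (4 * C * δ n) * (1 - 2 * (C * δ n)) := by
      have := Real.add_one_le_exp (4 * C * δ n)
      have h5 := hδ0 n
      have h6 : 0 ≤ C * δ n := by positivity
      calc (1:ℝ) ≤ (4 * C * δ n + 1) * (1 - 2 * (C * δ n)) := by nlinarith
        _ ≤ _ := by gcongr; linarith
    calc MM q p F (n+2) ≤ R * MM q p F (n+1) := f1
      _ ≤ R * (D * mm q p F (n+1) x) := by gcongr; exact hDn x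
      _ = 1 * (D * (R * mm q p F (n+1) x)) := by ring
      _ ≤ (Real.exp (4 * C * δ n) * (1 - 2 * (C * δ n))) * (D * (R * mm q p F (n+1) x)) := by gcongr
      _ = D * Real.exp (4 * C * δ n) * (R * (1 - 2 * (C * δ n)) * mm q p F (n+1) x) := by ring
      _ ≤ _ := by gcongr
  have key : ∀ n, m ≤ n → ∀ x, MM q p F (n+1) ≤
      D0 * Real.exp (4 * C * ∑ k ∈ Finset.range n, δ k) * mm q p F (n+1) x := by
    intro n hn
    induction n, hn using Nat.le_induction with
    | base =>
      intro x
      refine (hsmall (m+1) (by omega) x).trans ?_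
      have := h.mpos (m+1) x
      gcongr
      refine le_mul_of_one_le_right (by linarith) (Real.one_le_exp ?_)
      have : 0 ≤ ∑ k ∈ Finset.range m, δ k := Finset.sum_nonneg fun k _ => (hδ0 k).le
      positivity
    | succ n hn ih =>
      intro x
      have := step n hn _ ih x
      rw [Finset.sum_range_succ, mul_add, Real.exp_add, ← mul_assoc D0]
      exact this
  intro n x
  have hm' := h.mpos n x
  by_cases hn : n < m + 2
  · refine (hsmall n hn x).trans ?_
    gcongr
    refine le_mul_of_one_le_right (by linarith) (Real.one_le_exp ?_)
    have : 0 ≤ T := tsum_nonneg fun n => (hδ0 n).le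
    positivity
  · obtain ⟨n, rfl⟩ : ∃ n', n = n' + 1 := ⟨n - 1, by omega⟩
    refine (key n (by omega) x).trans ?_
    gcongr
    exact hsum.sum_le_tsum _ fun k _ => (hδ0 k).le

theorem phC (cf : CF α q p β) (B : ℕ → ℝ) (hd : DiophantineReal α) : ∃ D : ℝ, 1 ≤ D ∧
    ∀ F, Ev α q p β B F → ∀ n x, β n ≤ D * mm q p F n x ∧ mm q p F n x ≤ D * β n := by
  obtain ⟨D, hD, hB⟩ := phB cf B hd
  refine ⟨D, hD, fun F h n x => ⟨?_, ?_⟩⟩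
  · have := h.avg (n := n) (n' := n) (a := - MM q p F n) (c := 1) (d := 0)
      fun x => by linarith [h.mM n x]
    linarith [hB F h n x]
  · have := h.avg (n := n) (n' := n) (a := MM q p F n) (c := - D) (d := 0)
      fun x => by linarith [hB F h n x]
    linarith [h.mM n x]

theorem phE (cf : CF α q p β) (B : ℕ → ℝ) (hd : DiophantineReal α) : ∃ D : ℝ, 1 ≤ D ∧
    ∀ F, Ev α q p β B F → ∀ i x, |Lg F i x| ≤ D := by
  obtain ⟨D, hD, hB⟩ := phC cf B hd
  obtain ⟨K, hK, hDF⟩ := DF α q p β B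
  have hX : 1 ≤ K * D * D := by nlinarith [mul_le_mul hK hD zero_le_one (by linarith)]
  refine ⟨1 + Real.log (K * D * D), by linarith [Real.log_nonneg hX], fun F h i x => ?_⟩
  have hi : i ≤ q (2 * i + 1) := by have := cf.q2 (2*i+1); omega
  obtain ⟨h1, h2⟩ := hDF F h (2*i) i x hi
  obtain ⟨a1, a2⟩ := hB F h (2*i) x
  obtain ⟨b1, b2⟩ := hB F h (2*i) (F^[i] x)
  have hb := cf.bpos (2*i)
  have hm := h.mpos (2*i) x
  have e1 : Real.exp (Lg F i x) ≤ K * D * D := by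
    refine le_of_mul_le_mul_right (a := mm q p F (2*i) x) ?_ hm
    calc _ ≤ K * mm q p F (2*i) (F^[i] x) := h1
      _ ≤ K * (D * (D * mm q p F (2*i) x)) := by gcongr; exact b2.trans (by gcongr)
      _ = _ := by ring
  have e2 : 1 ≤ K * D * D * Real.exp (Lg F i x) := by
    refine le_of_mul_le_mul_right (a := mm q p F (2*i) x) ?_ hm
    calc _ ≤ D * (D * mm q p F (2*i) (F^[i] x)) := by
            rw [one_mul]; exact a2.trans (by gcongr)
      _ ≤ D * (D * (K * (Real.exp (Lg F i x) * mm q p F (2*i) x))) := by gcongr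
      _ = _ := by ring
  rw [abs_le]
  have g1 := (Real.le_log_iff_exp_le (by positivity)).2 e1
  have g2 := Real.log_le_log one_pos e2
  rw [Real.log_mul (by positivity) (by positivity), Real.log_exp, Real.log_one] at g2
  constructor <;> linarith
end Ev

theorem dadd {u v : ℝ → ℝ} (hu : Sm u) (hv : Sm v) (a : ℕ) :
    𝒟 a (fun y => u y + v y) = fun x => 𝒟 a u x + 𝒟 a v x :=
  funext fun x => iteratedDeriv_fun_add (hu.cat a x) (hv.cat a x)
theorem dsub {u v : ℝ → ℝ} (hu : Sm u) (hv : Sm v) (a : ℕ) :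
    𝒟 a (fun y => u y - v y) = fun x => 𝒟 a u x - 𝒟 a v x :=
  funext fun x => iteratedDeriv_fun_sub (hu.cat a x) (hv.cat a x)
theorem dsum {u : ℕ → ℝ → ℝ} (hu : ∀ i, Sm (u i)) (a N : ℕ) :
    𝒟 a (fun y => ∑ i ∈ Finset.range N, u i y) = fun x => ∑ i ∈ Finset.range N, 𝒟 a (u i) x := by
  induction N with
  | zero => ext x; cases a <;> simp [iteratedDeriv_const]
  | succ N ih =>
    simp only [Finset.sum_range_succ]
    rw [dadd (ContDiff.sum fun i _ => hu i) (hu N), ih]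

def Bd (k : ℕ) (A lam : ℝ) (u : ℝ → ℝ) : Prop := ∀ a ≤ k, ∀ x, |𝒟 a u x| ≤ A * lam ^ a

theorem Bd.mono {k k' : ℕ} {A A' lam : ℝ} {u : ℝ → ℝ} (h : Bd k A lam u) (hk : k' ≤ k) (hA : A ≤ A')
    (hl : 0 ≤ lam) : Bd k' A' lam u := fun a ha x =>
  (h a (ha.trans hk) x).trans (by gcongr)
theorem Bd.der {k : ℕ} {A lam : ℝ} {u : ℝ → ℝ} (h : Bd (k+1) A lam u) : Bd k (A * lam) lam (deriv u) := by
  intro a ha x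
  have := h (a+1) (by omega) x
  rw [dsucc] at this
  exact this.trans (le_of_eq (by ring))
theorem Bd.ofder {k : ℕ} {A lam : ℝ} {u : ℝ → ℝ} (h0 : ∀ x, |u x| ≤ A)
    (h : Bd k (A * lam) lam (deriv u)) : Bd (k+1) A lam u := by
  intro a ha x
  rcases a with _ | a
  · simpa using h0 x
  · rw [dsucc]; exact (h a (by omega) x).trans (le_of_eq (by ring))
theorem Bd.add {k : ℕ} {A A' lam : ℝ} {u v : ℝ → ℝ} (hu : Sm u) (hv : Sm v) (h : Bd k A lam u)
    (h' : Bd k A' lam v) : Bd k (A + A') lam (fun y => u y + v y) := by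
  intro a ha x
  rw [dadd hu hv, add_mul]
  exact (abs_add_le _ _).trans (add_le_add (h a ha x) (h' a ha x))
theorem Bd.sum {k : ℕ} {A lam : ℝ} {u : ℕ → ℝ → ℝ} {N : ℕ} (hu : ∀ i, Sm (u i))
    (h : ∀ i < N, Bd k A lam (u i)) : Bd k (N * A) lam (fun y => ∑ i ∈ Finset.range N, u i y) := by
  intro a ha x
  rw [dsum hu]
  refine (Finset.abs_sum_le_sum_abs _ _).trans ?_
  refine (Finset.sum_le_card_nsmul _ _ _ fun i hi => h i (Finset.mem_range.1 hi) a ha x).trans ?_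
  rw [Finset.card_range, nsmul_eq_mul]; exact (mul_assoc _ _ _).ge

theorem smid {u : ℝ → ℝ} (hu : Sm u) : Sm (fun y => y + u y) := contDiff_id.add hu
theorem did {u : ℝ → ℝ} (hu : Sm u) : deriv (fun y => y + u y) = fun y => 1 + deriv u y :=
  funext fun x => ((hasDerivAt_id x).add (hu.diff x).hasDerivAt).deriv

theorem PR (k : ℕ) (K : ℝ) (hK : 0 ≤ K) : ∃ C : ℝ, 1 ≤ C ∧ ∀ w u : ℝ → ℝ, Sm w → Sm u →
    ∀ A e lam : ℝ, 0 ≤ A → 0 ≤ e → 0 ≤ lam → e * lam ≤ K → Bd k A lam w → Bd (k+1) e lam u →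
    Bd k (C * A * (e * lam)) lam (fun y => w (y + u y) * deriv u y) := by
  obtain ⟨C, hC, hc⟩ := compG k (1 + K) (by linarith)
  refine ⟨2 ^ k * C, by nlinarith [one_le_pow₀ (n := k) (by norm_num : (1:ℝ) ≤ 2)],
    fun w u hw hu A e lam hA he hl heK hwb hub a ha x => ?_⟩
  have h1 : ∀ a ≤ k, |𝒟 a (fun y => w (y + u y)) x| ≤ C * A * lam ^ a := by
    refine hc w _ hw (smid hu) x A lam lam hA hl hl (fun a ha => hwb a ha _) fun a ha => ?_
    rw [did hu, dadd contDiff_const hu.deriv']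
    have h2 := hub.der a (by omega) x
    have h3 : |𝒟 a (fun _ => (1:ℝ)) x| ≤ lam ^ a := by
      rcases a with _ | a
      · simp
      · simp [iteratedDeriv_const]; positivity
    calc lam * |_| ≤ lam * (lam ^ a + e * lam * lam ^ a) := by
          gcongr; exact (abs_add_le _ _).trans (add_le_add h3 h2)
      _ = (1 + e * lam) * lam ^ (a+1) := by ring
      _ ≤ _ := by gcongr
  have h2 := prodG (u := fun y => w (y + u y)) (v := deriv u) (hw.comp (smid hu)) hu.deriv' (k := k)
    (B := C * A * (e * lam)) (lam := lam) (x := x) (fun i j hij => ?_) a ha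
  · refine h2.trans ?_
    have : (2:ℝ) ^ a ≤ 2 ^ k := pow_le_pow_right₀ (by norm_num) ha
    calc _ ≤ 2 ^ k * (C * A * (e * lam)) * lam ^ a := by gcongr
      _ = _ := by ring
  · calc _ ≤ (C * A * lam ^ i) * (e * lam * lam ^ j) :=
          mul_le_mul (h1 i (by omega)) (hub.der j (by omega) x) (abs_nonneg _) (by positivity)
      _ = _ := by ring

theorem DIF (k : ℕ) (K : ℝ) (hK : 0 ≤ K) : ∃ C : ℝ, 1 ≤ C ∧ ∀ w u : ℝ → ℝ, Sm w → Sm u →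
    ∀ A e lam : ℝ, 0 ≤ A → 0 ≤ e → 0 ≤ lam → e * lam ≤ K → Bd (k+1) A lam w → Bd k e lam u →
    Bd k (C * A * (e * lam)) lam (fun y => w (y + u y) - w y) := by
  induction k with
  | zero =>
    refine ⟨1, le_rfl, fun w u hw hu A e lam hA he hl heK hwb hub a ha x => ?_⟩
    obtain rfl : a = 0 := by omega
    obtain ⟨c, -, hc⟩ := mvt (fun x => hw.hda 0 x) x (x + u x)
    simp only [iteratedDeriv_zero] at hc
    have h1 := hwb 1 (by omega) c
    have h2 := hub 0 le_rfl x
    simp only [iteratedDeriv_zero, pow_zero, mul_one, pow_one, zero_add] at *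
    rw [hc, abs_mul, add_sub_cancel_left]
    calc _ ≤ (A * lam) * e := by gcongr
      _ = _ := by ring
  | succ k ih =>
    obtain ⟨C, hC, ih⟩ := ih
    obtain ⟨C', hC', hp⟩ := PR k K hK
    refine ⟨C + C', by linarith, fun w u hw hu A e lam hA he hl heK hwb hub => ?_⟩
    refine Bd.ofder (fun x => ?_) ?_
    · obtain ⟨c, -, hc⟩ := mvt (fun x => hw.hda 0 x) x (x + u x)
      simp only [iteratedDeriv_zero] at hc
      have h1 := hwb 1 (by omega) c
      have h2 := hub 0 (by omega) x
      simp only [iteratedDeriv_zero, pow_zero, mul_one, pow_one, zero_add] at *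
      rw [hc, abs_mul, add_sub_cancel_left]
      calc _ ≤ (A * lam) * e := by gcongr
        _ = 1 * A * (e * lam) := by ring
        _ ≤ _ := by gcongr; linarith
    · have e1 : deriv (fun y => w (y + u y) - w y) =
          fun y => (deriv w (y + u y) - deriv w y) + deriv w (y + u y) * deriv u y := by
        funext x
        have h1 := ((hw.diff (x + u x)).hasDerivAt.comp x
          ((hasDerivAt_id x).add (hu.diff x).hasDerivAt)).sub (hw.diff x).hasDerivAt
        refine h1.deriv.trans ?_
        ring
      rw [e1]
      have g1 := ih (deriv w) u hw.deriv' hu (A * lam) e lam (by positivity) he hl heK hwb.der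
        (hub.mono (by omega) le_rfl hl)
      have g2 := hp (deriv w) u hw.deriv' hu (A * lam) e lam (by positivity) he hl heK
        (hwb.der.mono (by omega) le_rfl hl) hub
      have g3 := Bd.add ((hw.deriv'.comp (smid hu)).sub hw.deriv')
        ((hw.deriv'.comp (smid hu)).mul hu.deriv') g1 g2
      exact g3.mono le_rfl (le_of_eq (by ring)) hl

theorem DIF2 (k : ℕ) (K : ℝ) (hK : 0 ≤ K) : ∃ C : ℝ, 1 ≤ C ∧ ∀ w u : ℝ → ℝ, Sm w → Sm u →
    ∀ A e lam : ℝ, 0 ≤ A → 0 ≤ e → 0 ≤ lam → e * lam ≤ K → Bd k A lam w → Bd k e lam u →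
    ∀ x, |𝒟 k (fun y => w (y + u y)) x - 𝒟 k w (x + u x)| ≤ C * A * (e * lam) * lam ^ k := by
  induction k with
  | zero =>
    refine ⟨1, le_rfl, fun w u hw hu A e lam hA he hl heK hwb hub x => ?_⟩
    simp; positivity
  | succ k ih =>
    obtain ⟨C, hC, ih⟩ := ih
    obtain ⟨C', hC', hp⟩ := PR k K hK
    refine ⟨C + C', by linarith, fun w u hw hu A e lam hA he hl heK hwb hub x => ?_⟩
    have e1 : deriv (fun y => w (y + u y)) =
        fun y => deriv w (y + u y) + deriv w (y + u y) * deriv u y := by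
      funext x
      have h1 := ((hw.diff (x + u x)).hasDerivAt.comp x
        ((hasDerivAt_id x).add (hu.diff x).hasDerivAt))
      refine h1.deriv.trans ?_
      ring
    rw [dsucc, dsucc, e1, dadd (u := fun y => deriv w (y + u y)) (v := fun y => deriv w (y + u y) * deriv u y)
      (hw.deriv'.comp (smid hu)) ((hw.deriv'.comp (smid hu)).mul hu.deriv')]
    have g1 := ih (deriv w) u hw.deriv' hu (A * lam) e lam (by positivity) he hl heK hwb.der
        (hub.mono (by omega) le_rfl hl) x
    have g2 := hp (deriv w) u hw.deriv' hu (A * lam) e lam (by positivity) he hl heK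
        hwb.der hub k le_rfl x
    calc _ = |(𝒟 k (fun y => deriv w (y + u y)) x - 𝒟 k (deriv w) (x + u x)) +
          𝒟 k (fun y => deriv w (y + u y) * deriv u y) x| := by congr 1; ring
      _ ≤ _ := (abs_add_le _ _).trans (add_le_add g1 g2)
      _ = _ := by ring

def uu (F : ℝ → ℝ) (i : ℕ) (P : ℤ) : ℝ → ℝ := fun x => F^[i] x - P - x

def AA (α : ℝ) (q : ℕ → ℕ) (p : ℕ → ℤ) (β B : ℕ → ℝ) (κ : ℝ) : Prop :=
  ∀ k, ∃ C : ℝ, 1 ≤ C ∧ ∀ F, Ev α q p β B F → ∀ n,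
    Bd k (C * β n) ((q n : ℝ) ^ κ) (uu F (q n) (p n))

namespace Ev
variable {α : ℝ} {q : ℕ → ℕ} {p : ℕ → ℤ} {β : ℕ → ℝ} {B : ℕ → ℝ} {F : ℝ → ℝ}

theorem smu (h : Ev α q p β B F) (i : ℕ) (P : ℤ) : Sm (uu F i P) :=
  ((h.ism _).sub contDiff_const).sub contDiff_id
theorem du (h : Ev α q p β B F) (i : ℕ) (P : ℤ) : deriv (uu F i P) = fun x => Real.exp (Lg F i x) - 1 :=
  funext fun x => (((h.ifd i x).sub_const _).sub (hasDerivAt_id x)).deriv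
theorem um (n : ℕ) (x : ℝ) : mm q p F n x = (-1) ^ n * uu F (q n) (p n) x := rfl
theorem um' (h : Ev α q p β B F) (n : ℕ) (x : ℝ) : |uu F (q n) (p n) x| = mm q p F n x := by
  have h1 : |mm q p F n x| = |uu F (q n) (p n) x| := by rw [um, abs_mul, abs_pow]; simp
  rw [← h1, abs_of_pos (h.mpos n x)]

theorem LS (k : ℕ) (K : ℝ) (hK : 0 ≤ K) : ∃ C : ℝ, 1 ≤ C ∧ ∀ F, Ev α q p β B F →
    ∀ w, Sm w → ∀ m A lam, 0 ≤ A → 0 ≤ lam →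
    Bd k A lam w → (∀ a < k, ∀ x, |𝒟 a (Lg F m) x| ≤ K * lam ^ a) →
    Bd k (C * A) lam (fun y => w (F^[m] y)) := by
  obtain ⟨C1, hC1, h1⟩ := expG (k-1) K hK
  obtain ⟨C, hC, h2⟩ := compG k (C1 * Real.exp K) (by positivity)
  refine ⟨C, hC, fun F h w hw m A lam hA hl hlb hmb a ha x => ?_⟩
  refine h2 w F^[m] hw (h.ism m) x A lam lam hA hl hl (fun a ha => hlb a ha _) (fun a ha => ?_) a ha
  rw [h.dF]
  have h3 := h1 (Lg F m) (h.smL m) x lam hl (fun a h1 h2 => hmb a (by omega) x) a (by omega)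
  have h4 : Lg F m x ≤ K := le_of_abs_le (by simpa using hmb 0 (by omega) x)
  calc _ ≤ lam * (C1 * Real.exp (Lg F m x) * lam ^ a) := by gcongr
    _ ≤ lam * (C1 * Real.exp K * lam ^ a) := by gcongr
    _ = _ := by ring

theorem Lmul (i m : ℕ) (x : ℝ) :
    Lg F (i * m) x = ∑ l ∈ Finset.range i, Lg F m (F^[l * m] x) := by
  induction i with
  | zero => simp [Lg]
  | succ i ih => rw [Finset.sum_range_succ, ← ih, Nat.succ_mul, add_comm, Lg_add, add_comm]

theorem G1 (cf : CF α q p β) (hd : DiophantineReal α) {κ : ℝ} (hA : AA α q p β B κ) (k : ℕ) :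
    ∃ C : ℝ, 1 ≤ C ∧ ∀ F, Ev α q p β B F → ∀ s lam, (q s : ℝ) ^ κ ≤ lam → β s * lam ≤ 1 →
    Bd k (C * (β s * lam)) lam (Lg F (q s)) := by
  obtain ⟨D, hD, hE⟩ := phE cf B hd
  obtain ⟨C1, hC1, h1⟩ := hA (k+1)
  obtain ⟨C2, hC2, h2⟩ := explog2 k (D + C1) (by linarith)
  have hCC : C1 ≤ C2 * C1 := by nlinarith
  refine ⟨C2 * C1 + Real.exp D * C1, by nlinarith [Real.exp_pos D], fun F h s lam hl hbl a ha x => ?_⟩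
  have hq : (0:ℝ) < q s := by linarith [cf.qR s]
  have hl0 : 0 < lam := (Real.rpow_pos_of_pos hq κ).trans_le hl
  have hb := cf.bpos s
  have g1 : Bd k (C1 * (β s * lam)) lam (fun y => Real.exp (Lg F (q s) y) - 1) := by
    rw [← h.du (q s) (p s)]
    intro a ha x
    have := h1 F h s (a+1) (by omega) x
    rw [dsucc] at this
    have hq' := Real.rpow_pos_of_pos hq κ
    calc _ ≤ _ := this
      _ ≤ C1 * β s * lam ^ (a+1) := by gcongr
      _ = _ := by ring
  have hL := abs_le.1 (hE F h (q s) x)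
  have hp : 0 < β s * lam := by positivity
  rcases Nat.eq_zero_or_pos a with rfl | ha0
  · have g2 := g1 0 (by omega) x
    simp only [iteratedDeriv_zero, pow_zero, mul_one] at g2 ⊢
    have g3 : |Lg F (q s) x| ≤ Real.exp D * |Real.exp (Lg F (q s) x) - 1| := by
      set y := Lg F (q s) x
      have e1 := Real.one_le_exp (show 0 ≤ D by linarith)
      rcases le_total 0 y with hy | hy
      · have := Real.add_one_le_exp y
        rw [abs_of_nonneg hy, abs_of_nonneg (by linarith)]
        nlinarith
      · have e2 : Real.exp y ≤ 1 := Real.exp_le_one_iff.2 hy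
        rw [abs_of_nonpos hy, abs_of_nonpos (by linarith)]
        have e3 := Real.add_one_le_exp (-y)
        have e4 : Real.exp (-y) * Real.exp y = 1 := by rw [← Real.exp_add]; simp
        have e5 : Real.exp (-y) ≤ Real.exp D := Real.exp_le_exp.2 (by linarith)
        calc -y ≤ Real.exp (-y) - 1 := by linarith
          _ = Real.exp (-y) * (1 - Real.exp y) := by rw [mul_sub, e4]; ring
          _ ≤ Real.exp D * (1 - Real.exp y) := by gcongr
          _ = _ := by ring
    calc _ ≤ _ := g3
      _ ≤ Real.exp D * (C1 * (β s * lam)) := by gcongr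
      _ ≤ _ := by
        have : 0 ≤ C2 * C1 * (β s * lam) := by positivity
        linarith
  · have g2 := h2 (Lg F (q s)) (h.smL _) x lam (C1 * (β s * lam)) hl0.le (by positivity)
      (by nlinarith) (by linarith) (fun a ha => g1 a ha x) a ha0 ha
    refine g2.trans (mul_le_mul_of_nonneg_right ?_ (by positivity))
    have : 0 ≤ Real.exp D * C1 * (β s * lam) := by positivity
    linarith

theorem G2 (cf : CF α q p β) (hd : DiophantineReal α) {κ : ℝ} (hA : AA α q p β B κ) (k : ℕ) :
    ∃ C : ℝ, 1 ≤ C ∧ ∀ F, Ev α q p β B F → ∀ s lam (b : ℕ), (q s : ℝ) ^ κ ≤ lam → β s * lam ≤ 1 →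
    b * β s * lam ≤ 1 → ∀ i ≤ b, Bd k (C * (b * β s * lam)) lam (Lg F (i * q s)) := by
  have main : ∀ k, ∀ K : ℝ, 0 ≤ K → ∃ C : ℝ, 1 ≤ C ∧ ∀ F, Ev α q p β B F → ∀ s lam (b : ℕ),
      (q s : ℝ) ^ κ ≤ lam → β s * lam ≤ 1 → b * β s * lam ≤ 1 →
      (∀ i ≤ b, ∀ a < k, ∀ x, |𝒟 a (Lg F (i * q s)) x| ≤ K * lam ^ a) →
      ∀ i ≤ b, Bd k (C * (b * β s * lam)) lam (Lg F (i * q s)) := by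
    intro k K hK
    obtain ⟨C1, hC1, h1⟩ := G1 cf hd hA k
    obtain ⟨C2, hC2, h2⟩ := LS (α := α) (q := q) (p := p) (β := β) (B := B) k K hK
    refine ⟨C2 * C1, by nlinarith, fun F h s lam b hl hbl hbb hlow i hi => ?_⟩
    have hq : (0:ℝ) < q s := by linarith [cf.qR s]
    have hl0 : 0 < lam := (Real.rpow_pos_of_pos hq κ).trans_le hl
    have hb := cf.bpos s
    have e : Lg F (i * q s) = fun y => ∑ l ∈ Finset.range i, Lg F (q s) (F^[l * q s] y) :=
      funext fun y => Lmul i (q s) y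
    rw [e]
    have g := Bd.sum (u := fun l y => Lg F (q s) (F^[l * q s] y)) (N := i) (k := k) (lam := lam)
      (A := C2 * (C1 * (β s * lam))) (fun l => (h.smL _).comp (h.ism _))
      (fun l hl' => h2 F h (Lg F (q s)) (h.smL _) (l * q s) _ lam (by positivity) hl0.le
        (h1 F h s lam hl hbl) (hlow l (by omega)))
    refine g.mono le_rfl ?_ hl0.le
    have : (i:ℝ) ≤ b := by exact_mod_cast hi
    calc _ ≤ b * (C2 * (C1 * (β s * lam))) := by gcongr
      _ = _ := by ring
  induction k with
  | zero =>
    obtain ⟨C, hC, hh⟩ := main 0 0 le_rfl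
    exact ⟨C, hC, fun F h s lam b hl hbl hbb => hh F h s lam b hl hbl hbb
      fun i hi a ha => absurd ha (by omega)⟩
  | succ k ih =>
    obtain ⟨C0, hC0, h0⟩ := ih
    obtain ⟨C, hC, hh⟩ := main (k+1) C0 (by linarith)
    refine ⟨C, hC, fun F h s lam b hl hbl hbb => hh F h s lam b hl hbl hbb fun i hi a ha x => ?_⟩
    have hq : (0:ℝ) < q s := by linarith [cf.qR s]
    have hl0 : 0 < lam := (Real.rpow_pos_of_pos hq κ).trans_le hl
    refine (h0 F h s lam b hl hbl hbb i hi a (by omega) x).trans ?_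
    gcongr
    nlinarith

theorem ub (h : Ev α q p β B F) (s b : ℕ) (x c1 c2 : ℝ) (hc : ∀ y, c1 ≤ mm q p F s y ∧ mm q p F s y ≤ c2) :
    b * c1 ≤ |uu F (b * q s) (b * p s) x| ∧ |uu F (b * q s) (b * p s) x| ≤ b * c2 := by
  have key : b * c1 ≤ (-1) ^ s * uu F (b * q s) (b * p s) x ∧ (-1) ^ s * uu F (b * q s) (b * p s) x ≤ b * c2 := by
    induction b with
    | zero => simp [uu]
    | succ b ih =>
      have e : (-1) ^ s * uu F ((b+1) * q s) ((b+1:ℕ) * p s) x = mm q p F s (F^[b * q s] x) +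
          (-1) ^ s * uu F (b * q s) (b * p s) x := by
        simp only [uu, mm]
        rw [← Function.iterate_add_apply, Nat.succ_mul, add_comm (q s)]
        push_cast; ring
      rw [e]
      have := hc (F^[b * q s] x)
      push_cast
      constructor <;> linarith [ih.1, ih.2]
  have hab : |uu F (b * q s) (b * p s) x| = |(-1) ^ s * uu F (b * q s) (b * p s) x| := by
    rw [abs_mul, abs_pow]; simp
  rw [hab]
  refine ⟨key.1.trans (le_abs_self _), ?_⟩
  rw [abs_le]; refine ⟨?_, key.2⟩
  have h0 : 0 ≤ (-1) ^ s * uu F (b * q s) (b * p s) x := by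
    clear hc key hab
    induction b with
    | zero => simp [uu]
    | succ b ih =>
      have e : (-1) ^ s * uu F ((b+1) * q s) ((b+1:ℕ) * p s) x = mm q p F s (F^[b * q s] x) +
          (-1) ^ s * uu F (b * q s) (b * p s) x := by
        simp only [uu, mm]
        rw [← Function.iterate_add_apply, Nat.succ_mul, add_comm (q s)]
        push_cast; ring
      rw [e]
      linarith [h.mpos s (F^[b * q s] x)]
  linarith [key.2]

theorem G3 (cf : CF α q p β) (hd : DiophantineReal α) {κ : ℝ} (hA : AA α q p β B κ) (k : ℕ) :
    ∃ C : ℝ, 1 ≤ C ∧ ∀ F, Ev α q p β B F → ∀ s lam (b : ℕ), (q s : ℝ) ^ κ ≤ lam → β s * lam ≤ 1 →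
    b * β s * lam ≤ 1 → Bd k (C * (b * β s)) lam (uu F (b * q s) (b * p s)) := by
  obtain ⟨C1, hC1, h1⟩ := G2 cf hd hA k
  obtain ⟨D, hD, hE⟩ := phC cf B hd
  obtain ⟨C2, hC2, h2⟩ := explog1 k C1 (by linarith)
  refine ⟨D + C2 * C1, by nlinarith, fun F h s lam b hl hbl hbb => ?_⟩
  have hq : (0:ℝ) < q s := by linarith [cf.qR s]
  have hl0 : 0 < lam := (Real.rpow_pos_of_pos hq κ).trans_le hl
  have hb := cf.bpos s
  have hbb0 : 0 ≤ b * β s := by positivity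
  refine Bd.mono (k := k+1) ?_ (Nat.le_succ k) le_rfl hl0.le
  refine Bd.ofder (fun x => ?_) ?_
  · have := (h.ub s b x 0 (D * β s) fun y => ⟨(h.mpos s y).le, (hE F h s y).2⟩).2
    refine this.trans ?_
    have : 0 ≤ C2 * C1 * (b * β s) := by positivity
    linarith
  · rw [h.du]
    intro a ha x
    have := h2 (Lg F (b * q s)) (h.smL _) x lam (C1 * (b * β s * lam)) hl0.le (by positivity)
      (by nlinarith) (fun a ha => h1 F h s lam b hl hbl hbb b le_rfl a ha x) a ha
    refine this.trans (mul_le_mul_of_nonneg_right ?_ (by positivity))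
    have : 0 ≤ D * (b * β s) * lam := by positivity
    linarith
end Ev

theorem dcomp (a b : ℕ) (u : ℝ → ℝ) : 𝒟 a (𝒟 b u) = 𝒟 (a + b) u := by
  simp only [iteratedDeriv_eq_iterate, Function.iterate_add_apply]
theorem dperi {u : ℝ → ℝ} (h : ∀ x, u (x+1) = u x) (a : ℕ) (x : ℝ) : 𝒟 a u (x+1) = 𝒟 a u x := by
  have h1 : (fun z => u (z + 1)) = u := funext h
  have h2 := iteratedDeriv_comp_add_const a u (1:ℝ)
  rw [h1] at h2
  exact (congrFun h2 x).symm

theorem ABS (k R : ℕ) (hR : 2 ≤ R) (C0 : ℝ) (hC0 : 1 ≤ C0) : ∃ C : ℝ, 1 ≤ C ∧ ∀ w u : ℝ → ℝ, Sm w → Sm u →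
    (∀ x, w (x+1) = w x) → ∀ b θ lam : ℝ, 0 < b → 0 < θ → 1 ≤ lam → θ * lam ≤ 1 → b * lam ≤ 1 →
    Bd k (C0 * b) lam w → Bd (k+1) (C0 * θ) lam u → (∀ x, θ ≤ C0 * |u x|) →
    (∀ x, w (x + u x) - w x = u (x + w x) - u x) →
    (∀ x, |𝒟 (R + (k+1)) w x| * θ ^ R ≤ C0 * b) →
    ∀ x, |𝒟 (k+1) w x| ≤ C * b * lam ^ (k+1) := by
  obtain ⟨C1, hC1, h1⟩ := DIF k C0 (by linarith)
  obtain ⟨C2, hC2, h2⟩ := DIF2 k C0 (by linarith)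
  obtain ⟨CI, hCI, hI⟩ := INT R
  set K := 2 * (C0 * CI) with hKd
  have hCC : 1 ≤ C0 * CI := one_le_mul_of_one_le_of_one_le hC0 hCI
  have hK : 1 ≤ K := by linarith
  refine ⟨2 * C0 * ((C1 + C2) * C0 ^ 2) + C0 * K ^ R, ?_, fun w u hw hu hper b θ lam hb hθ hl hθl hbl hwb hub hlow hcomm htop => ?_⟩
  · have : 1 ≤ C0 * K ^ R := one_le_mul_of_one_le_of_one_le hC0 (one_le_pow₀ hK)
    have : 0 ≤ 2 * C0 * ((C1 + C2) * C0 ^ 2) := by positivity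
    linarith
  have hl0 : 0 < lam := by linarith
  have g1 := h1 u w hu hw (C0 * θ) (C0 * b) lam (by positivity) (by positivity) hl0.le
    (by rw [mul_assoc]; nlinarith) hub hwb
  have g2 := h2 w u hw hu (C0 * b) (C0 * θ) lam (by positivity) (by positivity) hl0.le
    (by rw [mul_assoc]; nlinarith) hwb (hub.mono (by omega) le_rfl hl0.le)
  set E := (C1 + C2) * C0 ^ 2 * (b * lam ^ (k+1)) with hE
  have g3 : ∀ x, |𝒟 k w (x + u x) - 𝒟 k w x| ≤ E * θ := by
    intro x
    have e1 : (fun y => u (y + w y) - u y) = fun y => w (y + u y) - w y := funext fun y => (hcomm y).symm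
    have a1 := g1 k le_rfl x
    rw [e1, dsub (u := fun y => w (y + u y)) (hw.comp (smid hu)) hw] at a1
    have a2 := g2 x
    have : 𝒟 k w (x + u x) - 𝒟 k w x = (𝒟 k (fun y => w (y + u y)) x - 𝒟 k w x) -
      (𝒟 k (fun y => w (y + u y)) x - 𝒟 k w (x + u x)) := by ring
    rw [this]
    refine (abs_sub _ _).trans ((add_le_add a1 a2).trans (le_of_eq ?_))
    rw [hE]; ring
  obtain ⟨x0, hx0⟩ := exmax (f := fun x => |𝒟 (k+1) w x|) ((hw.iter (k+1)).continuous.abs)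
    fun x => by rw [dperi hper]
  set S := |𝒟 (k+1) w x0| with hS
  have hSx : ∀ x, |𝒟 (k+1) w x| ≤ S := hx0
  have hS0 : 0 ≤ S := abs_nonneg _
  set W := C0 * b / θ ^ R with hW
  set t := K * θ with ht
  have ht0 : 0 < t := by positivity
  have hWt : W * t ^ R = C0 * b * K ^ R := by
    rw [hW, ht, mul_pow]; field_simp
  have hv2 : ∀ x, |𝒟 (k+2) w x| * t ≤ CI * (S + C0 * b * K ^ R) := by
    intro x
    have := hI (𝒟 (k+1) w) (hw.iter _) x t S W ht0 (fun y _ => hSx y) (fun y _ => by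
      rw [dcomp, hW, le_div_iff₀ (by positivity)]; exact htop y) 1 (by omega)
    rw [hWt, dcomp, pow_one, show 1 + (k+1) = k+2 by ring] at this
    exact this
  have hfin : S ≤ E * C0 + (S + C0 * b * K ^ R) / 2 := by
    obtain ⟨c, hc, hc'⟩ := mvt (fun x => hw.hda k x) x0 (x0 + u x0)
    obtain ⟨d, hd, hd'⟩ := mvt (fun x => hw.hda (k+1) x) x0 c
    have hcx : |c - x0| ≤ |u x0| := by
      have := abs_sub_left_of_mem_uIcc hc
      simpa using this
    have b1 : |𝒟 (k+1) w c| * |u x0| ≤ E * θ := by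
      have := g3 x0
      rwa [hc', abs_mul, add_sub_cancel_left] at this
    have hu0 : |u x0| ≤ C0 * θ := by simpa using hub 0 (by omega) x0
    have hup : 0 < |u x0| := by
      have := hlow x0
      by_contra hn
      nlinarith
    have b2 : |𝒟 (k+1) w c| ≤ E * C0 := by
      have hE0 : 0 ≤ E := by positivity
      refine le_of_mul_le_mul_right (a := |u x0|) (b1.trans ?_) hup
      calc E * θ ≤ E * (C0 * |u x0|) := by gcongr; exact hlow x0
        _ = _ := by ring
    have b3 : |𝒟 (k+1) w c - 𝒟 (k+1) w x0| ≤ (S + C0 * b * K ^ R) / 2 := by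
      rw [hd', abs_mul]
      have b4 := hv2 d
      rw [ht, hKd] at b4
      have b5 : |𝒟 (k+2) w d| * (C0 * θ) ≤ (S + C0 * b * K ^ R) / 2 := by
        rw [hKd]
        refine le_of_mul_le_mul_left (a := 2 * CI) ?_ (by linarith)
        calc _ = |𝒟 (k+2) w d| * (2 * (C0 * CI) * θ) := by ring
          _ ≤ _ := b4
          _ = _ := by ring
      refine le_trans ?_ b5
      show |𝒟 (k+2) w d| * _ ≤ _
      gcongr
      exact hcx.trans hu0
    have := abs_sub_abs_le_abs_sub (𝒟 (k+1) w x0) (𝒟 (k+1) w c)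
    rw [abs_sub_comm] at this
    linarith
  intro x
  have hl1 : 1 ≤ lam ^ (k+1) := one_le_pow₀ hl
  calc _ ≤ S := hSx x
    _ ≤ 2 * (E * C0) + C0 * b * K ^ R * 1 := by linarith
    _ ≤ 2 * (E * C0) + C0 * b * K ^ R * lam ^ (k+1) := by gcongr
    _ = _ := by rw [hE]; ring

namespace Ev
variable {α : ℝ} {q : ℕ → ℕ} {p : ℕ → ℤ} {β : ℕ → ℝ} {B : ℕ → ℝ} {F : ℝ → ℝ}

theorem A34a (cf : CF α q p β) (hd : DiophantineReal α) (k : ℕ) : ∃ C : ℝ, 1 ≤ C ∧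
    ∀ F, Ev α q p β B F → ∀ n x, ∀ a ≤ k,
    |𝒟 (a+2) (uu F (q n) (p n)) x| ≤ C * √(q n) ^ (a+1) := by
  obtain ⟨D, hD, hB⟩ := phB cf B hd
  obtain ⟨D', hD', hC⟩ := phC cf B hd
  obtain ⟨D2, hD2, hE⟩ := phE cf B hd
  obtain ⟨C1, hC1, hN⟩ := Nc α q p β B k
  set K := √(D * D') * (2 + 1 / √(β 0)) with hK
  have hDD : 1 ≤ √(D * D') := Real.one_le_sqrt.2 (one_le_mul_of_one_le_of_one_le hD hD')
  have hb0 := Real.sqrt_pos.2 (cf.bpos 0)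
  have hK1 : 1 ≤ K := one_le_mul_of_one_le_of_one_le hDD (by
    have : 0 < 1 / √(β 0) := by positivity
    linarith)
  obtain ⟨C2, hC2, he⟩ := expG (k+1) (C1 * K ^ (k+1)) (by positivity)
  refine ⟨C2 * Real.exp D2, one_le_mul_of_one_le_of_one_le hC2 (Real.one_le_exp (by linarith)),
    fun F h n x a ha => ?_⟩
  have hq := cf.qR n
  have hq1 : 1 ≤ √(q n) := Real.one_le_sqrt.2 hq
  -- level
  have gen : ∀ l, √(MM q p F l) / mm q p F l x ≤ √(D * D') * (1 / √(β l)) := by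
    intro l
    have hm := h.mpos l x
    have hbl := cf.bpos l
    have e1 : √(MM q p F l) / mm q p F l x ≤ √D / √(mm q p F l x) := by
      rw [div_le_div_iff₀ hm (Real.sqrt_pos.2 hm)]
      have := Real.sqrt_le_sqrt (hB F h l x)
      rw [Real.sqrt_mul (by linarith)] at this
      have e := Real.mul_self_sqrt hm.le
      calc _ ≤ √D * √(mm q p F l x) * √(mm q p F l x) := by gcongr
        _ = _ := by rw [mul_assoc, e]
    refine e1.trans ?_
    rw [mul_one_div, div_le_div_iff₀ (Real.sqrt_pos.2 hm) (Real.sqrt_pos.2 hbl),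
      Real.sqrt_mul (by linarith), mul_assoc]
    gcongr
    rw [← Real.sqrt_mul (by linarith)]
    exact Real.sqrt_le_sqrt (hC F h l x).1
  have hlev : ∃ l, q n ≤ q (l+1) ∧ √(MM q p F l) / mm q p F l x ≤ K * √(q n) := by
    rcases n with _ | n
    · refine ⟨0, cf.qmono 0, (gen 0).trans ?_⟩
      rw [cf.q0, hK]; simp
      exact mul_le_mul_of_nonneg_left (by linarith) (by linarith)
    · refine ⟨n, le_rfl, (gen n).trans ?_⟩
      rw [hK, mul_assoc]
      gcongr
      have hbl := cf.bpos n
      have e1 : 1 / √(β n) ≤ 2 * √(q (n+1)) := by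
        rw [div_le_iff₀ (Real.sqrt_pos.2 hbl), mul_assoc, ← Real.sqrt_mul (by positivity)]
        have := cf.qb2 n
        have h5 : √(1/4) ≤ √(q (n+1) * β n) := Real.sqrt_le_sqrt (by linarith)
        have h6 : √(1/4 : ℝ) = 1/2 := by
          rw [show (1/4:ℝ) = (1/2)^2 by norm_num, Real.sqrt_sq (by norm_num)]
        linarith
      have : 0 ≤ 1 / √(β 0) * √(q (n+1)) := by positivity
      linarith
  obtain ⟨l, hl1, hl2⟩ := hlev
  have hL : ∀ a, 1 ≤ a → a ≤ k + 1 → |𝒟 a (Lg F (q n)) x| ≤ C1 * K ^ (k+1) * √(q n) ^ a := by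
    intro a ha1 ha
    obtain ⟨a, rfl⟩ : ∃ a', a = a' + 1 := ⟨a - 1, by omega⟩
    rw [dsucc, h.dL]
    refine (hN F h l (q n) x hl1 a (by omega)).trans ?_
    have hm := h.mpos l x
    calc _ ≤ C1 * (K * √(q n)) ^ (a+1) := by gcongr
      _ = C1 * K ^ (a+1) * √(q n) ^ (a+1) := by rw [mul_pow]; ring
      _ ≤ _ := by gcongr
  have h1 := he (Lg F (q n)) (h.smL _) x (√(q n)) (by positivity) hL (a+1) (by omega)
  have e2 : 𝒟 (a+2) (uu F (q n) (p n)) x = 𝒟 (a+1) (fun y => Real.exp (Lg F (q n) y)) x := by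
    rw [dsucc, h.du, dsub (h.smL _).exp contDiff_const]
    simp [iteratedDeriv_const]
  rw [e2]
  refine h1.trans ?_
  gcongr
  exact le_of_abs_le (hE F h (q n) x)

theorem A34 (cf : CF α q p β) (hd : DiophantineReal α) : AA α q p β B (3/4) := by
  intro k
  obtain ⟨c, hc, N, hN, hdio, -⟩ := cf.dio hd
  obtain ⟨D', hD', hC⟩ := phC cf B hd
  set R := 4 * N + k + 1 with hR
  obtain ⟨C1, hC1, h1⟩ := A34a (B := B) cf hd R
  obtain ⟨CI, hCI, hI⟩ := INT (R + 2)
  refine ⟨CI * (D' + C1 / c), ?_, fun F h n a ha x => ?_⟩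
  · refine one_le_mul_of_one_le_of_one_le hCI ?_
    have : 0 ≤ C1 / c := by positivity
    linarith
  have hq := cf.qR n
  have hq0 : (0:ℝ) < q n := by linarith
  have hb := cf.bpos n
  set t := ((q n : ℝ) ^ (3/4 : ℝ))⁻¹ with ht
  have hq34 : 0 < (q n : ℝ) ^ (3/4 : ℝ) := Real.rpow_pos_of_pos hq0 _
  have ht0 : 0 < t := by positivity
  have g := hI (uu F (q n) (p n)) (h.smu _ _) x t (D' * β n) (C1 * √(q n) ^ (R+1)) ht0
    (fun y _ => by rw [h.um']; exact (hC F h n y).2) (fun y _ => h1 F h n y R le_rfl) a (by omega)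
  have e1 : √(q n) ^ (R+1) * t ^ (R+2) ≤ β n / c := by
    have e2 : √(q n) ^ (R+1) * t ^ (R+2) ≤ (q n : ℝ) ^ (-(N:ℝ)) := by
      rw [ht, Real.sqrt_eq_rpow, ← Real.rpow_neg hq0.le, ← Real.rpow_natCast, ← Real.rpow_natCast,
        ← Real.rpow_mul hq0.le, ← Real.rpow_mul hq0.le, ← Real.rpow_add hq0]
      refine Real.rpow_le_rpow_of_exponent_le hq ?_
      rw [hR]; push_cast
      have : (0:ℝ) ≤ k := by positivity
      linarith
    refine e2.trans ?_
    rw [Real.rpow_neg hq0.le, Real.rpow_natCast, inv_eq_one_div, div_le_div_iff₀ (by positivity) hc]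
    linarith [hdio n]
  have e3 : |𝒟 a (uu F (q n) (p n)) x| * t ^ a ≤ CI * (D' + C1 / c) * β n := by
    refine g.trans ?_
    calc _ = CI * (D' * β n + C1 * (√(q n) ^ (R+1) * t ^ (R+2))) := by ring
      _ ≤ CI * (D' * β n + C1 * (β n / c)) := by gcongr
      _ = _ := by ring
  rw [ht, inv_pow, ← div_eq_mul_inv, div_le_iff₀ (by positivity)] at e3
  exact e3

set_option maxHeartbeats 1000000 in
theorem Astep (cf : CF α q p β) (hd : DiophantineReal α) {κ : ℝ} (hκ : 0 < κ) (hκ' : κ ≤ 3/4)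
    (hA : AA α q p β B κ) : AA α q p β B (7/8 * κ) := by
  obtain ⟨D, hD, hC⟩ := phC cf B hd
  intro k
  induction k with
  | zero =>
    refine ⟨D, hD, fun F h n a ha x => ?_⟩
    obtain rfl : a = 0 := by omega
    simp only [iteratedDeriv_zero, pow_zero, mul_one]
    rw [h.um']; exact (hC F h n x).2
  | succ k ih =>
    obtain ⟨C1, hC1, h1⟩ := ih
    set R := 6 * (k+1) with hR
    obtain ⟨C2, hC2, h2⟩ := G3 cf hd hA (k+1)
    obtain ⟨C3, hC3, h3⟩ := hA (R + (k+1))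
    obtain ⟨C, hCC, hh⟩ := ABS k R (by omega) (C1 + C2 + C3 + 2 * D) (by linarith)
    refine ⟨C1 + C, by linarith, fun F h n => ?_⟩
    have hq := cf.qR n
    have hq0 : (0:ℝ) < q n := by linarith
    have hb := cf.bpos n
    set lam := (q n : ℝ) ^ (7/8 * κ) with hlam
    set θ := (q n : ℝ) ^ (-(7/8) : ℝ) with hθ
    have hlam1 : 1 ≤ lam := Real.one_le_rpow hq (by positivity)
    have hθ0 : 0 < θ := Real.rpow_pos_of_pos hq0 _
    have hθl : θ * lam ≤ 1 := by
      rw [hθ, hlam, ← Real.rpow_add hq0]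
      exact Real.rpow_le_one_of_one_le_of_nonpos hq (by linarith)
    have hbl : β n * lam ≤ 1 := by
      have e1 : lam ≤ q n := by
        conv_rhs => rw [← Real.rpow_one (q n : ℝ)]
        exact Real.rpow_le_rpow_of_exponent_le hq (by linarith)
      have e2 : (q n : ℝ) ≤ q (n+1) := by exact_mod_cast cf.qmono n
      have := cf.qb n
      nlinarith
    -- choose s
    have hex : ∃ s, β s ≤ θ := by
      obtain ⟨s, hs⟩ := (cf.blim.eventually (gt_mem_nhds hθ0)).exists
      exact ⟨s, hs.le⟩
    classical
    obtain ⟨s, hs, hqs⟩ : ∃ s, β s ≤ θ ∧ (q s : ℝ) * θ ≤ 1 := by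
      refine ⟨Nat.find hex, Nat.find_spec hex, ?_⟩
      have hmin := fun m => Nat.find_min hex (m := m)
      rcases hns : Nat.find hex with _ | s
      · rw [cf.q0]; push_cast; nlinarith
      · have := hmin s (by omega)
        push Not at this
        have h5 := cf.qb s
        have h6 := cf.qR (s+1)
        nlinarith
    have hbs := cf.bpos s
    have hqs0 : (0:ℝ) < q s := by linarith [cf.qR s]
    set b := ⌊θ / β s⌋₊ with hbd
    have hb1 : b * β s ≤ θ := by
      have := Nat.floor_le (show 0 ≤ θ / β s by positivity)
      rwa [le_div_iff₀ hbs] at this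
    have hb2 : θ ≤ 2 * (b * β s) := by
      have e1 : 1 ≤ θ / β s := by rwa [le_div_iff₀ hbs, one_mul]
      have e2 : (1:ℝ) ≤ b := by
        have : 1 ≤ b := Nat.le_floor (by simpa using e1)
        exact_mod_cast this
      have e3 := Nat.lt_floor_add_one (θ / β s)
      rw [div_lt_iff₀ hbs] at e3
      have : θ < (b + 1) * β s := e3
      nlinarith
    have hqκ : (q s : ℝ) ^ κ ≤ lam := by
      have e1 : (q s : ℝ) ≤ (q n : ℝ) ^ (7/8 : ℝ) := by
        rw [hθ, Real.rpow_neg hq0.le, ← div_eq_mul_inv, div_le_one (Real.rpow_pos_of_pos hq0 _)] at hqs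
        exact hqs
      rw [hlam, Real.rpow_mul hq0.le]
      exact Real.rpow_le_rpow hqs0.le e1 hκ.le
    have hl0 : 0 < lam := by linarith
    have hub := h2 F h s lam b hqκ (by nlinarith) (by nlinarith)
    have hw := h1 F h n
    have key := hh (uu F (q n) (p n)) (uu F (b * q s) (b * p s)) (h.smu _ _) (h.smu _ _)
      (fun x => by
        have := h.iper (q n) 1 x
        push_cast at this
        simp only [uu]; rw [this]; ring)
      (β n) θ lam hb hθ0 hlam1 hθl hbl
      (hw.mono le_rfl (by gcongr; linarith) hl0.le)
      (hub.mono le_rfl (mul_le_mul (by linarith) hb1 (by positivity) (by linarith)) hl0.le)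
      (fun x => by
        have := (h.ub s b x (β s / D) (D * β s) fun y => ⟨by
          rw [div_le_iff₀ (by linarith)]; linarith [(hC F h s y).1], (hC F h s y).2⟩).1
        rw [mul_div_assoc', div_le_iff₀ (by linarith)] at this
        calc θ ≤ 2 * (b * β s) := hb2
          _ ≤ (2 * D) * |uu F (b * q s) (b * p s) x| := by linarith
          _ ≤ _ := by gcongr; linarith)
      (fun x => by
        have e1 : x + uu F (b * q s) (b * p s) x = F^[b * q s] x - ((b * p s : ℤ) : ℝ) := by
          simp only [uu]; ring
        have e2 : x + uu F (q n) (p n) x = F^[q n] x - p n := by simp only [uu]; ring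
        rw [e1, e2]
        simp only [uu]
        rw [h.iper', h.iper', ← Function.iterate_add_apply, ← Function.iterate_add_apply,
          add_comm (q n)]
        ring)
      (fun x => by
        have := h3 F h n (R + (k+1)) le_rfl x
        have e1 : ((q n : ℝ) ^ κ) ^ (R + (k+1)) * θ ^ R ≤ 1 := by
          rw [hθ, ← Real.rpow_natCast, ← Real.rpow_natCast, ← Real.rpow_mul hq0.le,
            ← Real.rpow_mul hq0.le, ← Real.rpow_add hq0]
          refine Real.rpow_le_one_of_one_le_of_nonpos hq ?_
          rw [hR]; push_cast
          have : κ * (k+1) ≤ 3/4 * (k+1) := by gcongr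
          linarith
        calc _ ≤ C3 * β n * ((q n : ℝ) ^ κ) ^ (R + (k+1)) * θ ^ R := by gcongr
          _ = C3 * β n * (((q n : ℝ) ^ κ) ^ (R + (k+1)) * θ ^ R) := by ring
          _ ≤ C3 * β n * 1 := by gcongr
          _ ≤ _ := by rw [mul_one]; gcongr; linarith)
    intro a ha x
    rcases Nat.lt_or_ge a (k+1) with hak | hak
    · refine (hw a (by omega) x).trans ?_
      gcongr; linarith
    · obtain rfl : a = k+1 := by omega
      refine (key x).trans ?_
      gcongr; linarith

theorem Aall (cf : CF α q p β) (hd : DiophantineReal α) {η : ℝ} (hη : 0 < η) :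
    ∃ κ, 0 < κ ∧ κ ≤ η ∧ AA α q p β B κ := by
  have h1 : ∀ m : ℕ, AA α q p β B ((7/8)^m * (3/4)) := by
    intro m
    induction m with
    | zero => simpa using A34 cf hd
    | succ m ih =>
      have := Astep cf hd (by positivity) (by
        have : ((7:ℝ)/8)^m ≤ 1 := pow_le_one₀ (by norm_num) (by norm_num)
        linarith) ih
      rwa [← mul_assoc, ← pow_succ'] at this
  obtain ⟨m, hm⟩ := exists_pow_lt_of_lt_one hη (by norm_num : (7/8:ℝ) < 1)
  have : (0:ℝ) < (7/8)^m := by positivity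
  exact ⟨_, by positivity, by linarith, h1 m⟩
end Ev

namespace Ev
variable {α : ℝ} {q : ℕ → ℕ} {p : ℕ → ℤ} {β : ℕ → ℝ} {B : ℕ → ℝ} {F : ℝ → ℝ}

theorem qsum (cf : CF α q p β) : ∃ E : ℝ, 1 ≤ E ∧ ∀ S, ∑ s ∈ Finset.range S, (√(q s))⁻¹ ≤ E := by
  have h1 := cf.bsum (t := 1/2) (by norm_num)
  have h2 : Summable fun s => (√(q s))⁻¹ := by
    rw [← summable_nat_add_iff 1]
    refine Summable.of_nonneg_of_le (fun s => by positivity) (fun s => ?_) (h1.mul_left 2)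
    have hq := cf.qR (s+1)
    have hb := cf.bpos s
    rw [← Real.sqrt_eq_rpow]
    rw [inv_le_iff_one_le_mul₀ (by positivity), mul_assoc, ← Real.sqrt_mul hb.le]
    have := cf.qb2 s
    have h5 : √(1/4) ≤ √(β s * q (s+1)) := Real.sqrt_le_sqrt (by linarith)
    have h6 : √(1/4 : ℝ) = 1/2 := by
      rw [show (1/4:ℝ) = (1/2)^2 by norm_num, Real.sqrt_sq (by norm_num)]
    linarith
  refine ⟨max 1 (∑' s, (√(q s))⁻¹), le_max_left _ _, fun S => le_max_of_le_right ?_⟩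
  exact h2.sum_le_tsum _ fun s _ => by positivity

theorem U (cf : CF α q p β) (hd : DiophantineReal α) (k : ℕ) : ∃ C : ℝ, 1 ≤ C ∧
    ∀ F, Ev α q p β B F → ∀ i, ∀ a ≤ k, ∀ x, |𝒟 a (Lg F i) x| ≤ C := by
  induction k with
  | zero =>
    obtain ⟨D, hD, h⟩ := phE cf B hd
    exact ⟨D, hD, fun F hF i a ha x => by
      obtain rfl : a = 0 := by omega
      simpa using h F hF i x⟩
  | succ k ih =>
    obtain ⟨K, hK, hlow⟩ := ih
    obtain ⟨κ, hκ, hκ2, hA⟩ := Aall (B := B) cf hd (η := 1 / (2 * (k+2))) (by positivity)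
    rw [le_div_iff₀ (by positivity)] at hκ2
    obtain ⟨C, hC, hG⟩ := G2 cf hd hA (k+1)
    obtain ⟨C2, hC2, hL⟩ := LS (α := α) (q := q) (p := p) (β := β) (B := B) (k+1) K (by linarith)
    obtain ⟨E, hE, hS⟩ := qsum cf
    refine ⟨C2 * C * E, one_le_mul_of_one_le_of_one_le (one_le_mul_of_one_le_of_one_le hC2 hC) hE,
      fun F h i a ha x => ?_⟩
    have main : ∀ S, ∀ i < q S, Bd (k+1) (C2 * C * ∑ s ∈ Finset.range S, (√(q s))⁻¹) 1 (Lg F i) := by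
      intro S
      induction S with
      | zero =>
        intro i hi a ha x
        obtain rfl : i = 0 := by have := cf.q0; omega
        have : Lg F 0 = fun _ => 0 := by funext y; simp [Lg]
        rw [this]
        simp [iteratedDeriv_const]
      | succ S ih =>
        intro i hi
        have hq1 := cf.qR S
        have hq : (0:ℝ) < q S := by linarith
        have hb := cf.bpos S
        set b := i / q S with hb'
        set i' := i % q S with hi'
        have hii : b * q S + i' = i := Nat.div_add_mod' i (q S)
        have hi1 : i' < q S := Nat.mod_lt _ (cf.qpos S)
        set lam := (q S : ℝ) ^ κ with hlam
        have hl1 : 1 ≤ lam := Real.one_le_rpow hq1 hκ.le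
        have hbq : b * β S ≤ (q S : ℝ)⁻¹ := by
          rw [← one_div, le_div_iff₀ hq]
          have h1 : (b:ℝ) * q S ≤ q (S+1) := by exact_mod_cast (by omega : b * q S ≤ q (S+1))
          have h2 := cf.qb S
          calc _ = (b:ℝ) * q S * β S := by ring
            _ ≤ q (S+1) * β S := by gcongr
            _ ≤ 1 := h2
        have hbe : β S ≤ (q S : ℝ)⁻¹ := by
          rw [← one_div, le_div_iff₀ hq]
          have h1 : (q S : ℝ) ≤ q (S+1) := by exact_mod_cast cf.qmono S
          have h2 := cf.qb S
          calc _ = (q S : ℝ) * β S := by ring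
            _ ≤ q (S+1) * β S := by gcongr
            _ ≤ 1 := h2
        have hsq : (q S : ℝ)⁻¹ * √(q S) = (√(q S))⁻¹ := by
          have h1 : √(q S) ≠ 0 := (Real.sqrt_pos.2 hq).ne'
          have h2 := Real.mul_self_sqrt hq.le
          field_simp
          rw [sq, h2]
        have hlp : ∀ a ≤ k + 1, lam ^ (a+1) ≤ √(q S) := by
          intro a ha
          rw [hlam, ← Real.rpow_natCast, ← Real.rpow_mul hq.le, Real.sqrt_eq_rpow]
          refine Real.rpow_le_rpow_of_exponent_le hq1 ?_
          have : ((a+1 : ℕ) : ℝ) ≤ k + 2 := by exact_mod_cast (by omega : a + 1 ≤ k + 2)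
          nlinarith [mul_le_mul_of_nonneg_left this hκ.le]
        have hle1 : (q S : ℝ)⁻¹ * lam ≤ 1 := by
          have h1 := hlp 0 (by omega)
          have h3 : (1:ℝ) ≤ √(q S) := Real.one_le_sqrt.2 hq1
          calc _ ≤ (q S : ℝ)⁻¹ * √(q S) := by gcongr; simpa using h1
            _ = (√(q S))⁻¹ := hsq
            _ ≤ 1 := inv_le_one_of_one_le₀ h3
        have hg := hG F h S lam b le_rfl ((mul_le_mul_of_nonneg_right hbe (by linarith)).trans hle1)
          ((mul_le_mul_of_nonneg_right hbq (by linarith)).trans hle1) b le_rfl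
        have hg1 : Bd (k+1) (C * (√(q S))⁻¹) 1 (Lg F (b * q S)) := by
          intro a ha x
          refine (hg a ha x).trans ?_
          rw [one_pow, mul_one, mul_assoc]
          gcongr
          calc b * β S * lam * lam ^ a = b * β S * lam ^ (a+1) := by ring
            _ ≤ (q S : ℝ)⁻¹ * √(q S) := by gcongr; exact hlp a ha
            _ = _ := hsq
        have h4 := hL F h _ (h.smL _) i' _ 1 (by positivity) zero_le_one hg1 (fun a ha x => by
          simpa using hlow F h i' a (by omega) x)
        have h5 := ih i' hi1
        have e : Lg F i = fun y => Lg F (b * q S) (F^[i'] y) + Lg F i' y := by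
          funext y; rw [← hii, Lg_add]
        intro a ha x
        rw [e, dadd (u := fun y => Lg F (b * q S) (F^[i'] y)) ((h.smL _).comp (h.ism i')) (h.smL _)]
        refine (abs_add_le _ _).trans ((add_le_add (h4 a ha x) (h5 a ha x)).trans ?_)
        rw [Finset.sum_range_succ]
        apply le_of_eq; ring
    have hi : i < q (2 * i + 2) := by have := cf.q2 (2 * i + 2); omega
    refine (main _ i hi a ha x).trans ?_
    rw [one_pow, mul_one]
    have := hS (2 * i + 2)
    gcongr
end Ev

theorem SMALL (k : ℕ) (K e : ℝ) (hK : 0 ≤ K) (he : 0 < e) : ∃ U : ℝ, 0 < U ∧ ∀ u : ℝ → ℝ, Sm u →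
    (∀ x, |u x| ≤ U) → (∀ x, |𝒟 (k+1) u x| ≤ K) → ∀ j ≤ k, ∀ x, |𝒟 j u x| ≤ e := by
  obtain ⟨C, hC, hI⟩ := INT (k+1)
  set t := min 1 (e / (2 * C * (K+1))) with ht
  have ht0 : 0 < t := by rw [ht]; positivity
  have ht1 : t ≤ 1 := min_le_left _ _
  have ht2 : t * (2 * C * (K+1)) ≤ e := by
    rw [← le_div_iff₀ (by positivity)]; exact min_le_right _ _
  refine ⟨e * t ^ k / (2 * C), by positivity, fun u hu h1 h2 j hj x => ?_⟩
  have h3 := hI u hu x t _ K ht0 (fun y _ => h1 y) (fun y _ => h2 y) j (by omega)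
  have h4 : t ^ k ≤ t ^ j := pow_le_pow_of_le_one ht0.le ht1 hj
  have h5 : 0 < t ^ k := by positivity
  have h6 : |𝒟 j u x| * t ^ k ≤ e * t ^ k := by
    calc |𝒟 j u x| * t ^ k ≤ |𝒟 j u x| * t ^ j := by gcongr
      _ ≤ _ := h3
      _ = (e / 2 + C * K * t) * t ^ k := by field_simp; ring
      _ ≤ e * t ^ k := by
        gcongr
        nlinarith [mul_pos ht0 (by linarith : 0 < C)]
  exact le_of_mul_le_mul_right h6 h5

theorem SMLIM {u : ℕ → ℝ → ℝ} (hu : ∀ n, Sm (u n)) {C : ℕ → ℝ} (hC : ∀ n a x, |𝒟 (a+1) (u n) x| ≤ C a)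
    (hc : ∀ e > 0, ∃ N, ∀ n ≥ N, ∀ m ≥ N, ∀ x, |u n x - u m x| ≤ e) :
    ∃ H, Sm H ∧ ∀ a x, Tendsto (fun n => 𝒟 a (u n) x) atTop (𝓝 (𝒟 a H x)) := by
  have hC0 : ∀ a, 0 ≤ C a := fun a => (abs_nonneg _).trans (hC 0 a 0)
  have h1 : ∀ a, ∀ e > 0, ∃ N, ∀ n ≥ N, ∀ m ≥ N, ∀ x, |𝒟 a (u n) x - 𝒟 a (u m) x| ≤ e := by
    intro a e he
    obtain ⟨U, hU, hS⟩ := SMALL a (2 * C a) e (by linarith [hC0 a]) he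
    obtain ⟨N, hN⟩ := hc U hU
    refine ⟨N, fun n hn m hm x => ?_⟩
    have := hS (fun y => u n y - u m y) ((hu n).sub (hu m)) (hN n hn m hm) (fun x => by
      rw [dsub (hu n) (hu m)]
      refine (abs_sub _ _).trans ?_
      linarith [hC n a x, hC m a x]) a le_rfl x
    rwa [dsub (hu n) (hu m)] at this
  have h2 : ∀ a, UniformCauchySeqOn (fun n => 𝒟 a (u n)) atTop univ := by
    intro a
    rw [Metric.uniformCauchySeqOn_iff]
    intro e he
    obtain ⟨N, hN⟩ := h1 a (e/2) (by linarith)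
    refine ⟨N, fun m hm n hn x _ => ?_⟩
    rw [Real.dist_eq]
    linarith [hN m hm n hn x]
  have h3 : ∀ a x, ∃ l, Tendsto (fun n => 𝒟 a (u n) x) atTop (𝓝 l) := fun a x =>
    cauchySeq_tendsto_of_complete ((h2 a).cauchySeq (mem_univ x))
  choose V hV using h3
  have h4 : ∀ a x, HasDerivAt (V a) (V (a+1) x) x := by
    intro a x
    refine hasDerivAt_of_tendstoLocallyUniformlyOn isOpen_univ (f := fun n => 𝒟 a (u n))
      (f' := fun n => 𝒟 (a+1) (u n)) (l := atTop)
      (((h2 (a+1)).tendstoUniformlyOn_of_tendsto fun x _ => hV (a+1) x).tendstoLocallyUniformlyOn)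
      (Eventually.of_forall fun n x _ => (hu n).hda a x) (fun x _ => hV a x) (mem_univ x)
  have h5 : ∀ a, 𝒟 a (V 0) = V a := by
    intro a
    induction a with
    | zero => simp
    | succ a ih =>
      rw [iteratedDeriv_succ, ih]
      exact funext fun x => (h4 a x).deriv
  refine ⟨V 0, ?_, fun a x => by rw [h5]; exact hV a x⟩
  refine contDiff_of_differentiable_iteratedDeriv fun a _ => ?_
  rw [h5]
  exact fun x => (h4 a x).differentiableAt

namespace Ev
variable {α : ℝ} {q : ℕ → ℕ} {p : ℕ → ℤ} {β : ℕ → ℝ} {B : ℕ → ℝ} {F : ℝ → ℝ}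

theorem osc (cf : CF α q p β) (hd : DiophantineReal α) : ∃ K : ℝ, 1 ≤ K ∧ ∀ F, Ev α q p β B F →
    ∀ (D : ℝ → ℝ) (L e : ℝ), (∀ x, D (x+1) = D x) → (∀ x y, |D x - D y| ≤ L * |x - y|) →
    (∀ x, |D (F x) - D x| ≤ e) → ∀ n x y, |D y - D x| ≤ (q n + q (n+1)) * e + L * (K * β n) := by
  obtain ⟨K, hK, hm⟩ := phC cf B hd
  refine ⟨K, hK, fun F h D L e hper hL he n x y => ?_⟩
  have hperZ : ∀ (k : ℤ) x, D (x + k) = D x := by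
    intro k x
    have : Function.Periodic D 1 := hper
    simpa using this.int_mul k x
  have hit : ∀ (a : ℕ) z, |D (F^[a] z) - D z| ≤ a * e := by
    intro a z
    induction a with
    | zero => simp
    | succ a ih =>
      rw [Function.iterate_succ_apply']
      have := he (F^[a] z)
      push_cast
      calc _ = |(D (F (F^[a] z)) - D (F^[a] z)) + (D (F^[a] z) - D z)| := by ring_nf
        _ ≤ _ := (abs_add_le _ _).trans (by linarith)
  obtain ⟨a, ha, z, hz, k, hk⟩ := h.cov n x y
  have h1 := hit a z
  rw [hk, hperZ] at h1
  have h2 := hL z x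
  have h3 := inIabs hz
  have h4 := (hm F h n x).2
  have he0 : 0 ≤ e := (abs_nonneg _).trans (he 0)
  have hL0 : 0 ≤ L := by simpa using (abs_nonneg _).trans (hL 1 0)
  have ha' : (a:ℝ) ≤ q n + q (n+1) := by exact_mod_cast ha.le
  calc |D y - D x| = |(D y - D z) + (D z - D x)| := by ring_nf
    _ ≤ |D y - D z| + |D z - D x| := abs_add_le _ _
    _ ≤ a * e + L * |z - x| := by linarith
    _ ≤ _ := by gcongr; linarith

theorem dFb (cf : CF α q p β) (hd : DiophantineReal α) (k : ℕ) : ∃ C : ℝ, 1 ≤ C ∧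
    ∀ F, Ev α q p β B F → ∀ i x, C⁻¹ ≤ deriv F^[i] x ∧ |𝒟 (k+1) F^[i] x| ≤ C := by
  obtain ⟨K, hK, hU⟩ := U (B := B) cf hd k
  obtain ⟨C, hC, he⟩ := expG k K (by linarith)
  have hE : 1 ≤ Real.exp K := Real.one_le_exp (by linarith)
  refine ⟨C * Real.exp K, one_le_mul_of_one_le_of_one_le hC hE, fun F h i x => ?_⟩
  have h0 := hU F h i 0 (by omega) x
  rw [iteratedDeriv_zero] at h0
  constructor
  · rw [h.dF, mul_inv, ← Real.exp_neg]
    calc _ ≤ 1 * Real.exp (-K) := by gcongr; exact inv_le_one_of_one_le₀ hC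
      _ ≤ _ := by rw [one_mul]; exact Real.exp_le_exp.2 (abs_le.1 h0).1
  · rw [dsucc, h.dF]
    have := he (Lg F i) (h.smL i) x 1 zero_le_one (fun a _ ha => by simpa using hU F h i a ha x) k le_rfl
    refine this.trans ?_
    rw [one_pow, mul_one]
    gcongr
    exact (abs_le.1 h0).2

end Ev

theorem mvtL {u : ℝ → ℝ} (hu : Sm u) {L : ℝ} (hL : ∀ x, |deriv u x| ≤ L) (x y : ℝ) :
    |u x - u y| ≤ L * |x - y| := by
  have := Convex.norm_image_sub_le_of_norm_deriv_le (f := u) (s := univ) (C := L) (x := y) (y := x)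
    (fun z _ => hu.diff z) (fun z _ => hL z) convex_univ (mem_univ _) (mem_univ _)
  simpa [Real.norm_eq_abs] using this

def AV (F : ℝ → ℝ) (N : ℕ) (x : ℝ) : ℝ := ∑ i ∈ Finset.range (N+1), ((N:ℝ)+1)⁻¹ * F^[i] x
def GV (F : ℝ → ℝ) (N : ℕ) (x : ℝ) : ℝ := AV F N x - AV F N 0

namespace Ev
variable {α : ℝ} {q : ℕ → ℕ} {p : ℕ → ℤ} {β : ℕ → ℝ} {B : ℕ → ℝ} {F : ℝ → ℝ}

theorem smAV (h : Ev α q p β B F) (N : ℕ) : Sm (AV F N) :=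
  ContDiff.sum fun i _ => contDiff_const.mul (h.ism i)
theorem smGV (h : Ev α q p β B F) (N : ℕ) : Sm (GV F N) := (h.smAV N).sub contDiff_const

theorem dGV (h : Ev α q p β B F) (N a : ℕ) (x : ℝ) :
    𝒟 (a+1) (GV F N) x = ∑ i ∈ Finset.range (N+1), ((N:ℝ)+1)⁻¹ * 𝒟 (a+1) F^[i] x := by
  have e : GV F N = fun x => AV F N x - AV F N 0 := rfl
  have e2 : AV F N = fun x => ∑ i ∈ Finset.range (N+1), (fun i x => ((N:ℝ)+1)⁻¹ * F^[i] x) i x := rfl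
  rw [e, dsub (h.smAV N) contDiff_const]
  simp only [iteratedDeriv_const, Nat.succ_ne_zero, if_false, sub_zero]
  rw [e2, dsum (fun i => contDiff_const.mul (h.ism i))]
  refine Finset.sum_congr rfl fun i _ => ?_
  exact iteratedDeriv_const_mul_field _ _

theorem GVF (h : Ev α q p β B F) (N : ℕ) (x : ℝ) : |GV F N (F x) - GV F N x - α| ≤ ((N:ℝ)+1)⁻¹ := by
  have e : GV F N (F x) - GV F N x = ((N:ℝ)+1)⁻¹ * (F^[N+1] x - x) := by
    simp only [GV, AV, ← Finset.mul_sum]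
    have := Finset.sum_range_sub (fun i => F^[i] x) (N+1)
    simp only [Function.iterate_succ_apply, Finset.sum_sub_distrib, Function.iterate_zero, id] at this ⊢
    rw [← this]; ring
  have h1 := h.orb (N+1) x
  have hN : (0:ℝ) < (N:ℝ)+1 := by positivity
  have e2 : GV F N (F x) - GV F N x - α = ((N:ℝ)+1)⁻¹ * (F^[N+1] x - x - (N+1 : ℕ) * α) := by
    rw [e]; push_cast; field_simp
  rw [e2, abs_mul, abs_of_pos (by positivity : 0 < ((N:ℝ)+1)⁻¹)]
  exact mul_le_of_le_one_right (by positivity) h1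

theorem GVper (h : Ev α q p β B F) (N : ℕ) (x : ℝ) : GV F N (x+1) = GV F N x + 1 := by
  have hN : (0:ℝ) < (N:ℝ)+1 := by positivity
  have h1 : ∀ i, F^[i] (x+1) = F^[i] x + 1 := fun i => by simpa using h.iper i 1 x
  simp only [GV, AV, h1, mul_add, Finset.sum_add_distrib]
  simp
  field_simp
  ring

theorem Hex (cf : CF α q p β) (hd : DiophantineReal α) : ∃ C : ℕ → ℝ, (∀ j, 1 ≤ C j) ∧
    ∀ F, Ev α q p β B F → ∃ H : ℝ → ℝ, Sm H ∧ (∀ x, H (F x) = H x + α) ∧ (∀ x, H (x+1) = H x + 1) ∧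
    H 0 = 0 ∧ (∀ x, (C 0)⁻¹ ≤ deriv H x) ∧ ∀ j x, |𝒟 (j+1) H x| ≤ C j := by
  choose C hC hb using dFb (B := B) cf hd
  obtain ⟨K, hK, hosc⟩ := osc (B := B) cf hd
  refine ⟨C, hC, fun F h => ?_⟩
  have hone : ∀ (N : ℕ) (c : ℝ), ∑ i ∈ Finset.range (N+1), ((N:ℝ)+1)⁻¹ * c = c := by
    intro N c
    have hN : (0:ℝ) < (N:ℝ)+1 := by positivity
    simp; field_simp
  have hup : ∀ N a x, |𝒟 (a+1) (GV F N) x| ≤ C a := by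
    intro N a x
    rw [h.dGV, ← hone N (C a)]
    refine (Finset.abs_sum_le_sum_abs _ _).trans (Finset.sum_le_sum fun i _ => ?_)
    rw [abs_mul, abs_of_nonneg (by positivity : 0 ≤ ((N:ℝ)+1)⁻¹)]
    gcongr
    exact (hb a F h i x).2
  have hlo : ∀ N x, (C 0)⁻¹ ≤ 𝒟 1 (GV F N) x := by
    intro N x
    rw [h.dGV N 0, ← hone N (C 0)⁻¹]
    refine Finset.sum_le_sum fun i _ => ?_
    gcongr
    simpa [iteratedDeriv_one] using (hb 0 F h i x).1
  have hG0 : ∀ N, GV F N 0 = 0 := fun N => by simp [GV]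
  have hcau : ∀ e > 0, ∃ N, ∀ n ≥ N, ∀ m ≥ N, ∀ x, |GV F n x - GV F m x| ≤ e := by
    intro e he
    obtain ⟨s, hs⟩ := (cf.blim.eventually (gt_mem_nhds (by
      have := hC 0
      positivity : 0 < e / (4 * C 0 * K)))).exists
    have hC0 := hC 0
    rw [lt_div_iff₀ (by positivity)] at hs
    obtain ⟨N, hN⟩ := exists_nat_gt (4 * (q s + q (s+1)) / e)
    rw [div_lt_iff₀ he] at hN
    refine ⟨N, fun n hn m hm x => ?_⟩
    have hNn : ∀ n ≥ N, (q s + q (s+1)) * ((n:ℝ)+1)⁻¹ ≤ e / 4 := by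
      intro n hn
      rw [← div_eq_mul_inv, div_le_iff₀ (by positivity)]
      have : (N:ℝ) ≤ n := by exact_mod_cast hn
      nlinarith
    have := hosc F h (fun x => GV F n x - GV F m x) (2 * C 0) (((n:ℝ)+1)⁻¹ + ((m:ℝ)+1)⁻¹)
      (fun x => by simp only [h.GVper]; ring)
      (mvtL (u := fun x => GV F n x - GV F m x) ((h.smGV n).sub (h.smGV m)) fun x => by
        rw [← iteratedDeriv_one, dsub (h.smGV n) (h.smGV m)]
        exact (abs_sub _ _).trans (by linarith [hup n 0 x, hup m 0 x]))
      (fun x => by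
        have h1 := h.GVF n x
        have h2 := h.GVF m x
        calc _ = |(GV F n (F x) - GV F n x - α) - (GV F m (F x) - GV F m x - α)| := by ring_nf
          _ ≤ _ := (abs_sub _ _).trans (by linarith)) s 0 x
    simp only [hG0, sub_zero] at this
    have a1 := hNn n hn
    have a2 := hNn m hm
    refine this.trans ?_
    linarith
  obtain ⟨H, hH, hT⟩ := SMLIM (u := GV F) h.smGV hup hcau
  have hT0 : ∀ x, Tendsto (fun n => GV F n x) atTop (𝓝 (H x)) := fun x => by simpa using hT 0 x
  refine ⟨H, hH, fun x => ?_, fun x => ?_, ?_, fun x => ?_, fun j x => ?_⟩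
  · have h1 := ((hT0 (F x)).sub (hT0 x)).sub_const α
    have h2 : Tendsto (fun n => GV F n (F x) - GV F n x - α) atTop (𝓝 0) :=
      squeeze_zero_norm (fun n => h.GVF n x) (by
        simpa using tendsto_one_div_add_atTop_nhds_zero_nat (𝕜 := ℝ))
    have := tendsto_nhds_unique h1 h2
    linarith
  · refine tendsto_nhds_unique (hT0 (x+1)) ?_
    simp only [h.GVper]
    exact (hT0 x).add_const 1
  · refine tendsto_nhds_unique (hT0 0) ?_
    simp only [hG0]
    exact tendsto_const_nhds
  · rw [← iteratedDeriv_one]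
    exact ge_of_tendsto' (hT 1 x) fun n => hlo n x
  · exact le_of_tendsto' (hT (j+1) x).abs fun n => hup n j x

end Ev

theorem dsubc {u : ℝ → ℝ} (hu : Sm u) (c : ℝ) (a : ℕ) : 𝒟 (a+1) (fun y => u y - c) = 𝒟 (a+1) u := by
  rw [dsub hu contDiff_const]
  simp [iteratedDeriv_const]

theorem smlog {F : ℝ → ℝ} (hF : Sm F) (h : ∀ x, 0 < deriv F x) : Sm (fun y => Real.log (deriv F y)) :=
  hF.deriv'.log fun x => (h x).ne'

theorem LOGB (k : ℕ) (E : ℝ) (hE : 1 ≤ E) : ∃ C : ℝ, 1 ≤ C ∧ ∀ F, Sm F → (∀ x, E⁻¹ ≤ deriv F x) →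
    (∀ a ≤ k, ∀ x, |𝒟 (a+1) F x| ≤ E) → ∀ a ≤ k, ∀ x, |𝒟 a (fun y => Real.log (deriv F y)) x| ≤ C := by
  obtain ⟨C, hC, hh⟩ := explog2 k (E+1) (by linarith)
  refine ⟨C * (E+1), by nlinarith, fun F hF hlo hhi a ha x => ?_⟩
  have hpos : ∀ x, 0 < deriv F x := fun x => (by positivity : 0 < E⁻¹).trans_le (hlo x)
  have hl : -E ≤ Real.log (deriv F x) := by
    have h4 := Real.log_le_log (by positivity) (hlo x)
    rw [Real.log_inv] at h4
    linarith [Real.log_le_sub_one_of_pos (show 0 < E by linarith)]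
  rcases Nat.eq_zero_or_pos a with h0 | h0
  · subst h0
    have h3 : deriv F x ≤ E := by
      have := hhi 0 (by omega) x
      rw [zero_add, iteratedDeriv_one] at this; exact (abs_le.1 this).2
    have h5 := Real.log_le_sub_one_of_pos (hpos x)
    rw [iteratedDeriv_zero, abs_le]
    constructor <;> nlinarith
  have := hh _ (smlog hF hpos) x 1 (E+1) zero_le_one (by linarith) le_rfl (by linarith) (fun b hb => by
    have e : (fun y => Real.exp (Real.log (deriv F y)) - 1) = fun y => deriv F y - 1 := by
      ext y; rw [Real.exp_log (hpos y)]
    rw [e, one_pow, mul_one]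
    have h8 := hhi b hb x
    rw [dsucc] at h8
    rcases b with _ | b
    · simp only [iteratedDeriv_zero] at h8 ⊢
      refine (abs_sub _ _).trans ?_
      simpa using h8
    · rw [dsubc hF.deriv']; linarith) a h0 ha
  simpa using this

theorem dinv {F K : ℝ → ℝ} (hF : Sm F) (hK : Sm K) (h : ∀ x, F (K x) = x) (x : ℝ) :
    deriv F (K x) * deriv K x = 1 := by
  have h1 := ((hF.diff (K x)).hasDerivAt.comp x (hK.diff x).hasDerivAt)
  have h2 : F ∘ K = id := funext h
  rw [h2] at h1
  exact h1.unique (hasDerivAt_id x)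

theorem INVB (E : ℝ) (hE : 1 ≤ E) (k : ℕ) : ∃ C : ℝ, 1 ≤ C ∧ ∀ F K, Sm F → Sm K → (∀ x, F (K x) = x) →
    (∀ x, E⁻¹ ≤ deriv F x) → (∀ a ≤ k, ∀ x, |𝒟 (a+1) F x| ≤ E) → ∀ a ≤ k, ∀ x, |𝒟 (a+1) K x| ≤ C := by
  have key : ∀ F K, Sm F → Sm K → (∀ x, F (K x) = x) → (∀ x, E⁻¹ ≤ deriv F x) →
      (∀ x, deriv K x = Real.exp (-Real.log (deriv F (K x)))) ∧ ∀ x, |deriv K x| ≤ E := by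
    intro F K hF hK hFK hlo
    have hpos : ∀ x, 0 < deriv F x := fun x => (by positivity : 0 < E⁻¹).trans_le (hlo x)
    have e : ∀ x, deriv K x = (deriv F (K x))⁻¹ := fun x =>
      eq_inv_of_mul_eq_one_right (dinv hF hK hFK x)
    refine ⟨fun x => ?_, fun x => ?_⟩
    · rw [Real.exp_neg, Real.exp_log (hpos _), e]
    · rw [e, abs_of_pos (inv_pos.2 (hpos _))]
      exact inv_le_of_inv_le₀ (by linarith) (hlo _)
  induction k with
  | zero =>
    refine ⟨E, hE, fun F K hF hK hFK hlo hhi a ha x => ?_⟩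
    obtain rfl : a = 0 := by omega
    rw [zero_add, iteratedDeriv_one]
    exact (key F K hF hK hFK hlo).2 x
  | succ k ih =>
    obtain ⟨C0, hC0, ih⟩ := ih
    obtain ⟨C1, hC1, h1⟩ := LOGB (k+1) E hE
    obtain ⟨C2, hC2, h2⟩ := compG (k+1) C0 (by linarith)
    obtain ⟨C3, hC3, h3⟩ := expG (k+1) (C2 * C1) (by positivity)
    refine ⟨C3 * E, by nlinarith, fun F K hF hK hFK hlo hhi a ha x => ?_⟩
    have hpos : ∀ x, 0 < deriv F x := fun x => (by positivity : 0 < E⁻¹).trans_le (hlo x)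
    obtain ⟨k1, k2⟩ := key F K hF hK hFK hlo
    have hsm := (smlog hF hpos).neg
    have i1 := ih F K hF hK hFK hlo (fun a ha => hhi a (by omega))
    have i2 := h1 F hF hlo hhi
    have i3 := h2 (fun y => -Real.log (deriv F y)) K hsm hK x C1 1 1 (by linarith) zero_le_one zero_le_one
      (fun a ha => by
        rw [iteratedDeriv_fun_neg, abs_neg]
        simpa using i2 a ha (K x))
      (fun a ha => by
        rw [← dsucc]; simpa using i1 a (by omega) x)
    have i4 := h3 (fun y => -Real.log (deriv F (K y))) (hsm.comp hK) x 1 zero_le_one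
      (fun a _ ha => by simpa using i3 a ha) a ha
    have e : (fun y => Real.exp (-Real.log (deriv F (K y)))) = deriv K := funext fun y => (k1 y).symm
    rw [e, ← k1, one_pow, mul_one] at i4
    rw [dsucc]
    refine i4.trans ?_
    gcongr
    exact (le_abs_self _).trans (k2 x)

theorem COMPB (E : ℝ) (hE : 1 ≤ E) (k : ℕ) : ∃ C : ℝ, 1 ≤ C ∧ ∀ F G, Sm F → Sm G →
    (∀ a ≤ k, ∀ x, |𝒟 (a+1) F x| ≤ E) → (∀ a ≤ k, ∀ x, |𝒟 (a+1) G x| ≤ E) →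
    ∀ a ≤ k, ∀ x, |𝒟 (a+1) (fun y => F (G y)) x| ≤ C := by
  obtain ⟨C2, hC2, h2⟩ := compG (k+1) E (by linarith)
  refine ⟨C2 * E, by nlinarith, fun F G hF hG h3 h4 a ha x => ?_⟩
  have := h2 (fun y => F y - F (G x)) G (hF.sub contDiff_const) hG x E 1 1 (by linarith) zero_le_one
    zero_le_one (fun a ha => by
      rcases a with _ | a
      · simp; linarith
      · rw [dsubc hF]; simpa using h3 a (by omega) _) (fun a ha => by
      rw [← dsucc]; simpa using h4 a (by omega) x) (a+1) (by omega)
  rw [dsubc (u := fun y => F (G y)) (hF.comp hG)] at this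
  simpa using this

-- lifts
structure Lf (F : ℝ → ℝ) : Prop where
  sm : Sm F
  per : ∀ x, F (x+1) = F x + 1
  pos : ∀ x, 0 < deriv F x

namespace Lf
variable {F G : ℝ → ℝ}

theorem mono (h : Lf F) : StrictMono F := strictMono_of_deriv_pos h.pos

theorem perZ (h : Lf F) (k : ℤ) (x : ℝ) : F (x + k) = F x + k := by
  have : Function.Periodic (fun y => F y - y) 1 := fun y => by simp only [h.per]; ring
  have := this.int_mul k x
  simp at this; linarith

theorem comp (hF : Lf F) (hG : Lf G) : Lf (fun x => F (G x)) := by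
  refine ⟨hF.sm.comp hG.sm, fun x => by rw [hG.per, hF.per], fun x => ?_⟩
  have := ((hF.sm.diff (G x)).hasDerivAt.comp x (hG.sm.diff x).hasDerivAt).deriv
  change 0 < deriv (F ∘ G) x
  rw [this]
  exact mul_pos (hF.pos _) (hG.pos _)

theorem surj (h : Lf F) : Function.Surjective F := by
  refine h.sm.continuous.surjective ?_ ?_
  · refine tendsto_atTop_mono (f := fun x => F 0 + (x - 1)) (fun x => ?_)
      (tendsto_atTop_add_const_left _ _ (tendsto_atTop_add_const_right _ _ tendsto_id))
    have h1 := h.perZ ⌊x⌋ 0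
    have h2 := h.mono.monotone (show 0 + (⌊x⌋:ℝ) ≤ x by simpa using Int.floor_le x)
    have := Int.sub_one_lt_floor x
    linarith
  · refine tendsto_atBot_mono (g := F) (f := fun x => F 0 + (x + 1)) (fun x => ?_)
      (tendsto_atBot_add_const_left _ _ (tendsto_atBot_add_const_right _ _ tendsto_id))
    have h1 := h.perZ ⌈x⌉ 0
    have h2 := h.mono.monotone (show x ≤ 0 + (⌈x⌉:ℝ) by simpa using Int.le_ceil x)
    have := Int.ceil_lt_add_one x
    linarith

theorem inv (h : Lf F) : ∃ K, Lf K ∧ (∀ x, F (K x) = x) ∧ ∀ x, K (F x) = x := by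
  let e := h.mono.orderIsoOfSurjective F h.surj
  have he : ∀ x, e x = F x := fun x => rfl
  have hr : ∀ x, F (e.symm x) = x := fun x => e.apply_symm_apply x
  have hl : ∀ x, e.symm (F x) = x := fun x => e.symm_apply_apply x
  have hsm : Sm e.symm := by
    have := e.toHomeomorph.contDiff_symm_deriv (n := (⊤:ℕ∞)) (f' := deriv F) (𝕜 := ℝ)
      (fun x => (h.pos x).ne') (fun x => (h.sm.diff x).hasDerivAt) h.sm
    exact this
  refine ⟨e.symm, ⟨hsm, fun x => ?_, fun x => ?_⟩, hr, hl⟩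
  · apply h.mono.injective
    rw [hr, h.per, hr]
  · have h1 := dinv h.sm hsm hr x
    have h2 := h.pos (e.symm x)
    by_contra h3
    nlinarith [not_lt.1 h3]

theorem dperi (h : Lf F) (a : ℕ) (x : ℝ) : 𝒟 (a+1) F (x+1) = 𝒟 (a+1) F x := by
  rw [dsucc]
  refine _root_.dperi (fun x => ?_) a x
  have h1 : (fun z => F (z + 1)) = fun z => F z + 1 := funext h.per
  have h2 := deriv_comp_add_const F 1 x
  rw [h1, deriv_add_const] at h2
  exact h2.symm

theorem exB (h : Lf F) : ∃ C : ℕ → ℝ, (∀ j, 1 ≤ C j) ∧ (∀ x, (C 0)⁻¹ ≤ deriv F x) ∧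
    ∀ j x, |𝒟 (j+1) F x| ≤ C j := by
  have bd : ∀ u : ℝ → ℝ, Continuous u → (∀ x, u (x+1) = u x) → ∃ C : ℝ, 1 ≤ C ∧ ∀ x, |u x| ≤ C := by
    intro u hu hp
    obtain ⟨C, hC⟩ := (isCompact_Icc (a := (0:ℝ)) (b := 1)).exists_bound_of_continuousOn hu.continuousOn
    refine ⟨max 1 C, le_max_left _ _, fun x => ?_⟩
    have : Function.Periodic u 1 := hp
    obtain ⟨y, hy, hxy⟩ := this.exists_mem_Ico₀ one_pos x
    rw [hxy]
    exact (hC y ⟨hy.1, hy.2.le⟩).trans (le_max_right _ _)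
  have h1 := fun j => bd (𝒟 (j+1) F) (h.sm.iter _).continuous (h.dperi j)
  choose C hC hCb using h1
  obtain ⟨D, hD, hDb⟩ := bd (fun x => (deriv F x)⁻¹)
    (h.sm.deriv'.continuous.inv₀ fun x => (h.pos x).ne') (fun x => by
      have := h.dperi 0 x
      simp only [zero_add, iteratedDeriv_one] at this
      rw [this])
  refine ⟨fun j => C j + D, fun j => by linarith [hC j], fun x => ?_, fun j x => by linarith [hCb j x]⟩
  refine inv_le_of_inv_le₀ (h.pos x) ?_
  linarith [(le_abs_self _).trans (hDb x), hC 0]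
end Lf

theorem contI {X : Type*} [TopologicalSpace X] {g : X → ℝ} (h1 : ∀ c, IsOpen (g ⁻¹' Ioi c))
    (h2 : ∀ c, IsOpen (g ⁻¹' Iio c)) : Continuous g := by
  rw [continuous_iff_continuousAt]
  intro x
  exact tendsto_order.2 ⟨fun c hc => (h1 c).mem_nhds hc, fun c hc => (h2 c).mem_nhds hc⟩

def cdl {F : ℝ → ℝ} (h : Lf F) : CircleDeg1Lift := ⟨⟨F, h.mono.monotone⟩, h.per⟩

theorem cdl_pow {F : ℝ → ℝ} (h : Lf F) (i : ℕ) (x : ℝ) : (cdl h ^ i) x = F^[i] x := by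
  rw [CircleDeg1Lift.coe_pow]; rfl

theorem cdl_ord {F : ℝ → ℝ} (h : Lf F) :
    (∀ (i : ℕ) (k : ℤ) x, (k:ℝ) < i * (cdl h).translationNumber → x + k < F^[i] x) ∧
    (∀ (i : ℕ) (k : ℤ) x, i * (cdl h).translationNumber < k → F^[i] x < x + k) := by
  constructor
  · intro i k x hk
    rw [← CircleDeg1Lift.translationNumber_pow] at hk
    rw [← cdl_pow h]
    exact CircleDeg1Lift.lt_map_of_int_lt_translationNumber _ hk x
  · intro i k x hk
    rw [← CircleDeg1Lift.translationNumber_pow] at hk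
    rw [← cdl_pow h]
    exact CircleDeg1Lift.map_lt_of_translationNumber_lt_int _ hk x

theorem cdl_cont {f : ℝ → ℝ → ℝ} (h : ∀ t, Lf (f t)) (hc : Continuous fun p : ℝ × ℝ => f p.1 p.2) :
    Continuous fun t => (cdl (h t)).translationNumber := by
  have hit : ∀ (i : ℕ) x, Continuous fun t => (f t)^[i] x := by
    intro i x
    induction i with
    | zero => simpa using continuous_const
    | succ i ih =>
      simp only [Function.iterate_succ_apply']
      exact hc.comp (continuous_id.prodMk ih)
  refine contI (fun c => ?_) (fun c => ?_)
  · rw [isOpen_iff_mem_nhds]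
    intro t ht
    obtain ⟨r, hr1, hr2⟩ := exists_rat_btwn (show c < _ from ht)
    have hden : (0:ℝ) < r.den := by exact_mod_cast r.den_pos
    have hr : (r:ℝ) = r.num / r.den := by exact_mod_cast (Rat.num_div_den r).symm
    rw [hr] at hr1 hr2
    rw [div_lt_iff₀ hden] at hr2
    have h1 := (cdl_ord (h t)).1 r.den r.num 0 (by linarith)
    filter_upwards [(hit r.den 0).continuousAt.eventually (lt_mem_nhds h1)] with s hs
    have h2 : (r.num:ℝ) ≤ (cdl (h s) ^ r.den).translationNumber :=
      CircleDeg1Lift.le_translationNumber_of_add_int_le _ (x := 0) (by rw [cdl_pow]; exact hs.le)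
    rw [CircleDeg1Lift.translationNumber_pow] at h2
    refine hr1.trans_le ?_
    rw [div_le_iff₀ hden]; linarith
  · rw [isOpen_iff_mem_nhds]
    intro t ht
    obtain ⟨r, hr1, hr2⟩ := exists_rat_btwn (show _ < c from ht)
    have hden : (0:ℝ) < r.den := by exact_mod_cast r.den_pos
    have hr : (r:ℝ) = r.num / r.den := by exact_mod_cast (Rat.num_div_den r).symm
    rw [hr] at hr1 hr2
    rw [lt_div_iff₀ hden] at hr1
    have h1 := (cdl_ord (h t)).2 r.den r.num 0 (by linarith)
    filter_upwards [(hit r.den 0).continuousAt.eventually (gt_mem_nhds h1)] with s hs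
    have h2 : (cdl (h s) ^ r.den).translationNumber ≤ (r.num:ℝ) :=
      CircleDeg1Lift.translationNumber_le_of_le_add_int _ (x := 0) (by rw [cdl_pow]; exact hs.le)
    rw [CircleDeg1Lift.translationNumber_pow] at h2
    refine lt_of_le_of_lt ?_ hr2
    rw [le_div_iff₀ hden]; linarith

theorem inv_cont {G K : ℝ → ℝ → ℝ} (h : ∀ t, Lf (G t)) (hK : ∀ t x, G t (K t x) = x)
    (hc : Continuous fun p : ℝ × ℝ => G p.1 p.2) : Continuous fun p : ℝ × ℝ => K p.1 p.2 := by
  refine contI (fun c => ?_) (fun c => ?_)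
  · have : (fun p : ℝ × ℝ => K p.1 p.2) ⁻¹' Ioi c = {p | G p.1 c < p.2} := by
      ext p
      simp only [mem_preimage, mem_Ioi, mem_setOf_eq]
      conv_rhs => rw [← hK p.1 p.2]
      exact (h p.1).mono.lt_iff_lt.symm
    rw [this]
    exact isOpen_lt (hc.comp (continuous_fst.prodMk continuous_const)) continuous_snd
  · have : (fun p : ℝ × ℝ => K p.1 p.2) ⁻¹' Iio c = {p | p.2 < G p.1 c} := by
      ext p
      simp only [mem_preimage, mem_Iio, mem_setOf_eq]
      conv_rhs => rw [← hK p.1 p.2]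
      exact (h p.1).mono.lt_iff_lt.symm
    rw [this]
    exact isOpen_lt continuous_snd (hc.comp (continuous_fst.prodMk continuous_const))

theorem TSEL {G K : ℝ → ℝ → ℝ} (hG : ∀ t, Lf (G t)) (hK : ∀ t, Lf (K t)) (hGK : ∀ t x, G t (K t x) = x)
    (hKG : ∀ t x, K t (G t x) = x)
    (hc : Continuous fun p : ℝ × ℝ => G p.1 p.2) {A F : ℝ → ℝ} (hA : Lf A) (hF : Lf F) {s : ℝ} (hs : 0 ≤ s)
    (h1 : ∀ x, G s (F x) ≤ A x) (h2 : ∀ x, A x ≤ G (-s) (F x)) :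
    ∃ t ∈ Icc (-s) s, (cdl ((hK t).comp hA)).translationNumber = (cdl hF).translationNumber := by
  have hcK := inv_cont hG hGK hc
  have hcf : Continuous fun p : ℝ × ℝ => K p.1 (A p.2) :=
    hcK.comp (continuous_fst.prodMk (hA.sm.continuous.comp continuous_snd))
  have hT := cdl_cont (fun t => (hK t).comp hA) hcf
  have := intermediate_value_Icc (show -s ≤ s by linarith) hT.continuousOn
  apply this
  constructor
  · refine CircleDeg1Lift.translationNumber_mono fun x => ?_
    show K (-s) (A x) ≤ F x
    rw [← hKG (-s) (F x)]
    exact (hK _).mono.monotone (h2 x)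
  · refine CircleDeg1Lift.translationNumber_mono fun x => ?_
    show F x ≤ K s (A x)
    rw [← hKG s (F x)]
    exact (hK _).mono.monotone (h1 x)

def BB (C : ℕ → ℝ) (F : ℝ → ℝ) : Prop := (∀ x, (C 0)⁻¹ ≤ deriv F x) ∧ ∀ j x, |𝒟 (j+1) F x| ≤ C j

def Em (C : ℕ → ℝ) (j : ℕ) : ℝ := ∑ a ∈ Finset.range (j+1), C a
theorem Em_le {C : ℕ → ℝ} (hC : ∀ j, 1 ≤ C j) {a j : ℕ} (h : a ≤ j) : C a ≤ Em C j :=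
  Finset.single_le_sum (f := C) (fun i _ => by linarith [hC i]) (by simp; omega)
theorem Em_one {C : ℕ → ℝ} (hC : ∀ j, 1 ≤ C j) (j : ℕ) : 1 ≤ Em C j := (hC 0).trans (Em_le hC (by omega))

theorem INVS {C : ℕ → ℝ} (hC : ∀ j, 1 ≤ C j) : ∃ C' : ℕ → ℝ, (∀ j, 1 ≤ C' j) ∧ ∀ F K, Sm F → Sm K →
    (∀ x, F (K x) = x) → BB C F → BB C' K := by
  choose D hD h using fun k => INVB (Em C k) (Em_one hC k) k
  refine ⟨fun j => D j + C 0, fun j => by linarith [hD j, hC 0], fun F K hF hK hFK hB => ⟨fun x => ?_, fun j x => ?_⟩⟩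
  · have h1 := dinv hF hK hFK x
    have h2 : deriv F (K x) ≤ C 0 := by
      have := hB.2 0 (K x); rw [zero_add, iteratedDeriv_one] at this; exact (abs_le.1 this).2
    have h3 := hB.1 (K x)
    have h0 := hC 0
    have h4 : 0 < deriv F (K x) := (by positivity : 0 < (C 0)⁻¹).trans_le h3
    rw [eq_inv_of_mul_eq_one_right h1]
    exact inv_anti₀ h4 (by linarith [hD 0])
  · have h0 := hC 0
    have := h j F K hF hK hFK (fun x => (inv_anti₀ (by linarith) (Em_le hC (by omega))).trans (hB.1 x))
      (fun a ha x => (hB.2 a x).trans (Em_le hC ha)) j le_rfl x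
    linarith

theorem COMPS {C D : ℕ → ℝ} (hC : ∀ j, 1 ≤ C j) (hD : ∀ j, 1 ≤ D j) : ∃ C' : ℕ → ℝ, (∀ j, 1 ≤ C' j) ∧
    ∀ F G, Sm F → Sm G → BB C F → BB D G → BB C' (fun x => F (G x)) := by
  choose E hE h using fun k => COMPB (Em C k + Em D k) (by linarith [Em_one hC k, Em_one hD k]) k
  have hCD : 1 ≤ C 0 * D 0 := one_le_mul_of_one_le_of_one_le (hC 0) (hD 0)
  refine ⟨fun j => E j + C 0 * D 0, fun j => by linarith [hE j], fun F G hF hG hB hB' => ⟨fun x => ?_, fun j x => ?_⟩⟩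
  · have := ((hF.diff (G x)).hasDerivAt.comp x (hG.diff x).hasDerivAt).deriv
    change _ ≤ deriv (F ∘ G) x
    rw [this]
    have h1 := hC 0
    have h2 := hD 0
    calc (E 0 + C 0 * D 0)⁻¹ ≤ (C 0 * D 0)⁻¹ := inv_anti₀ (by linarith) (by linarith [hE 0])
      _ = (C 0)⁻¹ * (D 0)⁻¹ := mul_inv _ _
      _ ≤ _ := mul_le_mul (hB.1 _) (hB'.1 _) (by positivity)
        ((by positivity : 0 ≤ (C 0)⁻¹).trans (hB.1 _))
  · have := h j F G hF hG
      (fun a ha x => (hB.2 a x).trans (by linarith [Em_le hC ha, Em_one hD j]))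
      (fun a ha x => (hB'.2 a x).trans (by linarith [Em_le hD ha, Em_one hC j])) j le_rfl x
    linarith

theorem EvBB {α : ℝ} {q : ℕ → ℕ} {p : ℕ → ℤ} {β : ℕ → ℝ} (cf : CF α q p β) {C : ℕ → ℝ} (hC : ∀ j, 1 ≤ C j)
    {F : ℝ → ℝ} (h : Lf F) (hB : BB C F) (ht : (cdl h).translationNumber = α) :
    Ev α q p β (fun j => C (j-1)) F := by
  obtain ⟨h1, h2⟩ := cdl_ord h
  rw [ht] at h1 h2
  refine ⟨cf, h.sm, h.per, fun j => hC _, hB.1, fun j x hj => ?_, h1, h2⟩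
  have := hB.2 (j-1) x
  rwa [Nat.sub_add_cancel hj] at this

theorem perlow {u : ℝ → ℝ} (hu : Continuous u) (hp : ∀ x, u (x+1) = u x) (h : ∀ x, 0 < u x) :
    ∃ c > 0, ∀ x, c ≤ u x := by
  obtain ⟨z, -, hz⟩ := (isCompact_Icc (a := (0:ℝ)) (b := 1)).exists_isMinOn ⟨0, by simp⟩ hu.continuousOn
  refine ⟨u z, h z, fun x => ?_⟩
  have : Function.Periodic u 1 := hp
  obtain ⟨y, hy, hxy⟩ := this.exists_mem_Ico₀ one_pos x
  rw [hxy]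
  exact hz ⟨hy.1, hy.2.le⟩

section fam
variable {ε : ℝ} {Γ : ℝ → ℝ → ℝ}

theorem famPart (hL : ∀ t ∈ Ioo (-ε) ε, Lf (Γ t))
    (hsm : ContDiffOn ℝ (⊤:ℕ∞) (fun p : ℝ × ℝ => Γ p.1 p.2) (Ioo (-ε) ε ×ˢ univ)) (j : ℕ) :
    ContDiffOn ℝ (⊤:ℕ∞) (fun p : ℝ × ℝ => 𝒟 j (Γ p.1) p.2) (Ioo (-ε) ε ×ˢ univ) := by
  have ho : IsOpen (Ioo (-ε) ε ×ˢ (univ : Set ℝ)) := isOpen_Ioo.prod isOpen_univ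
  induction j with
  | zero => simpa using hsm
  | succ j ih =>
    have h1 := (ih.fderiv_of_isOpen ho (m := (⊤:ℕ∞)) (by simp)).clm_apply
      (contDiffOn_const (c := ((0:ℝ), (1:ℝ))))
    refine h1.congr fun p hp => ?_
    have hd : DifferentiableAt ℝ (fun p : ℝ × ℝ => 𝒟 j (Γ p.1) p.2) p :=
      (ih.differentiableOn (by simp)).differentiableAt (ho.mem_nhds hp)
    have h2 : HasDerivAt (fun y : ℝ => (p.1, y)) ((0:ℝ), (1:ℝ)) p.2 :=
      (hasDerivAt_const p.2 p.1).prodMk (hasDerivAt_id p.2)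
    have h3 := HasFDerivAt.comp_hasDerivAt p.2 (f := fun y : ℝ => (p.1, y))
      (l := fun p : ℝ × ℝ => 𝒟 j (Γ p.1) p.2) hd.hasFDerivAt h2
    exact ((hL p.1 hp.1).sm.hda j p.2).unique h3

theorem famB (hL : ∀ t ∈ Ioo (-ε) ε, Lf (Γ t))
    (hsm : ContDiffOn ℝ (⊤:ℕ∞) (fun p : ℝ × ℝ => Γ p.1 p.2) (Ioo (-ε) ε ×ˢ univ)) {τ : ℝ} (hτ : τ < ε) :
    ∃ C : ℕ → ℝ, (∀ j, 1 ≤ C j) ∧ ∀ t ∈ Icc (-τ) τ, BB C (Γ t) := by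
  have hsub : Icc (-τ) τ ×ˢ Icc (0:ℝ) 1 ⊆ Ioo (-ε) ε ×ˢ univ := fun p hp =>
    ⟨⟨by linarith [hp.1.1], by linarith [hp.1.2]⟩, mem_univ _⟩
  have hcpt : IsCompact (Icc (-τ) τ ×ˢ Icc (0:ℝ) 1) := isCompact_Icc.prod isCompact_Icc
  have hc : ∀ j, ContinuousOn (fun p : ℝ × ℝ => 𝒟 j (Γ p.1) p.2) (Icc (-τ) τ ×ˢ Icc (0:ℝ) 1) :=
    fun j => (famPart hL hsm j).continuousOn.mono hsub
  have hred : ∀ t ∈ Icc (-τ) τ, ∀ j x, ∃ y ∈ Icc (0:ℝ) 1, 𝒟 (j+1) (Γ t) x = 𝒟 (j+1) (Γ t) y := by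
    intro t ht j x
    have : Function.Periodic (𝒟 (j+1) (Γ t)) 1 := (hL t ⟨by linarith [ht.1], by linarith [ht.2]⟩).dperi j
    obtain ⟨y, hy, hxy⟩ := this.exists_mem_Ico₀ one_pos x
    exact ⟨y, ⟨hy.1, hy.2.le⟩, hxy⟩
  choose C hC using fun j => hcpt.exists_bound_of_continuousOn (hc (j+1))
  have hpos : ∀ p ∈ Icc (-τ) τ ×ˢ Icc (0:ℝ) 1, 0 < 𝒟 1 (Γ p.1) p.2 := fun p hp => by
    rw [iteratedDeriv_one]; exact (hL p.1 (hsub hp).1).pos _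
  obtain ⟨D, hD⟩ := hcpt.exists_bound_of_continuousOn ((hc 1).inv₀ fun p hp => (hpos p hp).ne')
  refine ⟨fun j => 1 + |C j| + |D|, fun j => by linarith [abs_nonneg (C j), abs_nonneg D],
    fun t ht => ⟨fun x => ?_, fun j x => ?_⟩⟩
  · obtain ⟨y, hy, e⟩ := hred t ht 0 x
    rw [← iteratedDeriv_one]
    rw [zero_add] at e
    rw [e]
    have h1 := hpos (t, y) ⟨ht, hy⟩
    have h2 := hD (t, y) ⟨ht, hy⟩
    refine inv_le_of_inv_le₀ h1 ?_
    have h3 := (le_abs_self _).trans h2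
    exact h3.trans (by linarith [le_abs_self D, abs_nonneg (C 0)])
  · obtain ⟨y, hy, e⟩ := hred t ht j x
    rw [e]
    have h2 := hC j (t, y) ⟨ht, hy⟩
    rw [Real.norm_eq_abs] at h2
    exact h2.trans (by linarith [le_abs_self (C j), abs_nonneg D])

theorem famS (hL : ∀ t ∈ Ioo (-ε) ε, Lf (Γ t))
    (hsm : ContDiffOn ℝ (⊤:ℕ∞) (fun p : ℝ × ℝ => Γ p.1 p.2) (Ioo (-ε) ε ×ˢ univ))
    (hneg : ∀ t ∈ Ioo (-ε) ε, ∀ x, deriv (fun s => Γ s x) t < 0) {n0 : ℤ} (h0 : ∀ x, Γ 0 x = x + n0)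
    {τ : ℝ} (hτ0 : 0 < τ) (hτ : τ < ε) {η : ℝ} (hη : 0 < η) : ∃ s, 0 < s ∧ s ≤ τ ∧
    (∀ t ∈ Icc (-s) s, ∀ x, |Γ t x - n0 - x| ≤ η) ∧ ∃ c > 0, ∀ x, Γ s x - n0 ≤ x - c ∧ x + c ≤ Γ (-s) x - n0 := by
  have hsub : Icc (-τ) τ ×ˢ Icc (0:ℝ) 1 ⊆ Ioo (-ε) ε ×ˢ univ := fun p hp =>
    ⟨⟨by linarith [hp.1.1], by linarith [hp.1.2]⟩, mem_univ _⟩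
  have hcpt : IsCompact (Icc (-τ) τ ×ˢ Icc (0:ℝ) 1) := isCompact_Icc.prod isCompact_Icc
  have huc := hcpt.uniformContinuousOn_of_continuous (hsm.continuousOn.mono hsub)
  rw [Metric.uniformContinuousOn_iff] at huc
  obtain ⟨δ, hδ, hu⟩ := huc η hη
  have hs0 : 0 < min τ (δ/2) := lt_min hτ0 (by linarith)
  have hsτ : min τ (δ/2) ≤ τ := min_le_left _ _
  have hsδ : min τ (δ/2) ≤ δ/2 := min_le_right _ _
  set s := min τ (δ/2) with hs
  have hanti : ∀ x, StrictAntiOn (fun t => Γ t x) (Ioo (-ε) ε) := by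
    intro x
    refine strictAntiOn_of_deriv_neg (convex_Ioo _ _) ?_ (fun t ht => ?_)
    · exact hsm.continuousOn.comp (f := fun t : ℝ => (t, x)) (by fun_prop) fun t ht => ⟨ht, mem_univ _⟩
    · rw [interior_Ioo] at ht; exact hneg t ht x
  have m0 : (0:ℝ) ∈ Ioo (-ε) ε := ⟨by linarith, by linarith⟩
  have ms : s ∈ Ioo (-ε) ε := ⟨by linarith, by linarith⟩
  have ms' : -s ∈ Ioo (-ε) ε := ⟨by linarith, by linarith⟩
  refine ⟨s, hs0, hsτ, fun t ht x => ?_, ?_⟩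
  · have hlt := hL t ⟨by linarith [ht.1], by linarith [ht.2]⟩
    have : Function.Periodic (fun x => Γ t x - n0 - x) 1 := fun x => by
      simp only [hlt.per]; ring
    obtain ⟨y, hy, hxy⟩ := this.exists_mem_Ico₀ one_pos x
    rw [hxy]
    have h1 := hu (t, y) ⟨⟨by linarith [ht.1], by linarith [ht.2]⟩, hy.1, hy.2.le⟩ (0, y)
      ⟨⟨by linarith, by linarith⟩, hy.1, hy.2.le⟩ (by
        simp only [Prod.dist_eq, dist_self, Real.dist_eq, sub_zero]
        have := abs_le.2 ⟨ht.1, ht.2⟩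
        exact max_lt (by linarith) hδ)
    rw [Real.dist_eq] at h1
    simp only [h0] at h1
    calc _ = |Γ t y - (y + n0)| := by ring_nf
      _ ≤ _ := h1.le
  · obtain ⟨c1, hc1, h1⟩ := perlow (u := fun x => x + n0 - Γ s x)
      (by have := (hL s ms).sm.continuous; fun_prop) (fun x => by simp only [(hL s ms).per]; ring) (fun x => by
        have := hanti x m0 ms hs0
        simp only [h0] at this; linarith)
    obtain ⟨c2, hc2, h2⟩ := perlow (u := fun x => Γ (-s) x - (x + n0))
      (by have := (hL _ ms').sm.continuous; fun_prop) (fun x => by simp only [(hL _ ms').per]; ring) (fun x => by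
        have := hanti x ms' m0 (by linarith)
        simp only [h0] at this; linarith)
    refine ⟨min c1 c2, lt_min hc1 hc2, fun x => ⟨?_, ?_⟩⟩
    · linarith [h1 x, min_le_left c1 c2]
    · linarith [h2 x, min_le_right c1 c2]
end fam

theorem dioIrr {α : ℝ} (hd : DiophantineReal α) : Irrational α := by
  obtain ⟨C, hC, n, hn, h⟩ := hd
  rintro ⟨r, rfl⟩
  have h1 := h r.num r.den (by exact_mod_cast r.den_pos.ne')
  have hden : (0:ℝ) < r.den := by exact_mod_cast r.den_pos
  have hr : (r:ℝ) = r.num / r.den := by exact_mod_cast (Rat.num_div_den r).symm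
  have h2 : ((r.den : ℤ) : ℝ) * (r:ℝ) - r.num = 0 := by
    rw [hr]; push_cast; field_simp; ring
  rw [h2, abs_zero] at h1
  have h3 : 0 ≤ C / |((r.den : ℤ) : ℝ)| ^ n := by positivity
  linarith

theorem BB.lip {C : ℕ → ℝ} {F : ℝ → ℝ} (h : BB C F) (hF : Sm F) (x y : ℝ) : |F x - F y| ≤ C 0 * |x - y| :=
  mvtL hF (fun x => by simpa [iteratedDeriv_one] using h.2 0 x) x y

theorem BB.Lf {C : ℕ → ℝ} {F : ℝ → ℝ} (hC : ∀ j, 1 ≤ C j) (h : BB C F) (hF : Sm F)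
    (hp : ∀ x, F (x+1) = F x + 1) : Lf F :=
  ⟨hF, hp, fun x => (by have := hC 0; positivity : 0 < (C 0)⁻¹).trans_le (h.1 x)⟩

set_option maxHeartbeats 1000000 in
theorem MAIN {ε : ℝ} (hε : 0 < ε) {Γ : ℝ → ℝ → ℝ} (hL : ∀ t ∈ Ioo (-ε) ε, Lf (Γ t))
    (hsm : ContDiffOn ℝ (⊤:ℕ∞) (fun p : ℝ × ℝ => Γ p.1 p.2) (Ioo (-ε) ε ×ˢ univ))
    (hneg : ∀ t ∈ Ioo (-ε) ε, ∀ x, deriv (fun s => Γ s x) t < 0) {n0 : ℤ} (h0 : ∀ x, Γ 0 x = x + n0)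
    {F : ℝ → ℝ} (hF : Lf F) {α : ℝ} (hα : (cdl hF).translationNumber = α) (hd : DiophantineReal α)
    (k : ℕ) {e : ℝ} (he : 0 < e) {E : ℕ → ℝ} (hE : ∀ j, 1 ≤ E j) : ∃ η > 0, ∀ A, Lf A → BB E A →
    (∀ x, |A x - F x| ≤ η) → ∃ t b, |t| < e ∧ t ∈ Ioo (-ε) ε ∧ Lf b ∧
    (∀ j ≤ k, ∀ x, |𝒟 j (fun y => b y - y) x| ≤ e) ∧ ∀ x, A (b x) = Γ t (b (F x)) - n0 := by
  obtain ⟨q, p, β, cf⟩ := exists_CF (dioIrr hd)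
  set τ := min e ε / 2 with hτ
  have hmin : 0 < min e ε := lt_min he hε
  have hτ0 : 0 < τ := by rw [hτ]; linarith
  have hτe : τ < e := by rw [hτ]; linarith [min_le_left e ε]
  have hτε : τ < ε := by rw [hτ]; linarith [min_le_right e ε]
  obtain ⟨C1, hC1, hB1⟩ := famB hL hsm hτε
  obtain ⟨C2, hC2, hB2⟩ := INVS hC1
  obtain ⟨C3, hC3, hB3⟩ := COMPS hC2 hE
  obtain ⟨C4, hC4, hB4⟩ := Ev.Hex (B := fun j => C3 (j-1)) cf hd
  obtain ⟨D0, hD0, hBF⟩ := hF.exB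
  have hEF := EvBB cf hD0 hF hBF hα
  obtain ⟨D1, hD1, hHF⟩ := Ev.Hex (B := fun j => D0 (j-1)) cf hd
  obtain ⟨H0, hH0, hH0F, hH0p, hH00, hBH0⟩ := hHF F hEF
  have hLH0 : Lf H0 := BB.Lf hD1 hBH0 hH0 hH0p
  obtain ⟨C5, hC5, hB5⟩ := INVS hC4
  obtain ⟨C6, hC6, hB6⟩ := COMPS hC5 hD1
  obtain ⟨Ko, hKo, hosc⟩ := Ev.osc (B := fun j => D0 (j-1)) cf hd
  obtain ⟨U, hU, hSm⟩ := SMALL k (C6 k + 1) e (by linarith [hC6 k]) he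
  have p4 := hC4 0
  have p5 := hC5 0
  have pD := hD1 0
  have he1 : 0 < U / C5 0 := by positivity
  set e1 := U / C5 0 with he1'
  have hX : 0 < (C4 0 + D1 0) * Ko := by positivity
  obtain ⟨n, hn⟩ := (cf.blim.eventually (gt_mem_nhds
    (by positivity : 0 < e1 / 2 / ((C4 0 + D1 0) * Ko)))).exists
  rw [lt_div_iff₀ hX] at hn
  have hq : (0:ℝ) < q n + q (n+1) := by linarith [cf.qR n, cf.qR (n+1)]
  set η' := e1 / 2 / ((q n + q (n+1)) * C4 0) with hη'
  have hη0 : 0 < η' := by positivity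
  have hη1 : (q n + q (n+1)) * (C4 0 * η') = e1 / 2 := by
    rw [hη']; field_simp
  obtain ⟨s, hs0, hsτ, hsm1, c, hc, hgap⟩ := famS hL hsm hneg h0 hτ0 hτε (half_pos hη0)
  refine ⟨min c (η'/2), lt_min hc (by linarith), fun A hA hBA hAF => ?_⟩
  -- family
  let cl : ℝ → ℝ := fun t => max (-s) (min s t)
  have hcl : ∀ t, cl t ∈ Icc (-s) s := fun t =>
    ⟨le_max_left _ _, max_le (by linarith) (min_le_left _ _)⟩
  have hclI : ∀ t, cl t ∈ Ioo (-ε) ε := fun t => ⟨by linarith [(hcl t).1], by linarith [(hcl t).2]⟩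
  have hcls : ∀ t ∈ Icc (-s) s, cl t = t := fun t ht => by
    simp only [cl]; rw [min_eq_right ht.2, max_eq_right ht.1]
  let G : ℝ → ℝ → ℝ := fun t x => Γ (cl t) x - n0
  have hG : ∀ t, Lf (G t) := fun t => by
    have h := hL _ (hclI t)
    refine ⟨h.sm.sub contDiff_const, fun x => by simp only [G, h.per]; ring, fun x => ?_⟩
    simp only [G, deriv_sub_const]
    exact h.pos x
  have hGB : ∀ t, BB C1 (G t) := fun t => by
    have h := hB1 (cl t) ⟨by linarith [(hcl t).1], by linarith [(hcl t).2]⟩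
    refine ⟨fun x => ?_, fun j x => ?_⟩
    · simp only [G, deriv_sub_const]
      exact h.1 x
    · have := h.2 j x
      rwa [← dsubc (hL _ (hclI t)).sm n0] at this
  have hGc : Continuous fun p : ℝ × ℝ => G p.1 p.2 := by
    have h1 : Continuous fun p : ℝ × ℝ => (cl p.1, p.2) := by simp only [cl]; fun_prop
    exact (hsm.continuousOn.comp_continuous h1 fun p => ⟨hclI _, mem_univ _⟩).sub continuous_const
  choose K hK hGK hKG using fun t => (hG t).inv
  have hAF' : ∀ x, |A x - F x| ≤ c := fun x => (hAF x).trans (min_le_left _ _)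
  obtain ⟨t, ht, htn⟩ := TSEL hG hK hGK hKG hGc hA hF hs0.le
    (fun x => by
      have h1 := (hgap (F x)).1
      have h2 := (abs_le.1 (hAF' x)).1
      simp only [G]; rw [hcls s ⟨by linarith, le_rfl⟩]; linarith)
    (fun x => by
      have h1 := (hgap (F x)).2
      have h2 := (abs_le.1 (hAF' x)).2
      simp only [G]; rw [hcls (-s) ⟨le_rfl, by linarith⟩]; linarith)
  rw [hα] at htn
  have hLf : Lf fun x => K t (A x) := (hK t).comp hA
  have hBf : BB C3 fun x => K t (A x) :=
    hB3 _ _ (hK t).sm hA.sm (hB2 _ _ (hG t).sm (hK t).sm (hGK t) (hGB t)) hBA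
  have hEf := EvBB cf hC3 hLf hBf htn
  obtain ⟨H, hH, hHf, hHp, hH00', hBH⟩ := hB4 _ hEf
  have hLH : Lf H := BB.Lf hC4 hBH hH hHp
  obtain ⟨I, hI, hHI, hIH⟩ := hLH.inv
  have hBI : BB C5 I := hB5 H I hH hI.sm hHI hBH
  have hfF : ∀ x, |K t (A x) - F x| ≤ η' := by
    intro x
    have h1 := hsm1 (cl t) (hcl t) (K t (A x))
    have h2 : Γ (cl t) (K t (A x)) - n0 = A x := hGK t (A x)
    rw [h2] at h1
    have h3 := (hAF x).trans (min_le_right _ _)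
    rw [abs_le] at *
    constructor <;> linarith
  have hdiff : ∀ x, |H x - H0 x| ≤ e1 := by
    intro x
    have h1 := hosc F hEF (fun x => H x - H0 x) (C4 0 + D1 0) (C4 0 * η')
      (fun x => by simp only [hHp, hH0p]; ring)
      (fun x y => by
        have a1 := BB.lip hBH hH x y
        have a2 := BB.lip hBH0 hH0 x y
        calc _ = |(H x - H y) - (H0 x - H0 y)| := by ring_nf
          _ ≤ |H x - H y| + |H0 x - H0 y| := abs_sub _ _
          _ ≤ _ := by linarith)
      (fun x => by
        have a1 := BB.lip hBH hH (F x) (K t (A x))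
        have a2 : |F x - K t (A x)| ≤ η' := by rw [abs_sub_comm]; exact hfF x
        have a3 : H (K t (A x)) = H x + α := hHf x
        have a4 := hH0F x
        calc _ = |H (F x) - H (K t (A x))| := by rw [a3, a4]; ring_nf
          _ ≤ C4 0 * |F x - K t (A x)| := a1
          _ ≤ _ := by gcongr) n 0 x
    simp only [hH00, hH00', sub_zero] at h1
    refine h1.trans ?_
    rw [hη1]
    have : (C4 0 + D1 0) * (Ko * β n) = β n * ((C4 0 + D1 0) * Ko) := by ring
    linarith
  have hLb : Lf fun x => I (H0 x) := hI.comp hLH0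
  have hBb : BB C6 fun x => I (H0 x) := hB6 _ _ hI.sm hH0 hBI hBH0
  have htI : t ∈ Ioo (-ε) ε := ⟨by linarith [ht.1], by linarith [ht.2]⟩
  refine ⟨t, fun x => I (H0 x), ?_, htI, hLb, ?_, fun x => ?_⟩
  · have := abs_le.2 ⟨ht.1, ht.2⟩; linarith
  · refine hSm (fun y => I (H0 y) - y) (hLb.sm.sub contDiff_id) (fun x => ?_) (fun x => ?_)
    · have h1 := BB.lip hBI hI.sm (H0 x) (H x)
      rw [hIH] at h1
      refine h1.trans ?_
      have h2 := hdiff x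
      rw [abs_sub_comm] at h2
      calc _ ≤ C5 0 * e1 := by gcongr
        _ = U := by rw [he1']; field_simp
    · rw [dsub (u := fun y => I (H0 y)) (v := fun y => y) hLb.sm contDiff_id]
      have h1 := hBb.2 k x
      have h2 : |𝒟 (k+1) (fun y : ℝ => y) x| ≤ 1 := by
        rw [dsucc]
        simp only [deriv_id'']
        rw [iteratedDeriv_const]
        split_ifs <;> simp
      exact (abs_sub _ _).trans (by linarith)
  · have h1 : K t (A (I (H0 x))) = I (H0 (F x)) := by
      apply hLH.mono.injective
      have a3 : H (K t (A (I (H0 x)))) = H (I (H0 x)) + α := hHf _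
      rw [a3, hHI, hHI, hH0F]
    have h2 := hGK t (A (I (H0 x)))
    rw [h1] at h2
    simp only [G] at h2
    rw [hcls t ht] at h2
    exact h2.symm

theorem intconst {u : ℝ → ℝ} (hu : Continuous u) (h : ∀ x, ∃ n : ℤ, u x = n) : ∃ n : ℤ, ∀ x, u x = n := by
  choose n hn using h
  refine ⟨n 0, fun x => ?_⟩
  have key : ∀ a b : ℝ, n a < n b → False := by
    intro a b hab
    have h1 : ((n a : ℝ)) + 1 ≤ n b := by exact_mod_cast hab
    obtain ⟨c, hc⟩ := mem_range_of_exists_le_of_exists_ge hu (c := (n a : ℝ) + 1/2)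
      ⟨a, by rw [hn a]; linarith⟩ ⟨b, by rw [hn b]; linarith⟩
    rw [hn c] at hc
    have h2 : ((2 * n c : ℤ) : ℝ) = ((2 * n a + 1 : ℤ) : ℝ) := by push_cast; linarith
    have h3 : 2 * n c = 2 * n a + 1 := by exact_mod_cast h2
    omega
  rw [hn x]
  rcases lt_trichotomy (n x) (n 0) with h | h | h
  · exact (key _ _ h).elim
  · rw [h]
  · exact (key _ _ h).elim

theorem s1eq {x y : ℝ} : (x : S1) = (y : S1) ↔ ∃ n : ℤ, x - y = n := by
  rw [← sub_eq_zero, ← AddCircle.coe_sub, AddCircle.coe_eq_zero_iff]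
  simp only [zsmul_eq_mul, mul_one]
  exact exists_congr fun n => eq_comm

theorem IsLift.lf {f : Equiv.Perm S1} {F : ℝ → ℝ} (h : IsLift f F) : Lf F := ⟨h.1, h.2.1, h.2.2.1⟩

theorem IsLift.intdiff {f : Equiv.Perm S1} {F G : ℝ → ℝ} (h : IsLift f F) (h' : IsLift f G) :
    ∃ n : ℤ, ∀ x, F x - G x = n :=
  intconst (h.1.continuous.sub h'.1.continuous) fun x => s1eq.1 ((h.2.2.2 x).symm.trans (h'.2.2.2 x))

theorem id_lift : IsLift 1 (fun x => x) :=
  ⟨contDiff_id, fun _ => rfl, fun x => by simp, fun _ => rfl⟩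

theorem IsLift.subint {f : Equiv.Perm S1} {F : ℝ → ℝ} (h : IsLift f F) (n : ℤ) : IsLift f (fun x => F x - n) := by
  refine ⟨h.1.sub contDiff_const, fun x => ?_, fun x => ?_, fun x => ?_⟩
  · simp only [h.2.1]; ring
  · rw [deriv_sub_const]; exact h.2.2.1 x
  · rw [h.2.2.2 x]; exact s1eq.2 ⟨n, by ring⟩

theorem ldle {F G : ℝ → ℝ} (hF : Lf F) (hG : Lf G) {j k : ℕ} (hj : j ≤ k) (x : ℝ) :
    |𝒟 j F x - 𝒟 j G x| ≤ liftDist k F G := by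
  have hbd : ∃ C : ℝ, ∀ y, |𝒟 j F y - 𝒟 j G y| ≤ C := by
    have h1 : ∀ y, 𝒟 j F y - 𝒟 j G y = 𝒟 j (fun z => F z - G z) y := fun y => by
      rw [dsub hF.sm hG.sm]
    have hp : Function.Periodic (𝒟 j (fun z => F z - G z)) 1 :=
      fun y => dperi (fun z => by rw [hF.per, hG.per]; ring) j y
    have hc : Continuous (𝒟 j (fun z => F z - G z)) := (Sm.iter (hF.sm.sub hG.sm) j).continuous
    obtain ⟨C, hC⟩ := (isCompact_Icc (a := (0:ℝ)) (b := 1)).exists_bound_of_continuousOn hc.continuousOn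
    refine ⟨C, fun y => ?_⟩
    obtain ⟨z, hz, hzy⟩ := hp.exists_mem_Ico₀ one_pos y
    rw [h1, hzy]
    exact hC z ⟨hz.1, hz.2.le⟩
  obtain ⟨C, hC⟩ := hbd
  have h1 : |𝒟 j F x - 𝒟 j G x| ≤ ⨆ y : ℝ, |𝒟 j F y - 𝒟 j G y| :=
    le_ciSup (f := fun y => |𝒟 j F y - 𝒟 j G y|) ⟨C, by rintro _ ⟨y, rfl⟩; exact hC y⟩ x
  refine h1.trans ?_
  exact le_ciSup (f := fun i : Fin (k+1) => ⨆ y : ℝ, |𝒟 (i:ℕ) F y - 𝒟 (i:ℕ) G y|)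
    (Set.finite_range _).bddAbove ⟨j, by omega⟩

theorem exA {a a₀ : Equiv.Perm S1} {F0 : ℝ → ℝ} (h0 : IsLift a₀ F0) (ha : HasLift a) {i : ℕ} {δ : ℝ}
    (hd : distC i a a₀ < δ) : ∃ A, IsLift a A ∧ ∀ j ≤ i, ∀ x, |𝒟 j A x - 𝒟 j F0 x| ≤ δ := by
  obtain ⟨A', hA'⟩ := ha
  have hne : {d | ∃ F G, IsLift a F ∧ IsLift a₀ G ∧ d = liftDist i F G}.Nonempty := ⟨_, A', F0, hA', h0, rfl⟩
  obtain ⟨d, ⟨A, G, hA, hG, rfl⟩, hlt⟩ := exists_lt_of_csInf_lt hne hd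
  obtain ⟨n, hn⟩ := hG.intdiff h0
  refine ⟨_, hA.subint n, fun j hj x => ?_⟩
  have h1 : 𝒟 j (fun x => A x - n) x - 𝒟 j F0 x = 𝒟 j A x - 𝒟 j G x := by
    have e : F0 = fun x => G x - n := funext fun x => by linarith [hn x]
    cases j with
    | zero => simp only [iteratedDeriv_zero]; linarith [hn x]
    | succ j => rw [e, dsubc hA.1, dsubc hG.1]
  rw [h1]
  exact (ldle hA.lf hG.lf hj x).trans hlt.le

theorem distle {b : Equiv.Perm S1} {B : ℝ → ℝ} (hB : IsLift b B) {k : ℕ} {e : ℝ}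
    (h : ∀ j ≤ k, ∀ x, |𝒟 j (fun y => B y - y) x| ≤ e) : distC k b 1 ≤ e := by
  have h1 : liftDist k B (fun x => x) ≤ e := by
    refine ciSup_le fun j => ciSup_le fun x => ?_
    have := h j (by omega) x
    rwa [dsub hB.1 (show Sm (fun y => y) from contDiff_id)] at this
  refine le_trans (?_ : sInf {d | ∃ F G, IsLift b F ∧ IsLift 1 G ∧ d = liftDist k F G} ≤ _) h1
  refine csInf_le ⟨0, ?_⟩ ⟨B, _, hB, id_lift, rfl⟩
  rintro _ ⟨F, G, -, -, rfl⟩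
  exact Real.iSup_nonneg fun j => Real.iSup_nonneg fun x => abs_nonneg _

theorem mkperm {B : ℝ → ℝ} (hB : Lf B) : ∃ b : Equiv.Perm S1, IsLift b B := by
  obtain ⟨K, hK, h1, h2⟩ := hB.inv
  have per : ∀ {B : ℝ → ℝ}, Lf B → Function.Periodic (fun x => ((B x : ℝ) : S1)) 1 := fun hB x => by
    simp only [hB.per]; exact AddCircle.coe_add_period 1 _
  refine ⟨⟨(per hB).lift, (per hK).lift, fun x => ?_, fun x => ?_⟩, hB.sm, hB.per, hB.pos, fun x => rfl⟩
  · induction x using QuotientAddGroup.induction_on with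
    | H z => change ((K (B z) : ℝ) : S1) = z; rw [h2]
  · induction x using QuotientAddGroup.induction_on with
    | H z => change ((B (K z) : ℝ) : S1) = z; rw [h1]

theorem dioshift {s t : ℝ} (m : ℤ) (h : DiophantineReal s) (hm : s - t = m) : DiophantineReal t := by
  obtain ⟨C, hC, n, hn, h⟩ := h
  refine ⟨C, hC, n, hn, fun p q hq => ?_⟩
  have := h (p + q * m) q hq
  have e : (q:ℝ) * s - ((p + q * m : ℤ) : ℝ) = q * t - p := by
    push_cast; rw [← hm]; ring
  rwa [e] at this

theorem unifB {F : ℝ → ℝ} {A : ℕ → ℝ → ℝ} (hF : Lf F) (hA : ∀ i, Lf (A i))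
    (h : ∀ i, ∀ j ≤ i, ∀ x, |𝒟 j (A i) x - 𝒟 j F x| ≤ 1 / ((i:ℝ) + 1)) :
    ∃ E : ℕ → ℝ, (∀ j, 1 ≤ E j) ∧ ∀ i, BB E (A i) := by
  obtain ⟨C, hC1, hCl, hC⟩ := hF.exB
  have hB := fun i => (hA i).exB
  choose B hB1 hBl hBb using hB
  obtain ⟨N, hN⟩ := exists_nat_one_div_lt (show 0 < (C 0)⁻¹ / 2 by have := hC1 0; positivity)
  have hS : ∀ j n, 0 ≤ ∑ i ∈ Finset.range n, B i j := fun j n =>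
    Finset.sum_nonneg fun i _ => by linarith [hB1 i j]
  have hS' : ∀ j n i, i < n → B i j ≤ ∑ i ∈ Finset.range n, B i j := fun j n i hi =>
    Finset.single_le_sum (f := fun i => B i j) (fun i _ => by linarith [hB1 i j]) (Finset.mem_range.2 hi)
  refine ⟨fun j => 2 * C 0 + C j + 1 + ∑ i ∈ Finset.range (j + 2 + N), B i j, fun j => ?_, fun i => ⟨fun x => ?_, fun j x => ?_⟩⟩
  · linarith [hC1 0, hC1 j, hS j (j+2+N)]
  · by_cases hi : i < 0 + 2 + N
    · refine le_trans (inv_anti₀ (by linarith [hB1 i 0]) ?_) (hBl i x)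
      linarith [hC1 0, hS' 0 _ i hi]
    · have h1 := h i 1 (by omega) x
      rw [iteratedDeriv_one, iteratedDeriv_one] at h1
      have h2 : 1 / ((i:ℝ) + 1) ≤ 1 / ((N:ℝ) + 1) := by
        apply one_div_le_one_div_of_le (by positivity)
        have : (N:ℝ) ≤ i := by exact_mod_cast (by omega : N ≤ i)
        linarith
      have h3 := hCl x
      have h4 := (abs_le.1 h1).1
      have h5 : (2 * C 0 + C 0 + 1 + ∑ i ∈ Finset.range (0 + 2 + N), B i 0)⁻¹ ≤ (2 * C 0)⁻¹ :=
        inv_anti₀ (by linarith [hC1 0]) (by linarith [hC1 0, hS 0 (0+2+N)])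
      have h6 : (2 * C 0)⁻¹ = (C 0)⁻¹ / 2 := by rw [mul_inv]; ring
      linarith
  · by_cases hi : i < j + 2 + N
    · refine (hBb i j x).trans ?_
      linarith [hC1 0, hC1 j, hS' j _ i hi]
    · have h1 := h i (j+1) (by omega) x
      have h2 : 1 / ((i:ℝ) + 1) ≤ 1 := by
        rw [div_le_one (by positivity)]; linarith [Nat.cast_nonneg (α := ℝ) i]
      have h3 := abs_le.1 (h1.trans h2)
      have h4 := abs_le.1 (hC j x)
      have h5 := hS j (j+2+N)
      have h6 := hC1 0
      rw [abs_le]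
      constructor <;> linarith

/-- let `γ_t` be a smooth family of circle diffeomorphisms with `γ₀ = id` and
`∂γ/∂t < 0` (in a lift `Γ`), and let `a₀` have Diophantine rotation number. Then every `a`
sufficiently C^{k'}-close to `a₀` can be written as `γ_t ∘ b ∘ a₀ ∘ b⁻¹` with `t` small
and `b` C^k-close to the identity. -/
theorem theorem_yoc (ε : ℝ) (hε : 0 < ε)
    (γ : ℝ → Equiv.Perm S1) (Γ : ℝ → ℝ → ℝ)
    (hlift : ∀ t ∈ Set.Ioo (-ε) ε, IsLift (γ t) (Γ t))
    (hsmooth : ContDiffOn ℝ (⊤ : ℕ∞) (fun p : ℝ × ℝ => Γ p.1 p.2)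
      (Set.Ioo (-ε) ε ×ˢ (Set.univ : Set ℝ)))
    (hγ0 : γ 0 = 1)
    (hneg : ∀ t ∈ Set.Ioo (-ε) ε, ∀ x : ℝ, deriv (fun s => Γ s x) t < 0)
    (a₀ : Equiv.Perm S1) (ha₀ : HasLift a₀)
    (t₀ : S1) (ht₀ : Diophantine t₀) (hrot : HasRotNum a₀ t₀) :
    ∀ k : ℕ, ∀ ε' : ℝ, 0 < ε' → ∃ k' : ℕ, ∃ δ : ℝ, 0 < δ ∧
      ∀ a : Equiv.Perm S1, HasLift a → distC k' a a₀ < δ →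
        ∃ t : ℝ, ∃ b : Equiv.Perm S1, |t| < ε' ∧ t ∈ Set.Ioo (-ε) ε ∧
          HasLift b ∧ distC k b 1 < ε' ∧ a = γ t * b * a₀ * b⁻¹ := by
  intro k ε' hε'
  by_contra hcon
  push Not at hcon
  have h00 : (0:ℝ) ∈ Set.Ioo (-ε) ε := ⟨by linarith, hε⟩
  obtain ⟨F0, τ, hF0, hτ, hten⟩ := hrot
  obtain ⟨s, hs, hds⟩ := ht₀
  obtain ⟨m, hm⟩ := s1eq.1 (hs.trans hτ.symm)
  have hdτ : DiophantineReal τ := dioshift m hds hm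
  have htr : (cdl hF0.lf).translationNumber = τ :=
    CircleDeg1Lift.translationNumber_eq_of_tendsto₀ _ hten
  have hΓ0 := hlift 0 h00
  rw [hγ0] at hΓ0
  obtain ⟨n0, hn0⟩ := hΓ0.intdiff id_lift
  have hseq := fun i : ℕ => hcon i (1 / ((i:ℝ) + 1)) (by positivity)
  choose a haL had hno using hseq
  have hA := fun i => exA hF0 (haL i) (had i)
  choose A hAl hAd using hA
  obtain ⟨E, hE1, hEB⟩ := unifB hF0.lf (fun i => (hAl i).lf) hAd
  obtain ⟨η, hη, hmain⟩ := MAIN hε (fun t ht => (hlift t ht).lf) hsmooth hneg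
    (n0 := n0) (fun x => by linarith [hn0 x]) hF0.lf htr hdτ k (half_pos hε') hE1
  obtain ⟨i, hi⟩ := exists_nat_one_div_lt hη
  obtain ⟨t, B, ht, htI, hB, hBk, heq⟩ := hmain (A i) (hAl i).lf (hEB i) (fun x => by
    have := hAd i 0 (by omega) x
    simp only [iteratedDeriv_zero] at this
    linarith)
  obtain ⟨b, hb⟩ := mkperm hB
  refine hno i t b (by linarith) htI ⟨B, hb⟩ ((distle hb hBk).trans_lt (by linarith)) ?_
  rw [eq_mul_inv_iff_mul_eq]
  refine Equiv.ext fun y => ?_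
  induction y using QuotientAddGroup.induction_on with
  | H z =>
    change a i (b (z : S1)) = γ t (b (a₀ (z : S1)))
    rw [hb.2.2.2, (hAl i).2.2.2, hF0.2.2.2, hb.2.2.2, (hlift t htI).2.2.2, heq]
    exact s1eq.2 ⟨-n0, by push_cast; ring⟩

end
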